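/- arXiv:2509.19095 — 2 statements merged into one kernel-verified Lean document; each statement's English description precedes it below -/
import Mathlib

section
/- Let n ≥ 2, 1 ≤ k ≤ n−1 and ℓ ≥ 1 be integers, and set d = n / gcd(n, ℓ). If D ⊆ C([n], k) is a ρ^ℓ-symmetric weakly separated collection that is maximal with respect to inclusion among weakly separated collections in C([n], k), then k ≡ c (mod d) for some c ∈ {−1, 0, 1}. -/
open Finset

/-- `x +_n t`: add `t` to `x ∈ [n] = {1,…,n}` modulo `n`, with representative in `[n]`. -/
def shiftMod (n t x : ℕ) : ℕ := (x + t - 1) % n + 1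

/-- `S +_n t`: add `t` to every element of `S ⊆ [n]` modulo `n`. -/
def shiftSet (n t : ℕ) (S : Finset ℕ) : Finset ℕ := S.image (shiftMod n t)

/-- `x +_n t` for an integer shift `t`. -/
def shiftModZ (n : ℕ) (t : ℤ) (x : ℕ) : ℕ := ((((x : ℤ) + t - 1) % (n : ℤ)) + 1).toNat

/-- `S +_n t` for an integer shift `t`. -/
def shiftSetZ (n : ℕ) (t : ℤ) (S : Finset ℕ) : Finset ℕ := S.image (shiftModZ n t)

/-- Two sets `S`, `T` are weakly separated if there are no `a < b < c < d` with
`a, c ∈ S \ T` and `b, d ∈ T \ S`, nor with the roles of `S` and `T` exchanged. -/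
def WeaklySeparated (S T : Finset ℕ) : Prop :=
  ¬ ∃ a b c d : ℕ, a < b ∧ b < c ∧ c < d ∧
    ((a ∈ S \ T ∧ c ∈ S \ T ∧ b ∈ T \ S ∧ d ∈ T \ S) ∨
     (a ∈ T \ S ∧ c ∈ T \ S ∧ b ∈ S \ T ∧ d ∈ S \ T))

/-- The cyclic successor of `x` in a finite set `P ⊆ ℕ`: the least element of `P`
greater than `x` if one exists, and otherwise the least element of `P`. -/
def cyclicSucc (P : Finset ℕ) (x : ℕ) : ℕ :=
  if h : (P.filter (fun y => x < y)).Nonempty then (P.filter (fun y => x < y)).min' h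
  else if h2 : P.Nonempty then P.min' h2 else 0

open scoped Classical in
/-- The cyclic interval of `P` from `u` to `v`:
`{u, S_P(u), …, S_P^m(u)}` where `m ≥ 0` is minimal with `S_P^m(u) = v`. -/
noncomputable def cyclicIntervalTo (P : Finset ℕ) (u v : ℕ) : Finset ℕ :=
  if h : ∃ m : ℕ, (cyclicSucc P)^[m] u = v then
    (Finset.range (Nat.find h + 1)).image (fun j => (cyclicSucc P)^[j] u)
  else ∅

/-- The orbit `ā = {a + iℓ : 0 ≤ i ≤ d−1} ⊆ [dℓ]` of `a ∈ [ℓ]`. -/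
def orbit (d ℓ a : ℕ) : Finset ℕ := (Finset.range d).image (fun i => a + i * ℓ)

/-- `P_s = [n] \ (ā_{a_1} ∪ … ∪ ā_{a_{s−1}})`, where `n = dℓ`. -/
def Pset (d ℓ : ℕ) (a : ℕ → ℕ) (s : ℕ) : Finset ℕ :=
  Finset.Icc 1 (d * ℓ) \ (Finset.Icc 1 (s - 1)).biUnion (fun i => orbit d ℓ (a i))

/-- `P_{s,h} = P_s \ {a_s +_n hℓ, …, a_s +_n (d−1)ℓ}` for `1 ≤ h ≤ d−1`; `P_{s,d} = P_s`. -/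
def Psh (d ℓ : ℕ) (a : ℕ → ℕ) (s h : ℕ) : Finset ℕ :=
  Pset d ℓ a s \ (Finset.Ico h d).image (fun j => shiftMod (d * ℓ) (j * ℓ) (a s))

/-- `I(i,h) = {i, S_{P_{s,h}}(i), S_{P_{s,h}}²(i), …, S_{P_{s,h}}^{k−1}(i)}`. -/
def Iih (d ℓ k : ℕ) (a : ℕ → ℕ) (s h i : ℕ) : Finset ℕ :=
  (Finset.range k).image (fun j => (cyclicSucc (Psh d ℓ a s h))^[j] i)

/-- `B_s = {I(i,h) : i` in the cyclic interval of `P_s` from `S_{P_s}(a_s +_n (n−ℓ))` to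
`a_s`, `1 ≤ h ≤ d`, `|I(i,h)| = k}`. -/
noncomputable def Bset (d ℓ k : ℕ) (a : ℕ → ℕ) (s : ℕ) : Finset (Finset ℕ) :=
  (((cyclicIntervalTo (Pset d ℓ a s)
        (cyclicSucc (Pset d ℓ a s) (shiftMod (d * ℓ) (d * ℓ - ℓ) (a s)))
        (a s)) ×ˢ (Finset.Icc 1 d)).image
      (fun p => Iih d ℓ k a s p.2 p.1)).filter (fun I => I.card = k)

/-- `L_s = {I +_n xℓ : I ∈ B_s, 1 ≤ x ≤ d}`. -/
noncomputable def Lset (d ℓ k : ℕ) (a : ℕ → ℕ) (s : ℕ) : Finset (Finset ℕ) :=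
  ((Bset d ℓ k a s) ×ˢ (Finset.Icc 1 d)).image (fun p => shiftSet (d * ℓ) (p.2 * ℓ) p.1)

/-- The output collection `D = L_1 ∪ … ∪ L_{ℓ−r+1}`. -/
noncomputable def Dcol (d ℓ k r : ℕ) (a : ℕ → ℕ) : Finset (Finset ℕ) :=
  (Finset.Icc 1 (ℓ - r + 1)).biUnion (fun s => Lset d ℓ k a s)

/-- The map `F : [n] → [dℓ]`, `F(a + gx) = a + ℓx` for `1 ≤ a ≤ g`, `0 ≤ x ≤ d−1`. -/
def Fmap (g ℓ y : ℕ) : ℕ := (y - 1) % g + 1 + ℓ * ((y - 1) / g)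

section WeakSeparation

theorem WeaklySeparated.symm {S T : Finset ℕ} (h : WeaklySeparated S T) :
    WeaklySeparated T S := by
  rintro ⟨a, b, c, d, hab, hbc, hcd, h1 | h1⟩
  · exact h ⟨a, b, c, d, hab, hbc, hcd, Or.inr h1⟩
  · exact h ⟨a, b, c, d, hab, hbc, hcd, Or.inl h1⟩

theorem WeaklySeparated.not_cross {S T : Finset ℕ} (h : WeaklySeparated S T) {a b c d : ℕ}
    (hab : a < b) (hbc : b < c) (hcd : c < d) (ha : a ∈ S) (ha' : a ∉ T) (hb : b ∈ T)
    (hb' : b ∉ S) (hc : c ∈ S) (hc' : c ∉ T) (hd : d ∈ T) (hd' : d ∉ S) : False :=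
  h ⟨a, b, c, d, hab, hbc, hcd, Or.inl (by simp [*])⟩

/-- A sequence of sets `S 0, …, S m` in `D`, each containing all of `K` between two of its own
elements `u i < v i`, the intervals `[u i, v i]` overlapping consecutively. -/
structure HullChain (D : Finset (Finset ℕ)) (K : Finset ℕ) (m : ℕ) (S : ℕ → Finset ℕ)
    (u v : ℕ → ℕ) : Prop where
  mem : ∀ i ≤ m, S i ∈ D
  left : ∀ i ≤ m, u i ∈ S i
  right : ∀ i ≤ m, v i ∈ S i
  lt : ∀ i ≤ m, u i < v i
  hull : ∀ i ≤ m, ∀ t ∈ K, u i ≤ t → t ≤ v i → t ∈ S i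
  u_lt : ∀ i < m, u i < u (i + 1)
  v_lt : ∀ i < m, v i < v (i + 1)
  u_lt_v : ∀ i < m, u (i + 1) < v i
  u_not_mem : ∀ i < m, u (i + 1) ∉ S i
  v_not_mem : ∀ i < m, v i ∉ S (i + 1)

/-- `S i ⊆ S (i + 1)` on the part of the circle after `φ` and before `u (i + 1)`. -/
def LeftDom (S : ℕ → Finset ℕ) (u : ℕ → ℕ) (φ i : ℕ) : Prop :=
  ∀ t ∈ S i, (φ < t ∨ t < u (i + 1)) → t ∈ S (i + 1)

/-- `S (i + 1) ⊆ S i` on the part of the circle after `v i` and up to `φ`. -/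
def RightDom (S : ℕ → Finset ℕ) (v : ℕ → ℕ) (φ i : ℕ) : Prop :=
  ∀ t ∈ S (i + 1), v i < t → t ≤ φ → t ∈ S i

theorem dom_of_weaklySeparated {S T : Finset ℕ} (h : WeaklySeparated S T) {u v : ℕ} (φ : ℕ)
    (huv : u < v) (hu : u ∈ T) (hu' : u ∉ S) (hv : v ∈ S) (hv' : v ∉ T) :
    (∀ t ∈ S, (φ < t ∨ t < u) → t ∈ T) ∨ (∀ t ∈ T, v < t → t ≤ φ → t ∈ S) := by
  by_contra! hcon
  obtain ⟨⟨s, hs, hsu, hs'⟩, t, ht, hvt, htφ, ht'⟩ := hcon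
  rcases hsu with hsu | hsu
  · exact h.symm.not_cross huv hvt (by omega : t < s) hu hu' hv hv' ht ht' hs hs'
  · exact h.not_cross hsu huv hvt hs hs' hu hu' hv hv' ht ht'

variable {D : Finset (Finset ℕ)} {K : Finset ℕ} {m : ℕ} {S : ℕ → Finset ℕ} {u v : ℕ → ℕ}

theorem HullChain.dom (h : HullChain D K m S u v)
    (hws : ∀ I ∈ D, ∀ J ∈ D, WeaklySeparated I J) (φ : ℕ) {i : ℕ} (hi : i < m) :
    LeftDom S u φ i ∨ RightDom S v φ i :=
  dom_of_weaklySeparated (hws _ (h.mem i hi.le) _ (h.mem (i + 1) hi)) φ (h.u_lt_v i hi)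
    (h.left _ hi) (h.u_not_mem i hi) (h.right _ hi.le) (h.v_not_mem i hi)

theorem HullChain.drop (h : HullChain D K (m + 1) S u v) {φ j : ℕ} (hj : j ≤ m + 1)
    (hφ : ∀ i ≤ m + 1, v i ≤ φ) (hR : ∀ i, i + 1 = j → RightDom S v φ i)
    (hL : j < m + 1 → LeftDom S u φ j) :
    HullChain D K m (fun i => S (if i < j then i else i + 1))
      (fun i => u (if i ≤ j then i else i + 1)) (fun i => v (if i + 1 < j then i else i + 1)) := by
  obtain ⟨h1, h2, h3, h4, h5, h6, h7, h8, h9, h10⟩ := h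
  refine ⟨fun i hi => h1 _ (by split_ifs <;> omega), ?_, ?_, ?_, ?_, ?_, ?_, ?_, ?_, ?_⟩
  · intro i hi
    rcases lt_trichotomy i j with hij | rfl | hij
    · simpa [hij, hij.le] using h2 i (by omega)
    · have := hL (by omega) (u i) (h2 i (by omega)) (Or.inr (h6 i (by omega)))
      simpa using this
    · simpa [hij.not_gt, hij.not_ge] using h2 (i + 1) (by omega)
  · intro i hi
    rcases lt_trichotomy (i + 1) j with hij | rfl | hij
    · simpa [hij, (by omega : i < j)] using h3 i (by omega)
    · have := hR i rfl (v (i + 1)) (h3 _ (by omega)) (h7 i (by omega)) (hφ _ (by omega))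
      simpa using this
    · simpa only [if_neg hij.not_gt, if_neg (by omega : ¬ i < j)] using h3 (i + 1) (by omega)
  · intro i hi
    have a1 := h4 i (by omega)
    have a2 := h4 (i + 1) (by omega)
    have a3 := h6 i (by omega)
    have a4 := h7 i (by omega)
    split_ifs <;> omega
  · intro i hi t ht
    have a1 := h5 i (by omega) t ht
    have a2 := h5 (i + 1) (by omega) t ht
    have a3 := h8 i (by omega)
    rcases lt_trichotomy (i + 1) j with hij | rfl | hij
    · simpa [hij, (by omega : i < j), (by omega : i ≤ j)] using a1
    · have b := hR i rfl t
      have c := hφ (i + 1) (by omega)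
      simp only [lt_irrefl, if_false, (by omega : i < i + 1), (by omega : i ≤ i + 1), if_true]
      intro x y
      by_cases hv : t ≤ v i
      · exact a1 x hv
      · exact b (a2 (by omega) y) (by omega) (by omega)
    · rcases (by omega : i = j ∨ j < i) with rfl | hij'
      · have b := hL (by omega) t
        simp only [lt_irrefl, if_false, le_refl, if_true, if_neg (by omega : ¬ i + 1 < i)]
        intro x y
        by_cases hu : u (i + 1) ≤ t
        · exact a2 hu y
        · exact b (a1 x (by omega)) (Or.inr (by omega))
      · simpa [hij.not_gt, hij'.not_gt, hij'.not_ge] using a2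
  · intro i hi
    have a1 := h6 i (by omega)
    have a2 := h6 (i + 1) (by omega)
    split_ifs <;> omega
  · intro i hi
    have a1 := h7 i (by omega)
    have a2 := h7 (i + 1) (by omega)
    split_ifs <;> omega
  · intro i hi
    have a1 := h8 i (by omega)
    have a2 := h8 (i + 1) (by omega)
    have a3 := h4 (i + 1) (by omega)
    split_ifs <;> omega
  · intro i hi
    have a1 := h9 i (by omega)
    have a2 := h9 (i + 1) (by omega)
    split_ifs <;> first | assumption | omega
  · intro i hi
    have a1 := h10 i (by omega)
    have a2 := h10 (i + 1) (by omega)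
    split_ifs <;> assumption

theorem exists_last_not {P : ℕ → Prop} {N : ℕ} (h : ∃ i < N, ¬ P i) :
    ∃ i < N, ¬ P i ∧ ∀ j, i < j → j < N → P j := by
  induction N with
  | zero => obtain ⟨i, hi, -⟩ := h; omega
  | succ N ih =>
    by_cases hN : P N
    · obtain ⟨i, hi, hPi⟩ := h
      have hiN : i ≠ N := fun e => hPi (e ▸ hN)
      obtain ⟨i, hi, h1, h2⟩ := ih ⟨i, by omega, hPi⟩
      refine ⟨i, by omega, h1, fun j hj hjN => ?_⟩
      rcases (by omega : j < N ∨ j = N) with hj' | rfl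
      · exact h2 j hj hj'
      · exact hN
    · exact ⟨N, by omega, hN, fun j hj hjN => by omega⟩

theorem exists_first_not {P : ℕ → Prop} {N : ℕ} (h : ∃ i < N, ¬ P i) :
    ∃ i < N, ¬ P i ∧ ∀ j < i, P j := by
  classical
  have h' : ∃ i, i < N ∧ ¬ P i := h
  refine ⟨Nat.find h', (Nat.find_spec h').1, (Nat.find_spec h').2, fun j hj => ?_⟩
  have h1 := Nat.find_min h' hj
  have h2 := (Nat.find_spec h').1
  by_contra hP
  exact h1 ⟨by omega, hP⟩

/-- A hull chain one of whose members contains `F` can be merged into a single set containing `F`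
and spanning the whole chain. -/
theorem HullChain.merge {n b : ℕ} {F : Finset ℕ} (hF : ∀ t ∈ F, b < t ∧ t ≤ n)
    (hws : ∀ I ∈ D, ∀ J ∈ D, WeaklySeparated I J) (hbn : b ≤ n)
    (h : HullChain D K m S u v) (hb : ∀ i ≤ m, v i ≤ b) {c : ℕ} (hc : c ≤ m) (hcF : F ⊆ S c) :
    ∃ X ∈ D, u 0 ∈ X ∧ v m ∈ X ∧ (∀ t ∈ K, u 0 ≤ t → t ≤ v m → t ∈ X) ∧ F ⊆ X := by
  induction m generalizing S u v c with
  | zero =>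
    obtain rfl : c = 0 := by omega
    exact ⟨S 0, h.mem 0 le_rfl, h.left 0 le_rfl, h.right 0 le_rfl, h.hull 0 le_rfl, hcF⟩
  | succ m ih =>
    have key : ∀ j φ c, j ≤ m + 1 → b ≤ φ → c ≤ m + 1 → c ≠ j → F ⊆ S c →
        (∀ i, i + 1 = j → RightDom S v φ i) → (j < m + 1 → LeftDom S u φ j) →
        ∃ X ∈ D, u 0 ∈ X ∧ v (m + 1) ∈ X ∧
          (∀ t ∈ K, u 0 ≤ t → t ≤ v (m + 1) → t ∈ X) ∧ F ⊆ X := by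
      intro j φ c hj hφ hc hcj hcF hR hL
      have h' := h.drop hj (fun i hi => (hb i hi).trans hφ) hR hL
      have := ih h' (fun i hi => hb _ (by split_ifs <;> omega))
        (c := if c < j then c else c - 1) (by split_ifs <;> omega) ?_
      · simpa [if_neg (by omega : ¬ m + 1 < j)] using this
      · split_ifs with h1 h2
        · exact hcF
        · omega
        · rwa [Nat.sub_add_cancel (by omega)]
    have final : F ⊆ S 0 → ∃ X ∈ D, u 0 ∈ X ∧ v (m + 1) ∈ X ∧
          (∀ t ∈ K, u 0 ≤ t → t ≤ v (m + 1) → t ∈ X) ∧ F ⊆ X := by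
      intro h0
      by_cases hall : ∀ i < m + 1, LeftDom S u b i
      · refine key 0 b (m + 1) (by omega) le_rfl le_rfl (by omega) ?_ (by omega)
          (fun h => hall 0 h)
        have : ∀ i ≤ m + 1, F ⊆ S i := by
          intro i hi
          induction i with
          | zero => exact h0
          | succ i ih2 =>
            intro t ht
            exact hall i (by omega) t (ih2 (by omega) ht) (Or.inl (hF t ht).1)
        exact this _ le_rfl
      · obtain ⟨i, hi, h1, h2⟩ := exists_last_not (by push Not at hall; exact hall)
        refine key (i + 1) b 0 (by omega) le_rfl (by omega) (by omega) h0 ?_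
          (fun h => h2 _ (by omega) h)
        rintro j hj
        obtain rfl : j = i := by omega
        exact (h.dom hws b hi).resolve_left h1
    by_cases hall : ∀ i < c, RightDom S v n i
    · apply final
      have : ∀ i ≤ c, F ⊆ S (c - i) := by
        intro i hi
        induction i with
        | zero => exact hcF
        | succ i ih2 =>
          intro t ht
          have e : c - (i + 1) + 1 = c - i := by omega
          refine hall (c - (i + 1)) (by omega) t ?_ ?_ (hF t ht).2
          · rw [e]; exact ih2 (by omega) ht
          · exact (hb _ (by omega)).trans_lt (hF t ht).1
      simpa using this c le_rfl
    · obtain ⟨i, hi, h1, h2⟩ := exists_first_not (by push Not at hall; exact hall)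
      exact key i n c (by omega) hbn hc (by omega) hcF (fun j hj => h2 j (by omega))
        (fun hi' => (h.dom hws n hi').resolve_right h1)

/-- A hull chain enclosing an element of `Y` missed by its last set, with both outer ends outside
`Y`, has a member containing the part of `Y` that lies after the chain. -/
theorem HullChain.exists_superset {n b : ℕ} {Y : Finset ℕ} (hYD : ∀ I ∈ D, WeaklySeparated I Y)
    (hws : ∀ I ∈ D, ∀ J ∈ D, WeaklySeparated I J) (hYn : ∀ t ∈ Y, t ≤ n) (hbn : b ≤ n)
    (h : HullChain D K m S u v) (hb : ∀ i ≤ m, v i ≤ b) (hu : u 0 ∉ Y) (hv : v m ∉ Y) {q : ℕ}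
    (hqY : q ∈ Y) (hqS : q ∉ S m) (huq : u m < q) (hqv : q < v m) :
    ∃ c ≤ m, ∀ t ∈ Y, b < t → t ∈ S c := by
  induction m generalizing S u v q with
  | zero =>
    refine ⟨0, le_rfl, fun t ht hbt => ?_⟩
    by_contra hcon
    exact (hYD _ (h.mem 0 le_rfl)).not_cross huq hqv ((hb 0 le_rfl).trans_lt hbt)
      (h.left 0 le_rfl) hu hqY hqS (h.right 0 le_rfl) hv ht hcon
  | succ m ih =>
    have key : ∀ j q, j ≤ m + 1 → q ∈ Y →
        q ∉ S (if m < j then m else m + 1) → u (if m ≤ j then m else m + 1) < q →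
        q < v (m + 1) → (∀ i, i + 1 = j → RightDom S v n i) →
        (j < m + 1 → LeftDom S u n j) →
        ∃ c ≤ m + 1, ∀ t ∈ Y, b < t → t ∈ S c := by
      intro j q hj hqY hqS huq hqv hR hL
      have h' := h.drop hj (fun i hi => (hb i hi).trans hbn) hR hL
      obtain ⟨c, hc, hcY⟩ := ih h' (fun i hi => hb _ (by split_ifs <;> omega)) (by simpa using hu)
        (by simpa [if_neg (by omega : ¬ m + 1 < j)] using hv) hqY hqS huq
        (by simpa [if_neg (by omega : ¬ m + 1 < j)] using hqv)
      exact ⟨_, by split_ifs <;> omega, hcY⟩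
    rcases dom_of_weaklySeparated (hYD _ (h.mem _ le_rfl)) n hqv hqY hqS (h.right _ le_rfl) hv
      with hL | hR
    swap
    · exact ⟨m + 1, le_rfl, fun t ht hbt =>
        hR t ht ((hb _ le_rfl).trans_lt hbt) (hYn t ht)⟩
    have huY : u (m + 1) ∈ Y := hL _ (h.left _ le_rfl) (Or.inr huq)
    by_cases hall : ∀ i < m + 1, LeftDom S u n i
    · exfalso
      have : ∀ i ≤ m + 1, u 0 ∈ S i ∧ u 0 ≤ u i := by
        intro i hi
        induction i with
        | zero => exact ⟨h.left 0 (by omega), le_rfl⟩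
        | succ i ih2 =>
          obtain ⟨i1, i2⟩ := ih2 (by omega)
          have := h.u_lt i (by omega)
          exact ⟨hall i (by omega) _ i1 (Or.inr (by omega)), by omega⟩
      obtain ⟨i1, i2⟩ := this _ le_rfl
      exact hu (hL _ i1 (Or.inr (by omega)))
    · obtain ⟨i, hi, h1, h2⟩ := exists_last_not (by push Not at hall; exact hall)
      have hR : ∀ j, j + 1 = i + 1 → RightDom S v n j := by
        rintro j hj
        obtain rfl : j = i := by omega
        exact (h.dom hws n hi).resolve_left h1
      by_cases him : i = m
      · subst him
        refine key (i + 1) (u (i + 1)) le_rfl huY ?_ ?_ ?_ hR (by omega)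
        · simpa using h.u_not_mem i (by omega)
        · simpa using h.u_lt i (by omega)
        · exact h.lt _ le_rfl
      · refine key (i + 1) q (by omega) hqY ?_ ?_ hqv hR (fun h => h2 _ (by omega) h)
        · rwa [if_neg (by omega)]
        · have := h.u_lt m (by omega)
          split_ifs <;> omega

/-- `p < p'` lie in `X \ K`, and `X` agrees with `K` strictly between them. -/
structure IsGap (K X : Finset ℕ) (p p' : ℕ) : Prop where
  lt : p < p'
  left : p ∈ X
  right : p' ∈ X
  left' : p ∉ K
  right' : p' ∉ K
  mem_iff : ∀ t, p < t → t < p' → (t ∈ X ↔ t ∈ K)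

theorem exists_max_gap {a b x : ℕ}
    (h : ∃ X ∈ D, ∃ p p', a ≤ p ∧ p < x ∧ x < p' ∧ p' ≤ b ∧ IsGap K X p p') :
    ∃ X ∈ D, ∃ p p', a ≤ p ∧ p < x ∧ x < p' ∧ p' ≤ b ∧ IsGap K X p p' ∧
      ∀ Y ∈ D, ∀ r r', a ≤ r → r' ≤ b → IsGap K Y r r' → p' < r' → x ≤ r := by
  classical
  let P : ℕ → Prop := fun p' => ∃ X ∈ D, ∃ p, a ≤ p ∧ p < x ∧ x < p' ∧ p' ≤ b ∧ IsGap K X p p'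
  obtain ⟨X, hX, p, p', h1, h2, h3, h4, h5⟩ := h
  have hP : P (Nat.findGreatest P b) :=
    Nat.findGreatest_spec (P := P) h4 ⟨X, hX, p, h1, h2, h3, h4, h5⟩
  obtain ⟨Z, hZ, q, h1, h2, h3, h4, h5⟩ := hP
  refine ⟨Z, hZ, q, _, h1, h2, h3, h4, h5, fun Y hY r r' hr hr' hg hlt => ?_⟩
  by_contra! hcon
  exact Nat.findGreatest_is_greatest hlt hr' ⟨Y, hY, r, hr, hcon, by omega, hr', hg⟩

theorem exists_gap_chain {a b : ℕ}
    (hcov : ∀ x, a < x → x < b → x ∉ K →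
      ∃ X ∈ D, ∃ p p', a ≤ p ∧ p < x ∧ x < p' ∧ p' ≤ b ∧ IsGap K X p p')
    (hne : ∃ x, a < x ∧ x < b ∧ x ∉ K) :
    ∃ m S u v, HullChain D K m S u v ∧ u 0 = a ∧ v m = b ∧ (∀ i ≤ m, v i ≤ b) ∧
      ∀ i ≤ m, IsGap K (S i) (u i) (v i) := by
  classical
  suffices H : ∀ k, ∃ m S u v, HullChain D K m S u v ∧ u 0 = a ∧ (v m = b ∨ k ≤ v m) ∧
      (∀ i ≤ m, v i ≤ b) ∧ (∀ i ≤ m, IsGap K (S i) (u i) (v i)) ∧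
      ∀ Y ∈ D, ∀ r r', a ≤ r → r' ≤ b → IsGap K Y r r' → v m < r' → u m < r by
    obtain ⟨m, S, u, v, h1, h2, h3, h4, h5, -⟩ := H b
    have := h4 m le_rfl
    exact ⟨m, S, u, v, h1, h2, by omega, h4, h5⟩
  have single : ∀ X p p', X ∈ D → IsGap K X p p' →
      HullChain D K 0 (fun _ => X) (fun _ => p) (fun _ => p') := by
    intro X p p' hX hg
    refine ⟨fun _ _ => hX, fun _ _ => hg.left, fun _ _ => hg.right, fun _ _ => hg.lt, ?_,
      by simp, by simp, by simp, by simp, by simp⟩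
    intro i _ t ht hpt htp
    rcases eq_or_lt_of_le hpt with rfl | hpt
    · exact absurd ht hg.left'
    rcases eq_or_lt_of_le htp with rfl | htp
    · exact absurd ht hg.right'
    exact (hg.mem_iff t hpt htp).2 ht
  intro k
  induction k with
  | zero =>
    have hx := Nat.find_spec hne
    have hmin := fun y => Nat.find_min hne (m := y)
    generalize Nat.find hne = x at hx hmin
    obtain ⟨X, hX, p, p', h1, h2, h3, h4, h5, h6⟩ := exists_max_gap (hcov x hx.1 hx.2.1 hx.2.2)
    obtain rfl : p = a := by
      by_contra hpa
      exact hmin p h2 ⟨by omega, by omega, h5.left'⟩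
    refine ⟨0, fun _ => X, fun _ => p, fun _ => p', single X p p' hX h5, rfl, Or.inr (by omega),
      fun _ _ => h4, fun _ _ => h5, fun Y hY r r' hr hr' hg hlt => ?_⟩
    have := h6 Y hY r r' hr hr' hg hlt
    show p < r
    omega
  | succ k ih =>
    obtain ⟨m, S, u, v, hc, hu0, hvm, hvb, hgap, hmax⟩ := ih
    by_cases hb : v m = b
    · exact ⟨m, S, u, v, hc, hu0, Or.inl hb, hvb, hgap, hmax⟩
    have hum : a ≤ u m := by
      have : ∀ i ≤ m, u 0 ≤ u i := by
        intro i hi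
        induction i with
        | zero => exact le_rfl
        | succ i ih2 => exact (ih2 (by omega)).trans (hc.u_lt i (by omega)).le
      exact hu0 ▸ this m le_rfl
    have hgm := hgap m le_rfl
    have hvm' := hvb m le_rfl
    have := hgm.lt
    obtain ⟨X, hX, p, p', h1, h2, h3, h4, h5, h6⟩ :=
      exists_max_gap (hcov (v m) (by omega) (by omega) hgm.right')
    have hup : u m < p := hmax X hX p p' h1 h4 h5 h3
    have hs := single X p p' hX h5
    refine ⟨m + 1, fun i => if i ≤ m then S i else X, fun i => if i ≤ m then u i else p,
      fun i => if i ≤ m then v i else p', ?_, by simpa using hu0, Or.inr ?_, ?_, ?_, ?_⟩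
    · have bdry : ∀ i < m + 1, i + 1 ≤ m ∨ i = m := by omega
      refine ⟨?_, ?_, ?_, ?_, ?_, ?_, ?_, ?_, ?_, ?_⟩
      · intro i hi
        split_ifs with h
        exacts [hc.mem i h, hX]
      · intro i hi
        split_ifs with h
        exacts [hc.left i h, h5.left]
      · intro i hi
        split_ifs with h
        exacts [hc.right i h, h5.right]
      · intro i hi
        split_ifs with h
        exacts [hc.lt i h, h5.lt]
      · intro i hi
        split_ifs with h
        exacts [hc.hull i h, hs.hull 0 le_rfl]
      · intro i hi
        rcases bdry i hi with h | rfl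
        · simpa [h, (by omega : i ≤ m)] using hc.u_lt i h
        · simpa using hup
      · intro i hi
        rcases bdry i hi with h | rfl
        · simpa [h, (by omega : i ≤ m)] using hc.v_lt i h
        · simpa using h3
      · intro i hi
        rcases bdry i hi with h | rfl
        · simpa [h, (by omega : i ≤ m)] using hc.u_lt_v i h
        · simpa using h2
      · intro i hi
        rcases bdry i hi with h | rfl
        · simpa [h, (by omega : i ≤ m)] using hc.u_not_mem i h
        · simpa using fun h => h5.left' ((hgm.mem_iff p hup h2).1 h)
      · intro i hi
        rcases bdry i hi with h | rfl
        · simpa [h, (by omega : i ≤ m)] using hc.v_not_mem i h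
        · simpa using fun h => hgm.right' ((h5.mem_iff _ h2 h3).1 h)
    · simp; omega
    · intro i hi
      dsimp only
      split_ifs with h
      exacts [hvb i h, h4]
    · intro i hi
      dsimp only
      split_ifs with h
      exacts [hgap i h, h5]
    · intro Y hY r r' hr hr' hg hlt
      have := h6 Y hY r r' hr hr' hg (by simpa using hlt)
      simp; omega

/-- If every candidate `x` strictly between `a` and `b` lies in a gap, then some set of the
collection contains `a`, `b` and all of `K` between them; given a set `Y` avoiding `a`
and `b` it can be chosen to contain the part of `Y` after `b`. -/
theorem exists_full {n a b : ℕ} (hws : ∀ I ∈ D, ∀ J ∈ D, WeaklySeparated I J) (hbn : b ≤ n)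
    (hcov : ∀ x, a < x → x < b → x ∉ K →
      ∃ X ∈ D, ∃ p p', a ≤ p ∧ p < x ∧ x < p' ∧ p' ≤ b ∧ IsGap K X p p')
    (hne : ∃ x, a < x ∧ x < b ∧ x ∉ K) :
    (∃ X ∈ D, a ∈ X ∧ b ∈ X ∧ ∀ t ∈ K, a < t → t < b → t ∈ X) ∧
    ∀ Y ∈ D, (∀ t ∈ Y, t ≤ n) → a ∉ Y → b ∉ Y → (∃ q ∈ Y, a < q ∧ q < b ∧ q ∉ K) →
      ∃ X ∈ D, a ∈ X ∧ b ∈ X ∧ (∀ t ∈ K, a < t → t < b → t ∈ X) ∧ ∀ t ∈ Y, b < t → t ∈ X := by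
  classical
  obtain ⟨m, S, u, v, hc, rfl, rfl, hvb, hgap⟩ := exists_gap_chain hcov hne
  constructor
  · obtain ⟨X, hX, h1, h2, h3, -⟩ := hc.merge (F := ∅) (by simp) hws hbn hvb le_rfl (by simp)
    exact ⟨X, hX, h1, h2, fun t ht h h' => h3 t ht h.le h'.le⟩
  · intro Y hY hYn ha hb hq
    set P := Y.filter (fun q => u 0 < q ∧ q < v m ∧ q ∉ K) with hP
    have hPne : P.Nonempty := by
      obtain ⟨q, hq, h⟩ := hq
      exact ⟨q, by simp [hP, hq, h]⟩
    have hmaxmem := P.max'_mem hPne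
    have hmaxle : ∀ y ∈ P, y ≤ P.max' hPne := fun y hy => P.le_max' y hy
    generalize P.max' hPne = q at hmaxmem hmaxle
    simp only [hP, mem_filter] at hmaxmem hmaxle
    obtain ⟨hqY, hq1, hq2, hqK⟩ := hmaxmem
    have hex : ∃ i, i ≤ m ∧ q < v i := ⟨m, le_rfl, hq2⟩
    have hi := Nat.find_spec hex
    have himin := fun j => Nat.find_min hex (m := j)
    generalize Nat.find hex = i at hi himin
    have hui : u i < q := by
      rcases Nat.eq_zero_or_pos i with rfl | hpos
      · exact hq1
      · obtain ⟨j, rfl⟩ : ∃ j, i = j + 1 := ⟨i - 1, by omega⟩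
        have h1 := hc.u_lt_v j (by omega)
        have h2 := himin j (by omega)
        omega
    have hviY : v i ∉ Y := by
      intro hmem
      by_cases him : v i = v m
      · exact hb (him ▸ hmem)
      · have h1 := hvb i hi.1
        have := hmaxle (v i) ⟨hmem, by omega, by omega, (hgap i hi.1).right'⟩
        omega
    have hpre : HullChain D K i S u v :=
      ⟨fun j hj => hc.mem j (by omega), fun j hj => hc.left j (by omega),
        fun j hj => hc.right j (by omega), fun j hj => hc.lt j (by omega),
        fun j hj => hc.hull j (by omega), fun j hj => hc.u_lt j (by omega),
        fun j hj => hc.v_lt j (by omega), fun j hj => hc.u_lt_v j (by omega),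
        fun j hj => hc.u_not_mem j (by omega), fun j hj => hc.v_not_mem j (by omega)⟩
    obtain ⟨c, hcm, hcY⟩ := hpre.exists_superset (fun I hI => hws I hI Y hY) hws hYn hbn
      (fun j hj => hvb j (by omega)) ha hviY hqY
      (fun h => hqK (((hgap i hi.1).mem_iff q hui hi.2).1 h)) hui hi.2
    obtain ⟨X, hX, h1, h2, h3, h4⟩ := hc.merge (F := Y.filter (fun t => v m < t))
      (fun t ht => ⟨(mem_filter.1 ht).2, hYn t (mem_filter.1 ht).1⟩) hws hbn hvb
      (hcm.trans hi.1) (fun t ht => hcY t (mem_filter.1 ht).1 (mem_filter.1 ht).2)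
    exact ⟨X, hX, h1, h2, fun t ht h h' => h3 t ht h.le h'.le,
      fun t ht hbt => h4 (mem_filter.2 ⟨ht, hbt⟩)⟩

theorem weaklySeparated_base {X : Finset ℕ} {a b : ℕ} (hab : a < b)
    (haK : a ∉ K) (hbK : b ∉ K) (hX : ∀ t ∈ X, a ≤ t) (hcard : X.card = K.card + 1)
    (h1 : WeaklySeparated (insert a K) X) (h2 : WeaklySeparated (insert b K) X) :
    WeaklySeparated K X := by
  classical
  have third : ∀ s s', s ≠ s' → s ∈ K → s ∉ X → s' ∈ K → s' ∉ X →
      ∃ t ∈ X, t ∉ K ∧ t ≠ a ∧ t ≠ b := by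
    intro s s' hne h1 h2 h3 h4
    by_contra! hcon
    have e1 : X \ K ⊆ {a, b} := by
      intro t ht
      simp only [mem_sdiff] at ht
      have := hcon t ht.1 ht.2
      simp only [mem_insert, mem_singleton]
      tauto
    have e2 : {s, s'} ⊆ K \ X := by
      intro t ht
      simp only [mem_insert, mem_singleton] at ht
      rcases ht with rfl | rfl <;> simp [*]
    have e3 := card_le_card e1
    have e4 := card_le_card e2
    rw [card_pair hne] at e4
    have e5 := card_le_two (a := a) (b := b)
    have e6 := card_sdiff_add_card_inter X K
    have e7 := card_sdiff_add_card_inter K X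
    rw [inter_comm] at e7
    omega
  have key : ∀ s t s' t', s ∈ K → s ∉ X → s' ∈ K → s' ∉ X → t ∈ X → t ∉ K → t' ∈ X → t' ∉ K →
      ∀ c, c ∉ K → WeaklySeparated (insert c K) X → t ≠ c → t' ≠ c →
      (s < t ∧ t < s' ∧ s' < t' ∨ t < s ∧ s < t' ∧ t' < s') → False := by
    intro s t s' t' hs hs' hs1 hs1' ht ht' ht1 ht1' c hc hw h3 h4 h5
    rcases h5 with ⟨i, j, k⟩ | ⟨i, j, k⟩
    · exact hw.not_cross i j k (by simp [*]) hs' ht (by simp [*]) (by simp [*]) hs1' ht1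
        (by simp [*])
    · exact hw.symm.not_cross i j k ht (by simp [*]) (by simp [*]) hs' ht1
        (by simp [*]) (by simp [*]) hs1'
  have main : ∀ s t s' t', s ∈ K → s ∉ X → s' ∈ K → s' ∉ X → t ∈ X → t ∉ K → t' ∈ X → t' ∉ K →
      (s < t ∧ t < s' ∧ s' < t' ∨ t < s ∧ s < t' ∧ t' < s') → False := by
    intro s t s' t' hs hs' hs1 hs1' ht ht' ht1 ht1' h5
    have key1 := fun t t' ht ht' ht1 ht1' =>
      key s t s' t' hs hs' hs1 hs1' ht ht' ht1 ht1' a haK h1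
    have key2 := fun t t' ht ht' ht1 ht1' =>
      key s t s' t' hs hs' hs1 hs1' ht ht' ht1 ht1' b hbK h2
    have key3 := fun t t' ht ht' ht1 ht1' =>
      key s' t s t' hs1 hs1' hs hs' ht ht' ht1 ht1' a haK h1
    have key4 := fun t t' ht ht' ht1 ht1' =>
      key s' t s t' hs1 hs1' hs hs' ht ht' ht1 ht1' b hbK h2
    obtain ⟨r, hr, hrK, hra, hrb⟩ := third s s' (by omega) hs hs' hs1 hs1'
    have l1 := hX t ht
    have l2 := hX r hr
    have l3 := hX t' ht1
    have n1 : r ≠ s := fun h => hrK (h ▸ hs)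
    have n2 : r ≠ s' := fun h => hrK (h ▸ hs1)
    have k1 := key1 t t' ht ht' ht1 ht1'
    have k2 := key2 t t' ht ht' ht1 ht1'
    have k3 := key1 r t' hr hrK ht1 ht1'
    have k4 := key2 t r ht ht' hr hrK
    have k5 := key3 t' r ht1 ht1' hr hrK
    have k6 := key1 t' r ht1 ht1' hr hrK
    have k7 := key3 r t' hr hrK ht1 ht1'
    grind
  rintro ⟨p, q, r, s, h3, h4, h5, h6 | h6⟩ <;> simp only [mem_sdiff] at h6
  · exact main p q r s h6.1.1 h6.1.2 h6.2.1.1 h6.2.1.2 h6.2.2.1.1 h6.2.2.1.2 h6.2.2.2.1 h6.2.2.2.2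
      (Or.inl ⟨h3, h4, h5⟩)
  · exact main q p s r h6.2.2.1.1 h6.2.2.1.2 h6.2.2.2.1 h6.2.2.2.2 h6.1.1 h6.1.2 h6.2.1.1 h6.2.1.2
      (Or.inr ⟨h3, h4, h5⟩)

theorem exists_isGap {X : Finset ℕ} {a b x : ℕ} (hax : a < x) (hxb : x < b)
    (haK : a ∉ K) (hbK : b ∉ K) (hxK : x ∉ K) (hX : ∀ t ∈ X, a ≤ t)
    (hcard : X.card = K.card + 1)
    (h1 : WeaklySeparated (insert a K) X) (h2 : WeaklySeparated (insert b K) X)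
    (h3 : ¬ WeaklySeparated (insert x K) X) :
    ∃ p p', a ≤ p ∧ p < x ∧ x < p' ∧ p' ≤ b ∧ IsGap K X p p' := by
  classical
  have hK := weaklySeparated_base (hax.trans hxb) haK hbK hX hcard h1 h2
  obtain ⟨s, t, t', hsK, hsX, htX, htK, htX', htK', hxX, hpos⟩ : ∃ s t t', s ∈ K ∧ s ∉ X ∧
      t ∈ X ∧ t ∉ K ∧ t' ∈ X ∧ t' ∉ K ∧ x ∉ X ∧
      (t < x ∧ x < t' ∧ (s < t ∨ t' < s) ∨ t < s ∧ s < t' ∧ (x < t ∨ t' < x)) := by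
    unfold WeaklySeparated at h3
    push Not at h3
    obtain ⟨p, q, r, s, hpq, hqr, hrs, h6 | h6⟩ := h3 <;>
      simp only [mem_sdiff, mem_insert, not_or] at h6
    · obtain ⟨⟨hp, hp'⟩, ⟨hr, hr'⟩, ⟨hq, -, hq'⟩, hs, -, hs'⟩ := h6
      rcases hp with rfl | hp
      · rcases hr with rfl | hr
        · omega
        · exact ⟨r, q, s, hr, hr', hq, hq', hs, hs', hp', by omega⟩
      · rcases hr with rfl | hr
        · exact ⟨p, q, s, hp, hp', hq, hq', hs, hs', hr', by omega⟩
        · exact (hK.not_cross hpq hqr hrs hp hp' hq hq' hr hr' hs hs').elim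
    · obtain ⟨⟨hp, -, hp'⟩, ⟨hr, -, hr'⟩, ⟨hq, hq'⟩, hs, hs'⟩ := h6
      rcases hq with rfl | hq
      · rcases hs with rfl | hs
        · omega
        · exact ⟨s, p, r, hs, hs', hp, hp', hr, hr', hq', by omega⟩
      · rcases hs with rfl | hs
        · exact ⟨q, p, r, hq, hq', hp, hp', hr, hr', hs', by omega⟩
        · exact (hK.symm.not_cross hpq hqr hrs hp hp' hq hq' hr hr' hs hs').elim
  have key : ∀ c, c ∉ K → c ∉ X → WeaklySeparated (insert c K) X →
      ¬ (t < c ∧ c < t' ∧ (s < t ∨ t' < s) ∨ t < s ∧ s < t' ∧ (c < t ∨ t' < c)) := by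
    intro c hcK hcX hw hcon
    have e1 : t ≠ c := fun h => hcX (h ▸ htX)
    have e2 : t' ≠ c := fun h => hcX (h ▸ htX')
    have g1 : t ∉ insert c K := by simp [*]
    have g2 : t' ∉ insert c K := by simp [*]
    have g3 : s ∈ insert c K := by simp [*]
    have g4 : c ∈ insert c K := by simp
    rcases hcon with ⟨i, j, k | k⟩ | ⟨i, j, k | k⟩
    · exact hw.not_cross k i j g3 hsX htX g1 g4 hcX htX' g2
    · exact hw.symm.not_cross i j k htX g1 g4 hcX htX' g2 g3 hsX
    · exact hw.not_cross k i j g4 hcX htX g1 g3 hsX htX' g2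
    · exact hw.symm.not_cross i j k htX g1 g3 hsX htX' g2 g4 hcX
  have hLne : ((X \ K).filter (· < x)).Nonempty := by
    by_cases ha : a ∈ X
    · exact ⟨a, by simp [*]⟩
    by_contra hcon
    have hL : ∀ y ∈ X, y ∉ K → ¬ y < x := fun y hy hy' hlt => hcon ⟨y, by simp [*]⟩
    have := hL t htX htK
    have := hL t' htX' htK'
    have := key a haK ha h1
    omega
  have hRne : ((X \ K).filter (fun y => x < y ∧ y ≤ b)).Nonempty := by
    by_cases hb : b ∈ X
    · exact ⟨b, by simp [*]⟩
    by_contra hcon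
    have hL : ∀ y ∈ X, y ∉ K → ¬ (x < y ∧ y ≤ b) := fun y hy hy' hlt => hcon ⟨y, by simp [*]⟩
    have := hL t htX htK
    have := hL t' htX' htK'
    have := key b hbK hb h2
    omega
  have m1 := max'_mem _ hLne
  have m2 := fun y => le_max' ((X \ K).filter (· < x)) y
  have m3 := min'_mem _ hRne
  have m4 := fun y => min'_le ((X \ K).filter (fun y => x < y ∧ y ≤ b)) y
  simp only [mem_filter, mem_sdiff] at m1 m2 m3 m4
  set p := ((X \ K).filter (· < x)).max' hLne
  set p' := ((X \ K).filter (fun y => x < y ∧ y ≤ b)).min' hRne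
  have out : ∀ y ∈ X, y ∉ K → p < y → y < p' → False := by
    intro y hy hyK h4 h5
    have n1 : y ≠ x := fun h => hxX (h ▸ hy)
    rcases lt_or_gt_of_ne n1 with h | h
    · have := m2 y ⟨⟨hy, hyK⟩, h⟩
      omega
    · have := m4 y ⟨⟨hy, hyK⟩, h, by omega⟩
      omega
  refine ⟨p, p', hX _ m1.1.1, m1.2, m3.2.1, m3.2.2, by omega, m1.1.1, m3.1.1, m1.1.2, m3.1.2,
    fun y h4 h5 => ⟨fun hy => by_contra fun hyK => out y hy hyK h4 h5, fun hyK => ?_⟩⟩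
  by_contra hyX
  have o1 : ¬ (p < t ∧ t < p') := fun h => out t htX htK h.1 h.2
  have o2 : ¬ (p < t' ∧ t' < p') := fun h => out t' htX' htK' h.1 h.2
  have n1 : s ≠ p := fun h => hsX (h ▸ m1.1.1)
  have n2 : s ≠ p' := fun h => hsX (h ▸ m3.1.1)
  rcases (by omega : s < p ∨ p' < s) with h | h
  · exact hK.not_cross h h4 h5 hsK hsX m1.1.1 m1.1.2 hyK hyX m3.1.1 m3.1.2
  · exact hK.symm.not_cross h4 h5 h m1.1.1 m1.1.2 hyK hyX m3.1.1 m3.1.2 hsK hsX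

/-- `x` lies strictly inside the cyclic arc from `a` to `b`. -/
def Arc (a b x : ℕ) : Prop := a < x ∧ x < b ∨ x < b ∧ b < a ∨ b < a ∧ a < x

theorem shiftMod_eq {n t x : ℕ} (hx : x ∈ Icc 1 n) :
    shiftMod n t x = if x + t % n ≤ n then x + t % n else x + t % n - n := by
  rw [mem_Icc] at hx
  have hn : 0 < n := by omega
  have ht := Nat.mod_lt t hn
  have h1 : (x + t - 1) % n = (x + t % n - 1) % n := by
    rw [show x + t - 1 = (x - 1) + t by omega, show x + t % n - 1 = (x - 1) + t % n by omega,
      Nat.add_mod, Nat.add_mod (x - 1) (t % n), Nat.mod_mod]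
  unfold shiftMod
  rw [h1]
  split_ifs with h
  · rw [Nat.mod_eq_of_lt (by omega)]
    omega
  · rw [show x + t % n - 1 = (x + t % n - 1 - n) + n by omega, Nat.add_mod_right,
      Nat.mod_eq_of_lt (by omega)]
    omega

theorem shiftMod_mem {n t x : ℕ} (hx : x ∈ Icc 1 n) : shiftMod n t x ∈ Icc 1 n := by
  have h := mem_Icc.1 hx
  have := Nat.mod_lt t (by omega : 0 < n)
  rw [shiftMod_eq hx, mem_Icc]
  split_ifs <;> omega

theorem shiftMod_injOn (n t : ℕ) {x y : ℕ} (hx : x ∈ Icc 1 n) (hy : y ∈ Icc 1 n)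
    (h : shiftMod n t x = shiftMod n t y) : x = y := by
  rw [shiftMod_eq hx, shiftMod_eq hy] at h
  rw [mem_Icc] at hx hy
  have := Nat.mod_lt t (by omega : 0 < n)
  split_ifs at h <;> omega

theorem arc_shiftMod {n t a b x : ℕ} (ha : a ∈ Icc 1 n) (hb : b ∈ Icc 1 n) (hx : x ∈ Icc 1 n) :
    Arc (shiftMod n t a) (shiftMod n t b) (shiftMod n t x) ↔ Arc a b x := by
  rw [shiftMod_eq ha, shiftMod_eq hb, shiftMod_eq hx]
  rw [mem_Icc] at ha hb hx
  have := Nat.mod_lt t (by omega : 0 < n)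
  unfold Arc
  split_ifs <;> omega

theorem shiftMod_sub_shiftMod {n t x : ℕ} (hx : x ∈ Icc 1 n) :
    shiftMod n (n - t % n) (shiftMod n t x) = x := by
  have h1 := shiftMod_eq (t := n - t % n) (shiftMod_mem (t := t) hx)
  rw [h1, shiftMod_eq hx]
  rw [mem_Icc] at hx
  have := Nat.mod_lt t (by omega : 0 < n)
  rcases Nat.eq_zero_or_pos (t % n) with h | h
  · simp only [h, Nat.sub_zero, Nat.mod_self, Nat.add_zero]
    split_ifs <;> omega
  · rw [Nat.mod_eq_of_lt (by omega : n - t % n < n)]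
    split_ifs <;> omega

theorem exists_shiftMod_eq {n : ℕ} (t : ℕ) {x : ℕ} (hx : x ∈ Icc 1 n) :
    ∃ y ∈ Icc 1 n, shiftMod n t y = x := by
  have h := Finset.surj_on_of_inj_on_of_card_le (s := Icc 1 n) (t := Icc 1 n)
    (fun y _ => shiftMod n t y) (fun y hy => shiftMod_mem hy)
    (fun y z hy hz h => shiftMod_injOn n t hy hz h) le_rfl x hx
  obtain ⟨y, hy, h⟩ := h
  exact ⟨y, hy, h.symm⟩

theorem shiftMod_mem_shiftSet {n t x : ℕ} {S : Finset ℕ} (hS : S ⊆ Icc 1 n) (hx : x ∈ Icc 1 n) :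
    shiftMod n t x ∈ shiftSet n t S ↔ x ∈ S := by
  constructor
  · intro h
    obtain ⟨y, hy, he⟩ := mem_image.1 h
    exact shiftMod_injOn n t (hS hy) hx he ▸ hy
  · exact fun h => mem_image_of_mem _ h

theorem shiftSet_subset {n t : ℕ} {S : Finset ℕ} (hS : S ⊆ Icc 1 n) :
    shiftSet n t S ⊆ Icc 1 n := by
  intro y hy
  obtain ⟨x, hx, rfl⟩ := mem_image.1 hy
  exact shiftMod_mem (hS hx)

theorem card_shiftSet {n t : ℕ} {S : Finset ℕ} (hS : S ⊆ Icc 1 n) :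
    (shiftSet n t S).card = S.card :=
  card_image_of_injOn fun _ hx _ hy h => shiftMod_injOn n t (hS hx) (hS hy) h

theorem shiftSet_insert (n t x : ℕ) (S : Finset ℕ) :
    shiftSet n t (insert x S) = insert (shiftMod n t x) (shiftSet n t S) :=
  image_insert _ _ _

theorem shiftSet_sub_shiftSet {n t : ℕ} {S : Finset ℕ} (hS : S ⊆ Icc 1 n) :
    shiftSet n (n - t % n) (shiftSet n t S) = S := by
  unfold shiftSet
  rw [image_image]
  conv_rhs => rw [← image_id (s := S)]
  exact image_congr fun x hx => shiftMod_sub_shiftMod (hS hx)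

theorem WeaklySeparated.shiftSet {n t : ℕ} {S T : Finset ℕ} (hS : S ⊆ Icc 1 n)
    (hT : T ⊆ Icc 1 n) (h : WeaklySeparated S T) :
    WeaklySeparated (shiftSet n t S) (shiftSet n t T) := by
  have hsd : ∀ {S T : Finset ℕ}, S ⊆ Icc 1 n → T ⊆ Icc 1 n →
      ∀ y ∈ _root_.shiftSet n t S \ _root_.shiftSet n t T,
      ∃ x ∈ S \ T, x ∈ Icc 1 n ∧ shiftMod n t x = y := by
    intro S T hS hT y hy
    rw [mem_sdiff] at hy
    obtain ⟨x, hx, rfl⟩ := mem_image.1 hy.1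
    exact ⟨x, mem_sdiff.2 ⟨hx, fun hxT => hy.2 (mem_image_of_mem _ hxT)⟩, hS hx, rfl⟩
  have main : ∀ a b c d : ℕ, a ∈ Icc 1 n → b ∈ Icc 1 n → c ∈ Icc 1 n → d ∈ Icc 1 n →
      shiftMod n t a < shiftMod n t b → shiftMod n t b < shiftMod n t c →
      shiftMod n t c < shiftMod n t d → (a < b ∧ b < c ∧ c < d) ∨ (b < c ∧ c < d ∧ d < a) ∨
        (c < d ∧ d < a ∧ a < b) ∨ (d < a ∧ a < b ∧ b < c) := by
    intro a b c d ha hb hc hd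
    rw [shiftMod_eq ha, shiftMod_eq hb, shiftMod_eq hc, shiftMod_eq hd]
    rw [mem_Icc] at ha hb hc hd
    have := Nat.mod_lt t (by omega : 0 < n)
    split_ifs <;> omega
  rintro ⟨a, b, c, d, hab, hbc, hcd, ⟨h1, h2, h3, h4⟩ | ⟨h1, h2, h3, h4⟩⟩
  · obtain ⟨a, ha, ha', rfl⟩ := hsd hS hT a h1
    obtain ⟨c, hc, hc', rfl⟩ := hsd hS hT c h2
    obtain ⟨b, hb, hb', rfl⟩ := hsd hT hS b h3
    obtain ⟨d, hd, hd', rfl⟩ := hsd hT hS d h4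
    rcases main a b c d ha' hb' hc' hd' hab hbc hcd with g | g | g | g
    · exact h ⟨a, b, c, d, g.1, g.2.1, g.2.2, Or.inl ⟨ha, hc, hb, hd⟩⟩
    · exact h ⟨b, c, d, a, g.1, g.2.1, g.2.2, Or.inr ⟨hb, hd, hc, ha⟩⟩
    · exact h ⟨c, d, a, b, g.1, g.2.1, g.2.2, Or.inl ⟨hc, ha, hd, hb⟩⟩
    · exact h ⟨d, a, b, c, g.1, g.2.1, g.2.2, Or.inr ⟨hd, hb, ha, hc⟩⟩
  · obtain ⟨a, ha, ha', rfl⟩ := hsd hT hS a h1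
    obtain ⟨c, hc, hc', rfl⟩ := hsd hT hS c h2
    obtain ⟨b, hb, hb', rfl⟩ := hsd hS hT b h3
    obtain ⟨d, hd, hd', rfl⟩ := hsd hS hT d h4
    rcases main a b c d ha' hb' hc' hd' hab hbc hcd with g | g | g | g
    · exact h ⟨a, b, c, d, g.1, g.2.1, g.2.2, Or.inr ⟨ha, hc, hb, hd⟩⟩
    · exact h ⟨b, c, d, a, g.1, g.2.1, g.2.2, Or.inl ⟨hb, hd, hc, ha⟩⟩
    · exact h ⟨c, d, a, b, g.1, g.2.1, g.2.2, Or.inr ⟨hc, ha, hd, hb⟩⟩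
    · exact h ⟨d, a, b, c, g.1, g.2.1, g.2.2, Or.inl ⟨hd, hb, ha, hc⟩⟩

theorem weaklySeparated_shiftSet {n t : ℕ} {S T : Finset ℕ} (hS : S ⊆ Icc 1 n)
    (hT : T ⊆ Icc 1 n) :
    WeaklySeparated (shiftSet n t S) (shiftSet n t T) ↔ WeaklySeparated S T := by
  refine ⟨fun h => ?_, fun h => h.shiftSet hS hT⟩
  have := h.shiftSet (t := n - t % n) (shiftSet_subset hS) (shiftSet_subset hT)
  rwa [shiftSet_sub_shiftSet hS, shiftSet_sub_shiftSet hT] at this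

theorem weaklySeparated_sdiff {n : ℕ} {S T : Finset ℕ} (hS : S ⊆ Icc 1 n) (hT : T ⊆ Icc 1 n) :
    WeaklySeparated (Icc 1 n \ S) (Icc 1 n \ T) ↔ WeaklySeparated S T := by
  have key : ∀ {S T : Finset ℕ}, T ⊆ Icc 1 n → (Icc 1 n \ S) \ (Icc 1 n \ T) = T \ S := by
    intro S T hT
    ext x
    have := @hT x
    simp only [mem_sdiff]
    tauto
  unfold WeaklySeparated
  rw [key hT, key hS]
  exact not_congr ⟨fun ⟨a, b, c, d, h1, h2, h3, h⟩ => ⟨a, b, c, d, h1, h2, h3, h.symm⟩,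
    fun ⟨a, b, c, d, h1, h2, h3, h⟩ => ⟨a, b, c, d, h1, h2, h3, h.symm⟩⟩

/-- A weakly separated family of subsets of `[n]` of equal size. -/
structure WSFamily (n : ℕ) (D : Finset (Finset ℕ)) : Prop where
  subset : ∀ I ∈ D, I ⊆ Icc 1 n
  card_eq : ∀ I ∈ D, ∀ J ∈ D, I.card = J.card
  ws : ∀ I ∈ D, ∀ J ∈ D, WeaklySeparated I J

theorem WSFamily.shift {n : ℕ} (h : WSFamily n D) (t : ℕ) :
    WSFamily n (D.image (shiftSet n t)) := by
  refine ⟨?_, ?_, ?_⟩ <;> simp only [forall_mem_image]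
  · exact fun I hI => shiftSet_subset (h.subset I hI)
  · intro I hI J hJ
    rw [card_shiftSet (h.subset I hI), card_shiftSet (h.subset J hJ)]
    exact h.card_eq I hI J hJ
  · exact fun I hI J hJ => (h.ws I hI J hJ).shiftSet (h.subset I hI) (h.subset J hJ)

theorem WSFamily.compl {n : ℕ} (h : WSFamily n D) :
    WSFamily n (D.image (fun I => Icc 1 n \ I)) := by
  refine ⟨?_, ?_, ?_⟩ <;> simp only [forall_mem_image]
  · exact fun I _ => sdiff_subset
  · intro I hI J hJ
    rw [card_sdiff_of_subset (h.subset I hI), card_sdiff_of_subset (h.subset J hJ),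
      h.card_eq I hI J hJ]
  · exact fun I hI J hJ => (weaklySeparated_sdiff (h.subset I hI) (h.subset J hJ)).2 (h.ws I hI J hJ)

theorem exists_full_of_blocked_one {n b : ℕ} (hD : WSFamily n D) (hb : b ∈ Icc 1 n)
    (haK : 1 ∉ K) (hbK : b ∉ K) (hKa : insert 1 K ∈ D) (hKb : insert b K ∈ D)
    (hblk : ∀ x ∈ Icc 1 n, Arc 1 b x → x ∉ K → ∃ X ∈ D, ¬ WeaklySeparated (insert x K) X)
    (hne : ∃ x ∈ Icc 1 n, Arc 1 b x ∧ x ∉ K) :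
    (∃ X ∈ D, 1 ∈ X ∧ b ∈ X ∧ ∀ t ∈ K, Arc 1 b t → t ∈ X) ∧
    ∀ Y ∈ D, 1 ∉ Y → b ∉ Y → (∃ q ∈ Y, Arc 1 b q ∧ q ∉ K) →
      ∃ X ∈ D, 1 ∈ X ∧ b ∈ X ∧ (∀ t ∈ K, Arc 1 b t → t ∈ X) ∧ ∀ t ∈ Y, Arc b 1 t → t ∈ X := by
  rw [mem_Icc] at hb
  have hpos : ∀ I ∈ D, ∀ t ∈ I, 1 ≤ t ∧ t ≤ n := fun I hI t ht => mem_Icc.1 (hD.subset I hI ht)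
  have hcov : ∀ x, 1 < x → x < b → x ∉ K →
      ∃ X ∈ D, ∃ p p', 1 ≤ p ∧ p < x ∧ x < p' ∧ p' ≤ b ∧ IsGap K X p p' := by
    intro x h1 h2 hxK
    obtain ⟨X, hX, hw⟩ := hblk x (mem_Icc.2 (by omega)) (Or.inl ⟨h1, h2⟩) hxK
    refine ⟨X, hX, exists_isGap h1 h2 haK hbK hxK (fun t ht => (hpos X hX t ht).1) ?_
      (hD.ws _ hKa X hX) (hD.ws _ hKb X hX) hw⟩
    rw [hD.card_eq X hX _ hKa, card_insert_of_notMem haK]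
  obtain ⟨h1, h2⟩ := exists_full (n := n) hD.ws hb.2 hcov
    (by
      obtain ⟨x, hx, h, hxK⟩ := hne
      unfold Arc at h
      rw [mem_Icc] at hx
      exact ⟨x, by omega, by omega, hxK⟩)
  constructor
  · obtain ⟨X, hX, h3, h4, h5⟩ := h1
    exact ⟨X, hX, h3, h4, fun t ht h => h5 t ht (by unfold Arc at h; omega)
      (by have := hpos _ hKa t (mem_insert_of_mem ht); unfold Arc at h; omega)⟩
  · intro Y hY h3 h4 ⟨q, hq, hq', hqK⟩
    have := hpos Y hY q hq
    obtain ⟨X, hX, h5, h6, h7, h8⟩ := h2 Y hY (fun t ht => (hpos Y hY t ht).2) h3 h4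
      ⟨q, hq, by unfold Arc at hq'; omega, by unfold Arc at hq'; omega, hqK⟩
    exact ⟨X, hX, h5, h6, fun t ht h => h7 t ht (by unfold Arc at h; omega)
      (by have := hpos _ hKa t (mem_insert_of_mem ht); unfold Arc at h; omega),
      fun t ht h => h8 t ht (by have := hpos Y hY t ht; unfold Arc at h; omega)⟩

theorem exists_full_of_blocked {n a b : ℕ} (hD : WSFamily n D) (ha : a ∈ Icc 1 n)
    (hb : b ∈ Icc 1 n) (haK : a ∉ K) (hbK : b ∉ K) (hKa : insert a K ∈ D)
    (hKb : insert b K ∈ D)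
    (hblk : ∀ x ∈ Icc 1 n, Arc a b x → x ∉ K → ∃ X ∈ D, ¬ WeaklySeparated (insert x K) X)
    (hne : ∃ x ∈ Icc 1 n, Arc a b x ∧ x ∉ K) :
    (∃ X ∈ D, a ∈ X ∧ b ∈ X ∧ ∀ t ∈ K, Arc a b t → t ∈ X) ∧
    ∀ Y ∈ D, a ∉ Y → b ∉ Y → (∃ q ∈ Y, Arc a b q ∧ q ∉ K) →
      ∃ X ∈ D, a ∈ X ∧ b ∈ X ∧ (∀ t ∈ K, Arc a b t → t ∈ X) ∧ ∀ t ∈ Y, Arc b a t → t ∈ X := by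
  set t := n + 1 - a with ht
  have hK : K ⊆ Icc 1 n := (subset_insert a K).trans (hD.subset _ hKa)
  have h1 : shiftMod n t a = 1 := by
    unfold shiftMod
    rw [mem_Icc] at ha
    rw [show a + t - 1 = n by omega, Nat.mod_self]
  obtain ⟨g1, g2⟩ := exists_full_of_blocked_one (K := shiftSet n t K) (b := shiftMod n t b)
    (hD.shift t) (shiftMod_mem hb)
    (by rwa [← h1, shiftMod_mem_shiftSet hK ha]) (by rwa [shiftMod_mem_shiftSet hK hb])
    (by rw [← h1, ← shiftSet_insert]; exact mem_image_of_mem _ hKa)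
    (by rw [← shiftSet_insert]; exact mem_image_of_mem _ hKb) (by
      intro x hx hax hxK
      obtain ⟨x, hx', rfl⟩ := exists_shiftMod_eq t hx
      rw [← h1, arc_shiftMod ha hb hx'] at hax
      rw [shiftMod_mem_shiftSet hK hx'] at hxK
      obtain ⟨X, hX, hw⟩ := hblk x hx' hax hxK
      refine ⟨_, mem_image_of_mem _ hX, ?_⟩
      rwa [← shiftSet_insert, weaklySeparated_shiftSet (insert_subset hx' hK) (hD.subset X hX)]) (by
      obtain ⟨x, hx, h, hxK⟩ := hne
      refine ⟨shiftMod n t x, shiftMod_mem hx, ?_, ?_⟩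
      · rwa [← h1, arc_shiftMod ha hb hx]
      · rwa [shiftMod_mem_shiftSet hK hx])
  have tr : ∀ X, X ⊆ Icc 1 n → 1 ∈ shiftSet n t X ∧ shiftMod n t b ∈ shiftSet n t X ∧
      (∀ y ∈ shiftSet n t K, Arc 1 (shiftMod n t b) y → y ∈ shiftSet n t X) →
      a ∈ X ∧ b ∈ X ∧ ∀ t ∈ K, Arc a b t → t ∈ X := by
    rintro X hX ⟨h3, h4, h5⟩
    refine ⟨?_, ?_, fun y hy h => ?_⟩
    · rwa [← h1, shiftMod_mem_shiftSet hX ha] at h3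
    · rwa [shiftMod_mem_shiftSet hX hb] at h4
    · have := h5 _ (mem_image_of_mem _ hy)
      rw [← h1, arc_shiftMod ha hb (hK hy)] at this
      have := this h
      rwa [shiftMod_mem_shiftSet hX (hK hy)] at this
  constructor
  · obtain ⟨X, hX, h⟩ := g1
    obtain ⟨X, hX', rfl⟩ := mem_image.1 hX
    exact ⟨X, hX', tr X (hD.subset X hX') h⟩
  · intro Y hY haY hbY ⟨q, hq, hq', hqK⟩
    have hYn := hD.subset Y hY
    obtain ⟨X, hX, h3, h4, h5, h6⟩ := g2 _ (mem_image_of_mem _ hY)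
      (by rwa [← h1, shiftMod_mem_shiftSet hYn ha]) (by rwa [shiftMod_mem_shiftSet hYn hb])
      ⟨_, mem_image_of_mem _ hq, by rwa [← h1, arc_shiftMod ha hb (hYn hq)],
        by rwa [shiftMod_mem_shiftSet hK (hYn hq)]⟩
    obtain ⟨X, hX', rfl⟩ := mem_image.1 hX
    obtain ⟨h7, h8, h9⟩ := tr X (hD.subset X hX') ⟨h3, h4, h5⟩
    refine ⟨X, hX', h7, h8, h9, fun y hy h => ?_⟩
    have := h6 _ (mem_image_of_mem _ hy)
    rw [← h1, arc_shiftMod hb ha (hYn hy)] at this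
    have := this h
    rwa [shiftMod_mem_shiftSet (hD.subset X hX') (hYn hy)] at this

theorem arc_or_arc {a b x : ℕ} (hab : a ≠ b) (ha : x ≠ a) (hb : x ≠ b) :
    Arc a b x ∨ Arc b a x := by
  unfold Arc
  omega

theorem sdiff_insert_sdiff {n a b : ℕ} (hb : b ∈ Icc 1 n) (hab : a ≠ b) (hbK : b ∉ K) :
    insert b (Icc 1 n \ insert a (insert b K)) = Icc 1 n \ insert a K := by
  ext x
  simp only [mem_insert, mem_sdiff]
  by_cases h : x = b
  · subst h
    simp [hb, hab.symm, hbK]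
  · simp [h]

theorem exists_coFull_of_blocked {n a b : ℕ} (hD : WSFamily n D) (ha : a ∈ Icc 1 n)
    (hb : b ∈ Icc 1 n) (hab : a ≠ b) (haK : a ∉ K) (hbK : b ∉ K) (hKa : insert a K ∈ D)
    (hKb : insert b K ∈ D)
    (hblk : ∀ y ∈ K, Arc b a y → ∃ X ∈ D, ¬ WeaklySeparated ((insert a (insert b K)).erase y) X)
    (hne : ∃ y ∈ K, Arc b a y) :
    (∃ Y ∈ D, a ∉ Y ∧ b ∉ Y ∧ ∀ t ∈ Y, Arc b a t → t ∈ K) ∧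
    ∀ X ∈ D, a ∈ X → b ∈ X → (∃ q ∈ K, Arc b a q ∧ q ∉ X) →
      ∃ Y ∈ D, a ∉ Y ∧ b ∉ Y ∧ (∀ t ∈ Y, Arc b a t → t ∈ K) ∧ ∀ t ∈ Y, Arc a b t → t ∈ X := by
  have hK : K ⊆ Icc 1 n := (subset_insert a K).trans (hD.subset _ hKa)
  set L := insert a (insert b K) with hL
  have hL' : L = insert b (insert a K) := insert_comm _ _ _
  obtain ⟨g1, g2⟩ := exists_full_of_blocked (K := Icc 1 n \ L) hD.compl hb ha
    (by simp [hL]) (by simp [hL])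
    (by rw [hL, sdiff_insert_sdiff hb hab hbK]; exact mem_image_of_mem _ hKa)
    (by rw [hL', sdiff_insert_sdiff ha hab.symm haK]; exact mem_image_of_mem _ hKb) (by
      intro x hx hax hxM
      have hxK : x ∈ K := by
        have h1 : x ≠ a := by rintro rfl; unfold Arc at hax; omega
        have h2 : x ≠ b := by rintro rfl; unfold Arc at hax; omega
        simpa [mem_sdiff, hL, h1, h2, mem_Icc.1 hx] using hxM
      obtain ⟨X, hX, hw⟩ := hblk x hxK hax
      refine ⟨_, mem_image_of_mem _ hX, ?_⟩
      have e : insert x (Icc 1 n \ L) = Icc 1 n \ (L.erase x) := by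
        ext z
        simp only [mem_insert, mem_sdiff, mem_erase]
        by_cases h : z = x
        · subst h; simp [hx]
        · simp [h]
      rw [e]
      rwa [weaklySeparated_sdiff _ (hD.subset X hX)]
      exact (erase_subset _ _).trans (insert_subset ha (insert_subset hb hK))) (by
      obtain ⟨y, hy, h⟩ := hne
      exact ⟨y, hK hy, h, by simp [hL, hy]⟩)
  have tr : ∀ Y ∈ D, b ∈ Icc 1 n \ Y ∧ a ∈ Icc 1 n \ Y ∧
      (∀ t ∈ Icc 1 n \ L, Arc b a t → t ∈ Icc 1 n \ Y) →
      a ∉ Y ∧ b ∉ Y ∧ ∀ t ∈ Y, Arc b a t → t ∈ K := by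
    rintro Y hY ⟨h1, h2, h3⟩
    refine ⟨(mem_sdiff.1 h2).2, (mem_sdiff.1 h1).2, fun t ht h => ?_⟩
    by_contra htK
    refine (mem_sdiff.1 (h3 t ?_ h)).2 ht
    have h1 : t ≠ a := by rintro rfl; unfold Arc at h; omega
    have h2 : t ≠ b := by rintro rfl; unfold Arc at h; omega
    exact mem_sdiff.2 ⟨hD.subset Y hY ht, by simp [hL, h1, h2, htK]⟩
  constructor
  · obtain ⟨Z, hZ, h⟩ := g1
    obtain ⟨Y, hY, rfl⟩ := mem_image.1 hZ
    exact ⟨Y, hY, tr Y hY h⟩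
  · intro X hX haX hbX ⟨q, hq, hq', hqX⟩
    obtain ⟨Z, hZ, h1, h2, h3, h4⟩ := g2 _ (mem_image_of_mem _ hX) (by simp [hbX]) (by simp [haX])
      ⟨q, mem_sdiff.2 ⟨hK hq, hqX⟩, hq', by simp [hL, hq]⟩
    obtain ⟨Y, hY, rfl⟩ := mem_image.1 hZ
    obtain ⟨h5, h6, h7⟩ := tr Y hY ⟨h1, h2, h3⟩
    refine ⟨Y, hY, h5, h6, h7, fun t ht h => ?_⟩
    by_contra htX
    exact (mem_sdiff.1 (h4 t (mem_sdiff.2 ⟨hD.subset Y hY ht, htX⟩) h)).2 ht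

/-- If `K ∪ {a}` and `K ∪ {b}` belong to a weakly separated family and some exchange on the arc
from `a` to `b` is possible, then some such exchange is weakly separated from the family. -/
theorem exists_weaklySeparated_exchange {n a b : ℕ} (hD : WSFamily n D) (ha : a ∈ Icc 1 n)
    (hb : b ∈ Icc 1 n) (hab : a ≠ b) (haK : a ∉ K) (hbK : b ∉ K) (hKa : insert a K ∈ D)
    (hKb : insert b K ∈ D)
    (hne : (∃ x ∈ Icc 1 n, Arc a b x ∧ x ∉ K) ∨ ∃ y ∈ K, Arc b a y) :
    (∃ x ∈ Icc 1 n, Arc a b x ∧ x ∉ K ∧ ∀ X ∈ D, WeaklySeparated (insert x K) X) ∨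
    ∃ y ∈ K, Arc b a y ∧ ∀ X ∈ D, WeaklySeparated ((insert a (insert b K)).erase y) X := by
  by_contra! hcon
  obtain ⟨hblk, hblk'⟩ := hcon
  have hcard : ∀ X ∈ D, X.card = K.card + 1 := fun X hX => by
    rw [hD.card_eq X hX _ hKa, card_insert_of_notMem haK]
  have hfull := fun h => exists_full_of_blocked hD ha hb haK hbK hKa hKb hblk h
  have hcofull := fun h => exists_coFull_of_blocked hD ha hb hab haK hbK hKa hKb hblk' h
  have hX1 : ∀ X ∈ D, a ∈ X → b ∈ X → (∀ t ∈ K, Arc a b t → t ∈ X) →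
      ∃ y ∈ K, Arc b a y ∧ y ∉ X := by
    intro X hX haX hbX h
    have : ¬ insert a (insert b K) ⊆ X := by
      intro hsub
      have := card_le_card hsub
      rw [card_insert_of_notMem (by simp [hab, haK]), card_insert_of_notMem hbK, hcard X hX] at this
      omega
    obtain ⟨t, ht, htX⟩ := not_subset.1 this
    have h1 : t ≠ a := fun h => htX (h ▸ haX)
    have h2 : t ≠ b := fun h => htX (h ▸ hbX)
    have htK : t ∈ K := by simpa [h1, h2] using ht
    exact ⟨t, htK, (arc_or_arc hab h1 h2).resolve_left fun h' => htX (h t htK h'), htX⟩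
  have hY1 : ∀ Y ∈ D, a ∉ Y → b ∉ Y → (∀ t ∈ Y, Arc b a t → t ∈ K) →
      ∃ q ∈ Y, Arc a b q ∧ q ∉ K := by
    intro Y hY haY hbY h
    have : ¬ Y ⊆ K := by
      intro hsub
      have := card_le_card hsub
      rw [hcard Y hY] at this
      omega
    obtain ⟨t, ht, htK⟩ := not_subset.1 this
    have h1 : t ≠ a := fun h => haY (h ▸ ht)
    have h2 : t ≠ b := fun h => hbY (h ▸ ht)
    exact ⟨t, ht, (arc_or_arc hab h1 h2).resolve_right fun h' => htK (h t ht h'), htK⟩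
  have hY : ∃ Y ∈ D, a ∉ Y ∧ b ∉ Y ∧ ∀ t ∈ Y, Arc b a t → t ∈ K := by
    rcases hne with h | h
    · obtain ⟨X, hX, h1, h2, h3⟩ := (hfull h).1
      obtain ⟨y, hy, h4, -⟩ := hX1 X hX h1 h2 h3
      exact (hcofull ⟨y, hy, h4⟩).1
    · exact (hcofull h).1
  have hcomm : ∀ X ∈ D, (X \ K).card = (K \ X).card + 1 := by
    intro X hX
    have e6 := card_sdiff_add_card_inter X K
    have e7 := card_sdiff_add_card_inter K X
    rw [inter_comm, ] at e7
    have := hcard X hX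
    omega
  have desc : ∀ N, ∀ Y ∈ D, a ∉ Y → b ∉ Y → (∀ t ∈ Y, Arc b a t → t ∈ K) →
      (K \ Y).card ≤ N → False := by
    intro N
    induction N with
    | zero | succ N ih =>
      intro Y hY haY hbY h hN
      obtain ⟨q, hq, hq', hqK⟩ := hY1 Y hY haY hbY h
      obtain ⟨X, hX, h1, h2, h3, h4⟩ :=
        (hfull ⟨q, hD.subset Y hY hq, hq', hqK⟩).2 Y hY haY hbY ⟨q, hq, hq', hqK⟩
      obtain ⟨y, hy, hy', hyX⟩ := hX1 X hX h1 h2 h3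
      obtain ⟨Z, hZ, h5, h6, h7, h8⟩ := (hcofull ⟨y, hy, hy'⟩).2 X hX h1 h2 ⟨y, hy, hy', hyX⟩
      have c1 : K \ X ⊆ K \ Y := by
        intro t ht
        rw [mem_sdiff] at ht ⊢
        have n1 : t ≠ a := fun h => ht.2 (h ▸ h1)
        have n2 : t ≠ b := fun h => ht.2 (h ▸ h2)
        rcases arc_or_arc hab n1 n2 with g | g
        · exact absurd (h3 t ht.1 g) ht.2
        · exact ⟨ht.1, fun htY => ht.2 (h4 t htY g)⟩
      have c2 : Z \ K ⊆ ((X \ K).erase a).erase b := by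
        intro t ht
        rw [mem_sdiff] at ht
        have n1 : t ≠ a := fun h => h5 (h ▸ ht.1)
        have n2 : t ≠ b := fun h => h6 (h ▸ ht.1)
        rcases arc_or_arc hab n1 n2 with g | g
        · simp [n1, n2, h8 t ht.1 g, ht.2]
        · exact absurd (h7 t ht.1 g) ht.2
      have c3 := card_le_card c1
      have c4 := card_le_card c2
      rw [card_erase_of_mem (by simp [hab.symm, h2, hbK]), card_erase_of_mem (by simp [h1, haK])]
        at c4
      have c5 := hcomm X hX
      have c6 := hcomm Z hZ
      first | omega | exact ih Z hZ h5 h6 h7 (by omega)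
  obtain ⟨Y, hY, h1, h2, h3⟩ := hY
  exact desc _ Y hY h1 h2 h3 le_rfl

/-- The pairs `{p, q}` and `{m, r}` alternate around the circle. -/
def Cross (p q m r : ℕ) : Prop :=
  p < m ∧ m < q ∧ q < r ∨ p < r ∧ r < q ∧ q < m ∨ q < m ∧ m < p ∧ p < r ∨
    q < r ∧ r < p ∧ p < m ∨ m < p ∧ p < r ∧ r < q ∨ m < q ∧ q < r ∧ r < p ∨
    r < p ∧ p < m ∧ m < q ∨ r < q ∧ q < m ∧ m < p

theorem Cross.swap {p q m r : ℕ} (h : Cross p q m r) : Cross m r p q := by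
  unfold Cross at *
  grind

theorem Cross.ne {p q m r : ℕ} (h : Cross p q m r) : p ≠ m ∧ p ≠ r ∧ q ≠ m ∧ q ≠ r := by
  unfold Cross at h
  rcases h with g | g | g | g | g | g | g | g <;> omega

theorem Cross.replace {p q m r : ℕ} (h : Cross p q m r) {c : ℕ} (hm : c ≠ m) (hr : c ≠ r) :
    Cross c q m r ∨ Cross p c m r := by
  unfold Cross at *
  grind

theorem WeaklySeparated.not_crossing {S T : Finset ℕ} (h : WeaklySeparated S T) {p q m r : ℕ}
    (hp : p ∈ S \ T) (hq : q ∈ S \ T) (hm : m ∈ T \ S) (hr : r ∈ T \ S) : ¬ Cross p q m r := by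
  intro hc
  rcases hc with g | g | g | g | g | g | g | g
  · exact h ⟨_, _, _, _, g.1, g.2.1, g.2.2, Or.inl ⟨hp, hq, hm, hr⟩⟩
  · exact h ⟨_, _, _, _, g.1, g.2.1, g.2.2, Or.inl ⟨hp, hq, hr, hm⟩⟩
  · exact h ⟨_, _, _, _, g.1, g.2.1, g.2.2, Or.inl ⟨hq, hp, hm, hr⟩⟩
  · exact h ⟨_, _, _, _, g.1, g.2.1, g.2.2, Or.inl ⟨hq, hp, hr, hm⟩⟩
  · exact h ⟨_, _, _, _, g.1, g.2.1, g.2.2, Or.inr ⟨hm, hr, hp, hq⟩⟩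
  · exact h ⟨_, _, _, _, g.1, g.2.1, g.2.2, Or.inr ⟨hm, hr, hq, hp⟩⟩
  · exact h ⟨_, _, _, _, g.1, g.2.1, g.2.2, Or.inr ⟨hr, hm, hp, hq⟩⟩
  · exact h ⟨_, _, _, _, g.1, g.2.1, g.2.2, Or.inr ⟨hr, hm, hq, hp⟩⟩

theorem not_cross_of_faces {K' W W' : Finset ℕ} (hW : W.card = 3) (hW' : W'.card = 3)
    (hcard : K.card = K'.card) (hne : K ≠ K')
    (hws : ∀ a ∈ W, ∀ b ∈ W', WeaklySeparated (insert a K) (insert b K')) {p q m r : ℕ}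
    (hp : (p ∈ K ∨ p ∈ W) ∧ p ∉ K') (hq : (q ∈ K ∨ q ∈ W) ∧ q ∉ K')
    (hm : (m ∈ K' ∨ m ∈ W') ∧ m ∉ K) (hr : (r ∈ K' ∨ r ∈ W') ∧ r ∉ K) : ¬ Cross p q m r := by
  have third : ∀ V : Finset ℕ, V.card = 3 → ∀ y z, ∃ c ∈ V, c ≠ y ∧ c ≠ z := by
    intro V hV y z
    by_contra! hcon
    have : V ⊆ {y, z} := by
      intro c hc
      have := hcon c hc
      simp only [mem_insert, mem_singleton]
      tauto
    have := card_le_card this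
    have := card_le_two (a := y) (b := z)
    omega
  have pick : ∀ {K W : Finset ℕ}, W.card = 3 → ∀ {p q m r}, (p ∈ K ∨ p ∈ W) → (q ∈ K ∨ q ∈ W) →
      (p ∈ K ∨ q ∈ K) → Cross p q m r → m ∉ K → r ∉ K →
      ∃ a ∈ W, p ∈ insert a K ∧ q ∈ insert a K ∧ m ∉ insert a K ∧ r ∉ insert a K := by
    intro K W hW p q m r hp hq hpq hc hm hr
    obtain ⟨n1, n2, n3, n4⟩ := hc.ne
    by_cases hpK : p ∈ K
    · by_cases hqK : q ∈ K
      · obtain ⟨a, ha, h1, h2⟩ := third W hW m r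
        exact ⟨a, ha, by simp [hpK], by simp [hqK], by simp [h1.symm, hm], by simp [h2.symm, hr]⟩
      · exact ⟨q, hq.resolve_left hqK, by simp [hpK], by simp, by simp [hm, n3.symm],
          by simp [hr, n4.symm]⟩
    · exact ⟨p, hp.resolve_left hpK, by simp, by simp [hpq.resolve_left hpK],
        by simp [hm, n1.symm], by simp [hr, n2.symm]⟩
  have main : ∀ {p q m r}, ((p ∈ K ∨ p ∈ W) ∧ p ∉ K') → ((q ∈ K ∨ q ∈ W) ∧ q ∉ K') →
      ((m ∈ K' ∨ m ∈ W') ∧ m ∉ K) → ((r ∈ K' ∨ r ∈ W') ∧ r ∉ K) → (p ∈ K ∨ q ∈ K) →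
      (m ∈ K' ∨ r ∈ K') → ¬ Cross p q m r := by
    intro p q m r hp hq hm hr hpq hmr hc
    obtain ⟨a, ha, h1, h2, h3, h4⟩ := pick hW hp.1 hq.1 hpq hc hm.2 hr.2
    obtain ⟨b, hb, h5, h6, h7, h8⟩ := pick hW' hm.1 hr.1 hmr hc.swap hp.2 hq.2
    exact (hws a ha b hb).not_crossing (mem_sdiff.2 ⟨h1, h7⟩) (mem_sdiff.2 ⟨h2, h8⟩)
      (mem_sdiff.2 ⟨h5, h3⟩) (mem_sdiff.2 ⟨h6, h4⟩) hc
  obtain ⟨c, hc, hc'⟩ : ∃ c ∈ K, c ∉ K' := by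
    by_contra! h
    exact hne (eq_of_subset_of_card_le h hcard.ge)
  obtain ⟨e, he, he'⟩ : ∃ e ∈ K', e ∉ K := by
    by_contra! h
    exact hne (eq_of_subset_of_card_le h hcard.le).symm
  have main2 : ∀ {p q}, ((p ∈ K ∨ p ∈ W) ∧ p ∉ K') → ((q ∈ K ∨ q ∈ W) ∧ q ∉ K') →
      (p ∈ K ∨ q ∈ K) → ¬ Cross p q m r := by
    intro p q hp hq hpq hcr
    rcases hcr.swap.replace (c := e) (fun h => hp.2 (h ▸ he)) (fun h => hq.2 (h ▸ he)) with h | h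
    · exact main hp hq ⟨Or.inl he, he'⟩ hr hpq (Or.inl he) h.swap
    · exact main hp hq hm ⟨Or.inl he, he'⟩ hpq (Or.inr he) h.swap
  intro hcr
  rcases hcr.replace (c := c) (fun h => hm.2 (h ▸ hc)) (fun h => hr.2 (h ▸ hc)) with h | h
  · exact main2 ⟨Or.inl hc, hc'⟩ hq (Or.inl hc) h
  · exact main2 hp ⟨Or.inl hc, hc'⟩ (Or.inr hc) h

/-- First coordinate of the `i`-th vertex of the regular `n`-gon. -/
noncomputable def vx (n i : ℕ) : ℝ := Real.cos (2 * Real.pi * i / n)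

/-- Second coordinate of the `i`-th vertex of the regular `n`-gon. -/
noncomputable def vy (n i : ℕ) : ℝ := Real.sin (2 * Real.pi * i / n)

/-- First coordinate of the sum of the vertices of the regular `n`-gon indexed by `S`. -/
noncomputable def px (n : ℕ) (S : Finset ℕ) : ℝ := ∑ i ∈ S, vx n i

/-- Second coordinate of the sum of the vertices of the regular `n`-gon indexed by `S`. -/
noncomputable def py (n : ℕ) (S : Finset ℕ) : ℝ := ∑ i ∈ S, vy n i

theorem angle_shiftMod {n t x : ℕ} (hx : x ∈ Icc 1 n) : ∃ q : ℕ,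
    2 * Real.pi * (shiftMod n t x : ℝ) / n + q * (2 * Real.pi) =
      2 * Real.pi * x / n + 2 * Real.pi * t / n := by
  rw [mem_Icc] at hx
  have hn : (n : ℝ) ≠ 0 := by
    have : n ≠ 0 := by omega
    exact_mod_cast this
  refine ⟨(x + t - 1) / n, ?_⟩
  have h1 : shiftMod n t x + n * ((x + t - 1) / n) = x + t := by
    unfold shiftMod
    have := Nat.mod_add_div (x + t - 1) n
    omega
  have h2 : (shiftMod n t x : ℝ) + n * (((x + t - 1) / n : ℕ) : ℝ) = x + t := by exact_mod_cast h1
  field_simp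
  linarith

theorem vx_shiftMod {n t x : ℕ} (hx : x ∈ Icc 1 n) :
    vx n (shiftMod n t x) = vx n t * vx n x - vy n t * vy n x := by
  obtain ⟨q, hq⟩ := angle_shiftMod (t := t) hx
  unfold vx vy
  rw [← Real.cos_add_nat_mul_two_pi _ q, hq, Real.cos_add]
  ring

theorem vy_shiftMod {n t x : ℕ} (hx : x ∈ Icc 1 n) :
    vy n (shiftMod n t x) = vy n t * vx n x + vx n t * vy n x := by
  obtain ⟨q, hq⟩ := angle_shiftMod (t := t) hx
  unfold vx vy
  rw [← Real.sin_add_nat_mul_two_pi _ q, hq, Real.sin_add]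
  ring

theorem px_shiftSet {n t : ℕ} {S : Finset ℕ} (hS : S ⊆ Icc 1 n) :
    px n (shiftSet n t S) = vx n t * px n S - vy n t * py n S := by
  unfold px py shiftSet
  rw [sum_image fun x hx y hy h => shiftMod_injOn n t (hS hx) (hS hy) h, mul_sum, mul_sum,
    ← sum_sub_distrib]
  exact sum_congr rfl fun x hx => vx_shiftMod (hS hx)

theorem py_shiftSet {n t : ℕ} {S : Finset ℕ} (hS : S ⊆ Icc 1 n) :
    py n (shiftSet n t S) = vy n t * px n S + vx n t * py n S := by
  unfold px py shiftSet
  rw [sum_image fun x hx y hy h => shiftMod_injOn n t (hS hx) (hS hy) h, mul_sum, mul_sum,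
    ← sum_add_distrib]
  exact sum_congr rfl fun x hx => vy_shiftMod (hS hx)

theorem px_insert {n x : ℕ} (h : x ∉ K) : px n (insert x K) = vx n x + px n K := sum_insert h

theorem py_insert {n x : ℕ} (h : x ∉ K) : py n (insert x K) = vy n x + py n K := sum_insert h

theorem vx_sq_add_vy_sq (n i : ℕ) : vx n i ^ 2 + vy n i ^ 2 = 1 := Real.cos_sq_add_sin_sq _

theorem vy_one_nonneg (n : ℕ) : 0 ≤ vy n 1 := by
  unfold vy
  rcases Nat.lt_or_ge n 2 with h | h
  · interval_cases n <;> simp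
  · have : (2 : ℝ) ≤ n := by exact_mod_cast h
    apply Real.sin_nonneg_of_nonneg_of_le_pi
    · positivity
    · rw [div_le_iff₀ (by linarith)]
      push_cast
      nlinarith [Real.pi_pos]

theorem vy_one_pos {n : ℕ} (h : 3 ≤ n) : 0 < vy n 1 := by
  unfold vy
  have : (3 : ℝ) ≤ n := by exact_mod_cast h
  apply Real.sin_pos_of_pos_of_lt_pi
  · have := Real.pi_pos
    positivity
  · rw [div_lt_iff₀ (by linarith)]
    push_cast
    nlinarith [Real.pi_pos]

theorem shiftSet_Icc (n t : ℕ) : shiftSet n t (Icc 1 n) = Icc 1 n :=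
  eq_of_subset_of_card_le (shiftSet_subset Subset.rfl) (card_shiftSet Subset.rfl).ge

theorem px_py_Icc {n : ℕ} (h : 3 ≤ n) : px n (Icc 1 n) = 0 ∧ py n (Icc 1 n) = 0 := by
  have h1 := px_shiftSet (n := n) (t := 1) Subset.rfl
  have h2 := py_shiftSet (n := n) (t := 1) Subset.rfl
  rw [shiftSet_Icc] at h1 h2
  have h3 := vy_one_pos h
  have h4 := vx_sq_add_vy_sq n 1
  set x := px n (Icc 1 n)
  set y := py n (Icc 1 n)
  set c := vx n 1
  set s := vy n 1
  have hpos : 0 < (1 - c) ^ 2 + s ^ 2 := by positivity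
  constructor
  · have : ((1 - c) ^ 2 + s ^ 2) * x = 0 := by linear_combination (1 - c) * h1 - s * h2
    exact (mul_eq_zero.1 this).resolve_left hpos.ne'
  · have : ((1 - c) ^ 2 + s ^ 2) * y = 0 := by linear_combination (1 - c) * h2 + s * h1
    exact (mul_eq_zero.1 this).resolve_left hpos.ne'

theorem px_sdiff {n : ℕ} (h : 3 ≤ n) {S : Finset ℕ} (hS : S ⊆ Icc 1 n) :
    px n (Icc 1 n \ S) = - px n S := by
  have := sum_sdiff (f := vx n) hS
  have := (px_py_Icc h).1
  unfold px at *
  linarith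

theorem py_sdiff {n : ℕ} (h : 3 ≤ n) {S : Finset ℕ} (hS : S ⊆ Icc 1 n) :
    py n (Icc 1 n \ S) = - py n S := by
  have := sum_sdiff (f := vy n) hS
  have := (px_py_Icc h).2
  unfold py at *
  linarith

theorem sin_mul_sin_eq (A B : ℝ) :
    Real.sin A * Real.sin B = (Real.cos (A - B) - Real.cos (A + B)) / 2 := by
  rw [Real.cos_sub, Real.cos_add]
  ring

/-- A function on the vertices of the regular `n`-gon orthogonal to affine functions cannot change
sign along a single chord. -/
theorem not_separated_by_chord {n a b : ℕ} {g : ℕ → ℝ} (h0 : ∑ i ∈ Icc 1 n, g i = 0)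
    (hc : ∑ i ∈ Icc 1 n, g i * vx n i = 0) (hs : ∑ i ∈ Icc 1 n, g i * vy n i = 0)
    (ha : a ∈ Icc 1 n) (hb : b ∈ Icc 1 n) (hab : a ≤ b)
    (hin : ∀ i ∈ Icc 1 n, a ≤ i → i ≤ b → 0 ≤ g i)
    (hout : ∀ i ∈ Icc 1 n, (i < a ∨ b < i) → g i ≤ 0) (hga : 0 < g a) : False := by
  rw [mem_Icc] at ha hb
  have hn : (0 : ℝ) < n := by
    have : 0 < n := by omega
    exact_mod_cast this
  have hπ := Real.pi_pos
  set s : ℝ := a - 1 / 2 with hsdef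
  set t : ℝ := b + 1 / 2 with htdef
  set F : ℕ → ℝ := fun i => Real.sin (Real.pi * (i - s) / n) * Real.sin (Real.pi * (i - t) / n)
    with hF
  have hsum : ∑ i ∈ Icc 1 n, g i * F i = 0 := by
    have : ∀ i ∈ Icc 1 n, g i * F i = (Real.cos (Real.pi * (t - s) / n) / 2) * g i -
        (Real.cos (Real.pi * (s + t) / n) / 2) * (g i * vx n i) -
        (Real.sin (Real.pi * (s + t) / n) / 2) * (g i * vy n i) := by
      intro i _
      simp only [hF, vx, vy]
      rw [sin_mul_sin_eq,
        show Real.pi * (i - s) / n - Real.pi * (i - t) / n = Real.pi * (t - s) / n by ring,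
        show Real.pi * (i - s) / n + Real.pi * (i - t) / n =
          2 * Real.pi * i / n - Real.pi * (s + t) / n by ring, Real.cos_sub]
      ring
    rw [sum_congr rfl this, sum_sub_distrib, sum_sub_distrib, ← mul_sum, ← mul_sum, ← mul_sum,
      h0, hc, hs]
    ring
  have pos : ∀ z : ℝ, 0 < z → z < n → 0 < Real.sin (Real.pi * z / n) := by
    intro z h1 h2
    apply Real.sin_pos_of_pos_of_lt_pi
    · positivity
    · rw [div_lt_iff₀ hn]
      exact mul_lt_mul_of_pos_left h2 hπ
  have neg : ∀ z : ℝ, z < 0 → -n < z → Real.sin (Real.pi * z / n) < 0 := by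
    intro z h1 h2
    have := pos (-z) (by linarith) (by linarith)
    rw [show Real.pi * -z / n = -(Real.pi * z / n) by ring, Real.sin_neg] at this
    linarith
  have ca : (1 : ℝ) ≤ a := by exact_mod_cast ha.1
  have cb : (b : ℝ) ≤ n := by exact_mod_cast hb.2
  have cin : ∀ i ∈ Icc 1 n, a ≤ i → i ≤ b → F i < 0 := by
    intro i hi h1 h2
    have c1 : (a : ℝ) ≤ i := by exact_mod_cast h1
    have c2 : (i : ℝ) ≤ b := by exact_mod_cast h2
    exact mul_neg_of_pos_of_neg (pos _ (by linarith) (by linarith))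
      (neg _ (by linarith) (by linarith))
  have cout : ∀ i ∈ Icc 1 n, (i < a ∨ b < i) → 0 < F i := by
    intro i hi h1
    rw [mem_Icc] at hi
    have c1 : (1 : ℝ) ≤ i := by exact_mod_cast hi.1
    have c2 : (i : ℝ) ≤ n := by exact_mod_cast hi.2
    have c4 : (a : ℝ) ≤ b := by exact_mod_cast hab
    rcases h1 with h1 | h1
    · have c3 : (i : ℝ) + 1 ≤ a := by exact_mod_cast h1
      exact mul_pos_of_neg_of_neg (neg _ (by linarith) (by linarith))
        (neg _ (by linarith) (by linarith))
    · have c3 : (b : ℝ) + 1 ≤ i := by exact_mod_cast h1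
      exact mul_pos (pos _ (by linarith) (by linarith)) (pos _ (by linarith) (by linarith))
  have hlt : ∑ i ∈ Icc 1 n, g i * F i < ∑ i ∈ Icc 1 n, (0 : ℝ) := by
    apply sum_lt_sum
    · intro i hi
      by_cases h : a ≤ i ∧ i ≤ b
      · exact mul_nonpos_of_nonneg_of_nonpos (hin i hi h.1 h.2) (cin i hi h.1 h.2).le
      · exact mul_nonpos_of_nonpos_of_nonneg (hout i hi (by omega)) (cout i hi (by omega)).le
    · have ha' : a ∈ Icc 1 n := mem_Icc.2 ha
      exact ⟨a, ha', mul_neg_of_pos_of_neg hga (cin a ha' le_rfl hab)⟩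
  rw [hsum, sum_const_zero] at hlt
  exact lt_irrefl _ hlt

/-- A nonzero function on the vertices of the regular `n`-gon orthogonal to affine functions has at
least four sign changes. -/
theorem exists_cross_of_sum_eq_zero {n : ℕ} {g : ℕ → ℝ} (h0 : ∑ i ∈ Icc 1 n, g i = 0)
    (hc : ∑ i ∈ Icc 1 n, g i * vx n i = 0) (hs : ∑ i ∈ Icc 1 n, g i * vy n i = 0)
    (hne : ∃ i ∈ Icc 1 n, g i ≠ 0) :
    ∃ p ∈ Icc 1 n, ∃ q ∈ Icc 1 n, ∃ m ∈ Icc 1 n, ∃ r ∈ Icc 1 n,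
      0 < g p ∧ 0 < g q ∧ g m < 0 ∧ g r < 0 ∧ Cross p q m r := by
  by_contra! hcon
  have hP : ((Icc 1 n).filter (fun i => 0 < g i)).Nonempty := by
    by_contra hP
    have hle : ∀ i ∈ Icc 1 n, g i ≤ 0 := fun i hi => not_lt.1 fun h => hP ⟨i, by simp_all⟩
    obtain ⟨i, hi, hgi⟩ := hne
    exact hgi ((sum_eq_zero_iff_of_nonpos hle).1 h0 i hi)
  have hM : ((Icc 1 n).filter (fun i => g i < 0)).Nonempty := by
    by_contra hM
    have hle : ∀ i ∈ Icc 1 n, 0 ≤ g i := fun i hi => not_lt.1 fun h => hM ⟨i, by simp_all⟩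
    obtain ⟨i, hi, hgi⟩ := hne
    exact hgi ((sum_eq_zero_iff_of_nonneg hle).1 h0 i hi)
  have a1 := min'_mem _ hP
  have b1 := max'_mem _ hP
  have c1 := min'_mem _ hM
  have d1 := max'_mem _ hM
  have a2 := fun y => min'_le ((Icc 1 n).filter (fun i => 0 < g i)) y
  have b2 := fun y => le_max' ((Icc 1 n).filter (fun i => 0 < g i)) y
  have c2 := fun y => min'_le ((Icc 1 n).filter (fun i => g i < 0)) y
  have d2 := fun y => le_max' ((Icc 1 n).filter (fun i => g i < 0)) y
  set a := ((Icc 1 n).filter (fun i => 0 < g i)).min' hP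
  set b := ((Icc 1 n).filter (fun i => 0 < g i)).max' hP
  set c := ((Icc 1 n).filter (fun i => g i < 0)).min' hM
  set d := ((Icc 1 n).filter (fun i => g i < 0)).max' hM
  simp only [mem_filter] at a1 b1 c1 d1 a2 b2 c2 d2
  have hab : a ≤ b := a2 b b1
  have hcd : c ≤ d := c2 d d1
  have sgn : ∀ i, 0 < g i → ¬ g i < 0 := fun i h => not_lt.2 h.le
  by_cases hmid : ∃ m ∈ Icc 1 n, a ≤ m ∧ m ≤ b ∧ g m < 0
  · obtain ⟨m, hm, h1, h2, h3⟩ := hmid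
    have n1 : m ≠ a := fun h => sgn a a1.2 (h ▸ h3)
    have n2 : m ≠ b := fun h => sgn b b1.2 (h ▸ h3)
    have n3 : c ≠ a := fun h => sgn a a1.2 (h ▸ c1.2)
    have n4 : d ≠ b := fun h => sgn b b1.2 (h ▸ d1.2)
    have hac : a < c := by
      by_contra hlt
      exact hcon a a1.1 b b1.1 c c1.1 m hm a1.2 b1.2 c1.2 h3
        (Or.inr (Or.inr (Or.inr (Or.inr (Or.inl (by omega))))))
    have hdb : d < b := by
      by_contra hlt
      exact hcon a a1.1 b b1.1 m hm d d1.1 a1.2 b1.2 h3 d1.2 (Or.inl (by omega))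
    refine not_separated_by_chord (g := fun i => - g i) (a := c) (b := d) (by simpa using h0)
      (by simpa using hc) (by simpa using hs) c1.1 d1.1 hcd ?_ ?_ (by simpa using c1.2)
    · intro p hp h4 h5
      simp only [Left.nonneg_neg_iff]
      by_contra! h6
      have n5 : p ≠ c := fun h => sgn p h6 (h ▸ c1.2)
      have n6 : p ≠ d := fun h => sgn p h6 (h ▸ d1.2)
      exact hcon a a1.1 p hp c c1.1 d d1.1 a1.2 h6 c1.2 d1.2 (Or.inl (by omega))
    · intro i hi h4
      simp only [Left.neg_nonpos_iff]
      by_contra! h6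
      have := c2 i ⟨hi, h6⟩
      have := d2 i ⟨hi, h6⟩
      omega
  · push Not at hmid
    refine not_separated_by_chord h0 hc hs a1.1 b1.1 hab hmid ?_ a1.2
    intro i hi h4
    by_contra! h6
    have := a2 i ⟨hi, h6⟩
    have := b2 i ⟨hi, h6⟩
    omega

/-- The indicator function of `S`. -/
noncomputable def ind (S : Finset ℕ) (i : ℕ) : ℝ := if i ∈ S then 1 else 0

theorem ind_of_mem {S : Finset ℕ} {i : ℕ} (h : i ∈ S) : ind S i = 1 := if_pos h

theorem ind_of_notMem {S : Finset ℕ} {i : ℕ} (h : i ∉ S) : ind S i = 0 := if_neg h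

theorem ind_nonneg (S : Finset ℕ) (i : ℕ) : 0 ≤ ind S i := by
  unfold ind
  split_ifs <;> norm_num

theorem ind_le_one (S : Finset ℕ) (i : ℕ) : ind S i ≤ 1 := by
  unfold ind
  split_ifs <;> norm_num

theorem sum_ind_mul {n : ℕ} {S : Finset ℕ} (hS : S ⊆ Icc 1 n) (f : ℕ → ℝ) :
    ∑ i ∈ Icc 1 n, ind S i * f i = ∑ i ∈ S, f i := by
  simp only [ind, ite_mul, one_mul, zero_mul, sum_ite_mem, inter_eq_right.2 hS]

theorem sum_ind {n : ℕ} {S : Finset ℕ} (hS : S ⊆ Icc 1 n) :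
    ∑ i ∈ Icc 1 n, ind S i = S.card := by
  simpa using sum_ind_mul hS fun _ => 1

theorem eq_of_px_py_eq {n : ℕ} {S T : Finset ℕ} (hS : S ⊆ Icc 1 n) (hT : T ⊆ Icc 1 n)
    (hcard : S.card = T.card) (hws : WeaklySeparated S T) (hx : px n S = px n T)
    (hy : py n S = py n T) : S = T := by
  by_contra hne
  obtain ⟨p, -, q, -, m, -, r, -, hp, hq, hm, hr, hc⟩ :=
    exists_cross_of_sum_eq_zero (n := n) (g := fun i => ind S i - ind T i)
    (by rw [sum_sub_distrib, sum_ind hS, sum_ind hT, hcard, sub_self])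
    (by
      simp only [sub_mul, sum_sub_distrib, sum_ind_mul hS, sum_ind_mul hT]
      exact sub_eq_zero.2 hx)
    (by
      simp only [sub_mul, sum_sub_distrib, sum_ind_mul hS, sum_ind_mul hT]
      exact sub_eq_zero.2 hy)
    (by
      by_contra! h
      apply hne
      ext i
      by_cases hi : i ∈ Icc 1 n
      · have := h i hi
        by_cases h1 : i ∈ S <;> by_cases h2 : i ∈ T <;>
          simp_all [ind_of_mem, ind_of_notMem]
      · exact iff_of_false (fun h => hi (hS h)) (fun h => hi (hT h)))
  have key : ∀ {S T : Finset ℕ} {i}, 0 < ind S i - ind T i → i ∈ S \ T := by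
    intro S T i h
    rw [mem_sdiff]
    by_contra! hcon
    by_cases h1 : i ∈ S
    · rw [ind_of_mem h1, ind_of_mem (hcon h1)] at h
      linarith
    · rw [ind_of_notMem h1] at h
      linarith [ind_nonneg T i]
  exact hws.not_crossing (key hp) (key hq) (key (by linarith)) (key (by linarith)) hc

theorem shiftSet_eq_of_vertex {n t : ℕ} (hD : WSFamily n D) (hsym : ∀ I ∈ D, shiftSet n t I ∈ D)
    {I : Finset ℕ} (hI : I ∈ D) (hx : px n I = 0) (hy : py n I = 0) : shiftSet n t I = I := by
  have hs := hD.subset I hI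
  have hI' := hsym I hI
  refine eq_of_px_py_eq (hD.subset _ hI') hs (hD.card_eq _ hI' _ hI) (hD.ws _ hI' _ hI) ?_ ?_
  · rw [px_shiftSet hs, hx, hy]; simp
  · rw [py_shiftSet hs, hx, hy]; simp

theorem shiftSet_eq_of_face {n t : ℕ} (hD : WSFamily n D) (hsym : ∀ I ∈ D, shiftSet n t I ∈ D)
    (hv : ∀ I ∈ D, ¬ (px n I = 0 ∧ py n I = 0)) {a b x : ℕ} (hab : a ≠ b) (hax : a ≠ x)
    (hbx : b ≠ x) (haK : a ∉ K) (hbK : b ∉ K) (hxK : x ∉ K) (hKa : insert a K ∈ D)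
    (hKb : insert b K ∈ D) (hKx : insert x K ∈ D) {α β γ : ℝ} (hα : 0 ≤ α) (hβ : 0 ≤ β)
    (hγ : 0 ≤ γ) (hpos : 0 < α + β + γ)
    (hx0 : α * px n (insert a K) + β * px n (insert b K) + γ * px n (insert x K) = 0)
    (hy0 : α * py n (insert a K) + β * py n (insert b K) + γ * py n (insert x K) = 0) :
    shiftSet n t K = K := by
  have hK : K ⊆ Icc 1 n := (subset_insert a K).trans (hD.subset _ hKa)
  have ha : a ∈ Icc 1 n := hD.subset _ hKa (mem_insert_self _ _)
  have hb : b ∈ Icc 1 n := hD.subset _ hKb (mem_insert_self _ _)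
  have hx : x ∈ Icc 1 n := hD.subset _ hKx (mem_insert_self _ _)
  have hKa' := hsym _ hKa
  have hKb' := hsym _ hKb
  have hKx' := hsym _ hKx
  have sa := hD.subset _ hKa
  have sb := hD.subset _ hKb
  have sx := hD.subset _ hKx
  have sa' := hD.subset _ hKa'
  have sb' := hD.subset _ hKb'
  have sx' := hD.subset _ hKx'
  have xa := px_shiftSet (t := t) sa
  have xb := px_shiftSet (t := t) sb
  have xx := px_shiftSet (t := t) sx
  have ya := py_shiftSet (t := t) sa
  have yb := py_shiftSet (t := t) sb
  have yx := py_shiftSet (t := t) sx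
  have cK : K.card = (shiftSet n t K).card := (card_shiftSet hK).symm
  rw [shiftSet_insert] at *
  have haK' : shiftMod n t a ∉ shiftSet n t K := by rwa [shiftMod_mem_shiftSet hK ha]
  have hbK' : shiftMod n t b ∉ shiftSet n t K := by rwa [shiftMod_mem_shiftSet hK hb]
  have hxK' : shiftMod n t x ∉ shiftSet n t K := by rwa [shiftMod_mem_shiftSet hK hx]
  have hab' : shiftMod n t a ≠ shiftMod n t b := fun h => hab (shiftMod_injOn n t ha hb h)
  have hax' : shiftMod n t a ≠ shiftMod n t x := fun h => hax (shiftMod_injOn n t ha hx h)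
  have hbx' : shiftMod n t b ≠ shiftMod n t x := fun h => hbx (shiftMod_injOn n t hb hx h)
  generalize shiftMod n t a = a' at *
  generalize shiftMod n t b = b' at *
  generalize shiftMod n t x = x' at *
  generalize shiftSet n t K = K' at *
  by_contra hne
  set G : ℕ → ℝ := fun i => α * ind (insert a K) i + β * ind (insert b K) i +
    γ * ind (insert x K) i with hG
  set G' : ℕ → ℝ := fun i => α * ind (insert a' K') i + β * ind (insert b' K') i +
    γ * ind (insert x' K') i with hG'
  have sumG : ∀ f : ℕ → ℝ, ∑ i ∈ Icc 1 n, G i * f i = α * ∑ i ∈ insert a K, f i +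
      β * ∑ i ∈ insert b K, f i + γ * ∑ i ∈ insert x K, f i := by
    intro f
    simp only [hG, add_mul, sum_add_distrib, mul_assoc, ← mul_sum, sum_ind_mul sa, sum_ind_mul sb,
      sum_ind_mul sx]
  have sumG' : ∀ f : ℕ → ℝ, ∑ i ∈ Icc 1 n, G' i * f i = α * ∑ i ∈ insert a' K', f i +
      β * ∑ i ∈ insert b' K', f i + γ * ∑ i ∈ insert x' K', f i := by
    intro f
    simp only [hG', add_mul, sum_add_distrib, mul_assoc, ← mul_sum, sum_ind_mul sa',
      sum_ind_mul sb', sum_ind_mul sx']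
  have val : ∀ {K a b x}, a ∉ K → b ∉ K → x ∉ K → ∀ i, (i ∈ K → α * ind (insert a K) i +
      β * ind (insert b K) i + γ * ind (insert x K) i = α + β + γ) ∧
      (i ∉ K → i ∉ ({a, b, x} : Finset ℕ) → α * ind (insert a K) i +
      β * ind (insert b K) i + γ * ind (insert x K) i = 0) := by
    intro K a b x _ _ _ i
    constructor
    · intro h
      rw [ind_of_mem (mem_insert_of_mem h), ind_of_mem (mem_insert_of_mem h),
        ind_of_mem (mem_insert_of_mem h)]
      ring
    · intro h h1
      simp only [mem_insert, mem_singleton, not_or] at h1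
      rw [ind_of_notMem (by simp [h, h1]), ind_of_notMem (by simp [h, h1]),
        ind_of_notMem (by simp [h, h1])]
      ring
  have bd : ∀ A B C : Finset ℕ, ∀ i, 0 ≤ α * ind A i + β * ind B i + γ * ind C i ∧
      α * ind A i + β * ind B i + γ * ind C i ≤ α + β + γ := by
    intro A B C i
    have := ind_nonneg A i
    have := ind_nonneg B i
    have := ind_nonneg C i
    have := mul_le_mul_of_nonneg_left (ind_le_one A i) hα
    have := mul_le_mul_of_nonneg_left (ind_le_one B i) hβ
    have := mul_le_mul_of_nonneg_left (ind_le_one C i) hγ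
    constructor
    · positivity
    · linarith
  have hnz : ∃ i ∈ Icc 1 n, G i - G' i ≠ 0 := by
    by_contra! hz
    obtain ⟨i, hi, hiK'⟩ : ∃ c ∈ K, c ∉ K' := by
      by_contra! h
      exact hne (eq_of_subset_of_card_le h cK.ge).symm
    have h1 := hz i (hK hi)
    have h2 : G i = α + β + γ := (val haK hbK hxK i).1 hi
    rw [h2] at h1
    have mem : ∀ c, c ∉ K' → ind (insert c K') i = if i = c then 1 else 0 := by
      intro c _
      simp [ind, hiK']
    simp only [hG', mem a' haK', mem b' hbK', mem x' hxK'] at h1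
    by_cases ia : i = a'
    · subst ia
      simp only [if_true, hab', hax', if_false] at h1
      have hα' : α ≠ 0 := by intro h; linarith
      have e1 : β = 0 := by linarith
      have e2 : γ = 0 := by linarith
      simp only [e1, e2, zero_mul, add_zero, mul_eq_zero, hα', false_or] at hx0 hy0
      exact hv _ hKa ⟨hx0, hy0⟩
    by_cases ib : i = b'
    · subst ib
      simp only [if_true, ia, hbx', if_false] at h1
      have hα' : β ≠ 0 := by intro h; linarith
      have e1 : α = 0 := by linarith
      have e2 : γ = 0 := by linarith
      simp only [e1, e2, zero_mul, add_zero, zero_add, mul_eq_zero, hα', false_or] at hx0 hy0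
      exact hv _ hKb ⟨hx0, hy0⟩
    by_cases ix : i = x'
    · subst ix
      simp only [if_true, ia, ib, if_false] at h1
      have hα' : γ ≠ 0 := by intro h; linarith
      have e1 : α = 0 := by linarith
      have e2 : β = 0 := by linarith
      simp only [e1, e2, zero_mul, zero_add, mul_eq_zero, hα', false_or] at hx0 hy0
      exact hv _ hKx ⟨hx0, hy0⟩
    · simp only [ia, ib, ix, if_false] at h1
      linarith
  obtain ⟨p, -, q, -, m, -, r, -, hp, hq, hm, hr, hc⟩ :=
    exists_cross_of_sum_eq_zero (n := n) (g := fun i => G i - G' i)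
    (by
      have e1 := sumG fun _ => 1
      have e2 := sumG' fun _ => 1
      simp only [mul_one, sum_const, nsmul_eq_mul, card_insert_of_notMem haK,
        card_insert_of_notMem hbK, card_insert_of_notMem hxK, card_insert_of_notMem haK',
        card_insert_of_notMem hbK', card_insert_of_notMem hxK', cK] at e1 e2
      rw [sum_sub_distrib, e1, e2, sub_self])
    (by
      simp only [sub_mul, sum_sub_distrib, sumG, sumG']
      change α * px n _ + β * px n _ + γ * px n _ - (α * px n _ + β * px n _ + γ * px n _) = 0
      rw [xa, xb, xx]
      linear_combination (1 - vx n t) * hx0 + vy n t * hy0)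
    (by
      simp only [sub_mul, sum_sub_distrib, sumG, sumG']
      change α * py n _ + β * py n _ + γ * py n _ - (α * py n _ + β * py n _ + γ * py n _) = 0
      rw [ya, yb, yx]
      linear_combination (1 - vx n t) * hy0 - vy n t * hx0)
    hnz
  have sgn : ∀ i, 0 < G i - G' i → (i ∈ K ∨ i ∈ ({a, b, x} : Finset ℕ)) ∧ i ∉ K' := by
    intro i hi
    have h1 := bd (insert a K) (insert b K) (insert x K) i
    have h2 := bd (insert a' K') (insert b' K') (insert x' K') i
    constructor
    · by_contra! h
      have : G i = 0 := (val haK hbK hxK i).2 h.1 h.2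
      linarith [h2.1]
    · intro h
      have : G' i = α + β + γ := (val haK' hbK' hxK' i).1 h
      linarith [h1.2]
  have sgn' : ∀ i, G i - G' i < 0 → (i ∈ K' ∨ i ∈ ({a', b', x'} : Finset ℕ)) ∧ i ∉ K := by
    intro i hi
    have h1 := bd (insert a K) (insert b K) (insert x K) i
    have h2 := bd (insert a' K') (insert b' K') (insert x' K') i
    constructor
    · by_contra! h
      have : G' i = 0 := (val haK' hbK' hxK' i).2 h.1 h.2
      linarith [h1.1]
    · intro h
      have : G i = α + β + γ := (val haK hbK hxK i).1 h
      linarith [h2.2]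
  refine not_cross_of_faces (K := K) (K' := K') (W := {a, b, x}) (W' := {a', b', x'})
    (card_eq_three.2 ⟨a, b, x, hab, hax, hbx, rfl⟩)
    (card_eq_three.2 ⟨a', b', x', hab', hax', hbx', rfl⟩) cK (fun h => hne h.symm) ?_
    (sgn p hp) (sgn q hq) (sgn' m hm) (sgn' r hr) hc
  intro c hc e he
  simp only [mem_insert, mem_singleton] at hc he
  apply hD.ws
  · rcases hc with rfl | rfl | rfl <;> assumption
  · rcases he with rfl | rfl | rfl <;> assumption

theorem shiftMod_shiftMod (n s t : ℕ) {x : ℕ} (hx : 1 ≤ x) :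
    shiftMod n s (shiftMod n t x) = shiftMod n (s + t) x := by
  unfold shiftMod
  rw [show (x + t - 1) % n + 1 + s - 1 = (x + t - 1) % n + s by omega, Nat.mod_add_mod,
    show x + (s + t) - 1 = x + t - 1 + s by omega]

theorem shiftSet_mul_eq {n t : ℕ} {S : Finset ℕ} (hS : S ⊆ Icc 1 n) (h : shiftSet n t S = S)
    (m : ℕ) : shiftSet n (t * m) S = S := by
  induction m with
  | zero =>
    conv_rhs => rw [← image_id (s := S)]
    refine image_congr fun x hx => ?_
    have := mem_Icc.1 (hS hx)
    rw [shiftMod_eq (hS hx)]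
    simp [this.2]
  | succ m ih =>
    conv_rhs => rw [← ih, ← h]
    unfold shiftSet
    rw [image_image]
    refine image_congr fun x hx => ?_
    rw [Function.comp_apply, shiftMod_shiftMod _ _ _ (mem_Icc.1 (hS hx)).1, Nat.mul_succ]

theorem dvd_card_of_shiftSet_eq_of_dvd {g d : ℕ} (hg : 0 < g) (hd : 2 ≤ d) {S : Finset ℕ}
    (hS : S ⊆ Icc 1 (g * d)) (h : shiftSet (g * d) g S = S) : d ∣ S.card := by
  have hlt : g < g * d := by nlinarith
  have step : ∀ x j, 1 ≤ x → x + j * g ≤ g * d → (x + j * g ∈ S ↔ x ∈ S) := by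
    intro x j hx
    induction j with
    | zero => simp
    | succ j ih =>
      intro hj
      have e : x + (j + 1) * g = x + j * g + g := by ring
      rw [e] at hj ⊢
      have hm : x + j * g ∈ Icc 1 (g * d) := mem_Icc.2 (by omega)
      rw [← ih (by omega), ← shiftMod_mem_shiftSet (t := g) hS hm, h, shiftMod_eq hm,
        Nat.mod_eq_of_lt hlt, if_pos hj]
  have himg : S = ((S.filter (· ≤ g)) ×ˢ range d).image fun p => p.1 + p.2 * g := by
    ext y
    simp only [mem_image, mem_product, mem_filter, mem_range, Prod.exists]
    constructor
    · intro hy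
      have hy' := mem_Icc.1 (hS hy)
      have e := Nat.mod_add_div (y - 1) g
      have hlt' := Nat.mod_lt (y - 1) hg
      have hy1 : (y - 1) % g + 1 + (y - 1) / g * g = y := by
        rw [mul_comm]
        omega
      refine ⟨(y - 1) % g + 1, (y - 1) / g, ⟨⟨?_, by omega⟩, ?_⟩, hy1⟩
      · rw [← step _ ((y - 1) / g) (by omega) (by omega), hy1]
        exact hy
      · exact Nat.div_lt_of_lt_mul (by omega)
    · rintro ⟨x, j, ⟨⟨hx, hxg⟩, hj⟩, rfl⟩
      have hx' := mem_Icc.1 (hS hx)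
      refine (step x j hx'.1 ?_).2 hx
      have := Nat.mul_le_mul_right g (Nat.succ_le_of_lt hj)
      rw [Nat.succ_mul, mul_comm d] at this
      omega
  rw [himg, card_image_of_injOn, card_product, card_range]
  · exact dvd_mul_left _ _
  · rintro ⟨x, i⟩ hx ⟨y, j⟩ hy hxy
    simp only [coe_product, Set.mem_prod, mem_coe, mem_filter] at hx hy hxy
    have h1 := mem_Icc.1 (hS hx.1.1)
    have h2 := mem_Icc.1 (hS hy.1.1)
    have e1 : x + i * g - 1 = (x - 1) + g * i := by rw [mul_comm]; omega
    have e2 : y + j * g - 1 = (y - 1) + g * j := by rw [mul_comm]; omega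
    have e3 : (x - 1) + g * i = (y - 1) + g * j := by omega
    have q := congrArg (· / g) e3
    simp only [Nat.add_mul_div_left _ _ hg] at q
    rw [Nat.div_eq_of_lt (by omega), Nat.div_eq_of_lt (by omega), zero_add, zero_add] at q
    subst q
    simp only [Prod.mk.injEq, and_true]
    omega

theorem dvd_card_of_shiftSet_eq {n t : ℕ} (hn : 0 < n) (hd : 2 ≤ n / Nat.gcd n t) {S : Finset ℕ}
    (hS : S ⊆ Icc 1 n) (h : shiftSet n t S = S) : n / Nat.gcd n t ∣ S.card := by
  have hg : 0 < Nat.gcd n t := Nat.gcd_pos_of_pos_left _ hn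
  have hgn : Nat.gcd n t * (n / Nat.gcd n t) = n := Nat.mul_div_cancel' (Nat.gcd_dvd_left n t)
  have hlt : Nat.gcd t n < n := by
    rw [Nat.gcd_comm]
    nlinarith
  obtain ⟨m, -, hm⟩ := Nat.exists_mul_mod_eq_gcd hlt
  have h1 := shiftSet_mul_eq hS h m
  have h2 : shiftSet n (Nat.gcd n t) S = S := by
    conv_rhs => rw [← h1]
    refine image_congr fun x hx => ?_
    rw [shiftMod_eq (hS hx), shiftMod_eq (hS hx), hm, Nat.gcd_comm n t, Nat.mod_eq_of_lt hlt]
  generalize Nat.gcd n t = g at *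
  generalize n / g = d at *
  subst hgn
  exact dvd_card_of_shiftSet_eq_of_dvd hg hd hS h2

theorem det_pos_of_arc {n a b x : ℕ} (ha : a ∈ Icc 1 n) (hb : b ∈ Icc 1 n) (hx : x ∈ Icc 1 n)
    (h : Arc b a x) : 0 < (vx n b - vx n a) * (vy n x - vy n a) -
      (vy n b - vy n a) * (vx n x - vx n a) := by
  rw [mem_Icc] at ha hb hx
  have hn : (0 : ℝ) < n := by
    have : 0 < n := by omega
    exact_mod_cast this
  have hπ := Real.pi_pos
  have pos : ∀ i j : ℕ, 1 ≤ i → i < j → j ≤ n → 0 < Real.sin (Real.pi * j / n - Real.pi * i / n) := by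
    intro i j h1 h2 h3
    have c1 : (1 : ℝ) ≤ i := by exact_mod_cast h1
    have c2 : (i : ℝ) < j := by exact_mod_cast h2
    have c3 : (j : ℝ) ≤ n := by exact_mod_cast h3
    rw [show Real.pi * j / n - Real.pi * i / n = Real.pi * (j - i) / n by ring]
    apply Real.sin_pos_of_pos_of_lt_pi
    · have : (0 : ℝ) < j - i := by linarith
      positivity
    · rw [div_lt_iff₀ hn]
      exact mul_lt_mul_of_pos_left (by linarith) hπ
  have neg : ∀ i j : ℕ, 1 ≤ i → i < j → j ≤ n → Real.sin (Real.pi * i / n - Real.pi * j / n) < 0 := by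
    intro i j h1 h2 h3
    have := pos i j h1 h2 h3
    rw [← neg_sub, Real.sin_neg] at this
    linarith
  have key : (vx n b - vx n a) * (vy n x - vy n a) - (vy n b - vy n a) * (vx n x - vx n a) =
      4 * (Real.sin (Real.pi * b / n - Real.pi * a / n) *
        Real.sin (Real.pi * x / n - Real.pi * a / n) *
        Real.sin (Real.pi * x / n - Real.pi * b / n)) := by
    have two : ∀ i : ℕ, 2 * Real.pi * i / n = 2 * (Real.pi * i / n) := fun i => by ring
    unfold vx vy
    simp only [two]
    generalize Real.pi * a / n = α
    generalize Real.pi * b / n = β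
    generalize Real.pi * x / n = ξ
    rw [Real.cos_sub_cos, Real.cos_sub_cos, Real.sin_sub_sin, Real.sin_sub_sin,
      show (2 * β - 2 * α) / 2 = β - α by ring, show (2 * ξ - 2 * α) / 2 = ξ - α by ring,
      show (2 * β + 2 * α) / 2 = β + α by ring, show (2 * ξ + 2 * α) / 2 = ξ + α by ring,
      show Real.sin (ξ - β) = Real.sin ((ξ + α) - (β + α)) by congr 1; ring,
      Real.sin_sub (ξ + α)]
    ring
  rw [key]
  rcases h with h | h | h
  · have h1 := neg b a (by omega) (by omega) (by omega)
    have h2 := neg x a (by omega) (by omega) (by omega)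
    have h3 := pos b x (by omega) (by omega) (by omega)
    have := mul_pos (mul_pos_of_neg_of_neg h1 h2) h3
    linarith
  · have h1 := pos a b (by omega) (by omega) (by omega)
    have h2 := neg x a (by omega) (by omega) (by omega)
    have h3 := neg x b (by omega) (by omega) (by omega)
    have := mul_pos_of_neg_of_neg (mul_neg_of_pos_of_neg h1 h2) h3
    linarith
  · have h1 := pos a b (by omega) (by omega) (by omega)
    have h2 := pos a x (by omega) (by omega) (by omega)
    have h3 := pos b x (by omega) (by omega) (by omega)
    have := mul_pos (mul_pos h1 h2) h3
    linarith

theorem weaklySeparated_Icc {n : ℕ} (k : ℕ) {T : Finset ℕ} (hT : T ⊆ Icc 1 n) :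
    WeaklySeparated (Icc 1 k) T := by
  rintro ⟨a, b, c, d, hab, hbc, hcd, ⟨h1, h2, h3, h4⟩ | ⟨h1, h2, h3, h4⟩⟩
  · rw [mem_sdiff] at *
    have := mem_Icc.1 (hT h3.1)
    have := mem_Icc.1 h2.1
    exact h3.2 (mem_Icc.2 (by omega))
  · rw [mem_sdiff] at *
    have := mem_Icc.1 (hT h2.1)
    have := mem_Icc.1 h4.1
    exact h2.2 (mem_Icc.2 (by omega))

theorem weaklySeparated_shiftSet_Icc {n k : ℕ} (t : ℕ) (hk : k ≤ n) {T : Finset ℕ}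
    (hT : T ⊆ Icc 1 n) : WeaklySeparated (shiftSet n t (Icc 1 k)) T := by
  have hI : Icc 1 k ⊆ Icc 1 n := Icc_subset_Icc_right hk
  obtain ⟨T', hT', rfl⟩ : ∃ T' ⊆ Icc 1 n, shiftSet n t T' = T := by
    refine ⟨(Icc 1 n).filter fun x => shiftMod n t x ∈ T, filter_subset _ _, ?_⟩
    ext y
    simp only [shiftSet, mem_image, mem_filter]
    constructor
    · rintro ⟨x, ⟨-, hx⟩, rfl⟩
      exact hx
    · intro hy
      obtain ⟨x, hx, rfl⟩ := exists_shiftMod_eq t (hT hy)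
      exact ⟨x, ⟨hx, hy⟩, rfl⟩
  exact (weaklySeparated_Icc k hT').shiftSet hI hT'

/-- A cyclic path of directed edges in the plane around the origin, in which every edge is the side
of some face on its left, has a face containing the origin. -/
theorem exists_face_around_origin {ι : Type*} {A : Finset ι} {p q : ι → ℝ} {s : ℝ}
    {E : ι → ι → Prop} {F : ι → ι → ι → Prop} (hs : ∀ i ∈ A, q i - s * p i ≠ 0)
    (hnext : ∀ i ∈ A, ∀ j ∈ A, E i j → 0 < p i * q j - p j * q i → ∃ x ∈ A, E i x ∧ E x j ∧
      F i j x ∧ 0 < (p j - p i) * (q x - q i) - (q j - q i) * (p x - p i))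
    (hstart : ∃ i ∈ A, ∃ j ∈ A, E i j ∧ q i - s * p i < 0 ∧ 0 < q j - s * p j ∧
      0 < p i * q j - p j * q i) :
    ∃ i j x, F i j x ∧ 0 < p i * q j - p j * q i ∧ 0 ≤ p j * q x - p x * q j ∧
      0 ≤ p x * q i - p i * q x := by
  classical
  set f : ι × ι → ℝ := fun z => (p z.1 * q z.2 - p z.2 * q z.1) /
    ((q z.2 - s * p z.2) - (q z.1 - s * p z.1)) with hf
  set B := (A ×ˢ A).filter fun z => E z.1 z.2 ∧ q z.1 - s * p z.1 < 0 ∧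
    0 < q z.2 - s * p z.2 ∧ 0 < p z.1 * q z.2 - p z.2 * q z.1 with hB
  have hBne : B.Nonempty := by
    obtain ⟨i, hi, j, hj, h⟩ := hstart
    exact ⟨(i, j), mem_filter.2 ⟨mem_product.2 ⟨hi, hj⟩, h⟩⟩
  obtain ⟨⟨i, j⟩, hij, hmin⟩ := exists_min_image B f hBne
  obtain ⟨hmem, hE, h1, h2, h3⟩ := mem_filter.1 hij
  obtain ⟨hi, hj⟩ := mem_product.1 hmem
  simp only at hE h1 h2 h3 hi hj
  obtain ⟨x, hx, hix, hxj, hF, hdet⟩ := hnext i hi j hj hE h3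
  have hmin' : ∀ a ∈ A, ∀ b ∈ A, E a b → q a - s * p a < 0 → 0 < q b - s * p b →
      0 < p a * q b - p b * q a → (p i * q j - p j * q i) *
        ((q b - s * p b) - (q a - s * p a)) ≤ (p a * q b - p b * q a) *
        ((q j - s * p j) - (q i - s * p i)) := by
    intro a ha b hb hab e1 e2 e3
    have := hmin (a, b) (mem_filter.2 ⟨mem_product.2 ⟨ha, hb⟩, hab, e1, e2, e3⟩)
    simp only [hf] at this
    rwa [div_le_div_iff₀ (by linarith) (by linarith)] at this
  have rel : (p j * q x - p x * q j) * (q i - s * p i) + (p x * q i - p i * q x) *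
      (q j - s * p j) + (p i * q j - p j * q i) * (q x - s * p x) = 0 := by ring
  refine ⟨i, j, x, hF, h3, ?_⟩
  rcases lt_or_gt_of_ne (hs x hx) with h | h
  · have c1 : 0 ≤ p j * q x - p x * q j := by
      by_contra! hc
      have := hmin' x hx j hj hxj h h2 (by linarith)
      have := mul_pos h2 hdet
      linarith
    refine ⟨c1, ?_⟩
    by_contra! hc
    have := mul_nonpos_of_nonneg_of_nonpos c1 h1.le
    have := mul_neg_of_neg_of_pos hc h2
    have := mul_neg_of_pos_of_neg h3 h
    linarith
  · have c1 : 0 ≤ p x * q i - p i * q x := by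
      by_contra! hc
      have := hmin' i hi x hx hix h1 h (by linarith)
      have := mul_neg_of_neg_of_pos h1 hdet
      linarith
    refine ⟨?_, c1⟩
    by_contra! hc
    have := mul_pos_of_neg_of_neg hc h1
    have := mul_nonneg c1 h2.le
    have := mul_pos h3 h
    linarith

/-- `I` and `J` differ by exchanging one element. -/
def Adj (I J : Finset ℕ) : Prop :=
  ∃ a b K, a ≠ b ∧ a ∉ K ∧ b ∉ K ∧ I = insert a K ∧ J = insert b K

/-- `I`, `J`, `X` are three distinct one-element extensions of the same set. -/
def Fan (I J X : Finset ℕ) : Prop :=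
  ∃ a b x K, a ≠ b ∧ a ≠ x ∧ b ≠ x ∧ a ∉ K ∧ b ∉ K ∧ x ∉ K ∧ I = insert a K ∧ J = insert b K ∧
    X = insert x K

theorem cross_nonpos_of_cyclic_interval {n a b : ℕ} (hn : 2 ≤ n) (ha : a ∈ Icc 1 n)
    (hb : b ∈ Icc 1 n) (hab : a ≠ b) (hK : K ⊆ Icc 1 n) (haK : a ∉ K)
    (hbK : b ∉ K) (h1 : ∀ x ∈ Icc 1 n, Arc b a x → x ∈ K) (h2 : ∀ y ∈ K, ¬ Arc a b y) :
    px n (insert a K) * py n (insert b K) - px n (insert b K) * py n (insert a K) ≤ 0 := by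
  have hJ : insert b K ⊆ Icc 1 n := insert_subset hb hK
  have heq : shiftSet n 1 (insert b K) = insert a K := by
    refine eq_of_subset_of_card_le ?_ ?_
    · intro y hy
      obtain ⟨x, hx, rfl⟩ := mem_image.1 hy
      have hx' := hJ hx
      rw [mem_insert]
      by_contra! hcon
      refine hcon.2 (h1 _ (shiftMod_mem hx') ?_)
      have hxx : x = b ∨ Arc b a x := by
        rcases mem_insert.1 hx with rfl | hxK
        · exact Or.inl rfl
        · exact Or.inr ((arc_or_arc hab (fun h => haK (h ▸ hxK))
            (fun h => hbK (h ▸ hxK))).resolve_left (h2 x hxK))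
      have hne := hcon.1
      clear hcon
      rw [shiftMod_eq hx', Nat.mod_eq_of_lt (by omega : 1 < n)] at hne ⊢
      unfold Arc at hxx ⊢
      rw [mem_Icc] at ha hb hx'
      split_ifs at hne ⊢ <;> omega
    · rw [card_shiftSet hJ, card_insert_of_notMem haK, card_insert_of_notMem hbK]
  rw [← heq, px_shiftSet hJ, py_shiftSet hJ]
  have := vy_one_nonneg n
  nlinarith [mul_nonneg this (add_nonneg (sq_nonneg (px n (insert b K)))
    (sq_nonneg (py n (insert b K))))]

theorem exists_next_face {n k : ℕ} {I J : Finset ℕ} (hn : 2 ≤ n) (hD : WSFamily n D)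
    (hcard : ∀ I ∈ D, I.card = k)
    (hfull : ∀ X ⊆ Icc 1 n, X.card = k → (∀ Y ∈ D, WeaklySeparated X Y) → X ∈ D)
    (hI : I ∈ D) (hJ : J ∈ D) (hadj : Adj I J) (hpos : 0 < px n I * py n J - px n J * py n I) :
    ∃ X ∈ D, Adj I X ∧ Adj X J ∧
      (Fan I J X ∨ Fan (Icc 1 n \ I) (Icc 1 n \ J) (Icc 1 n \ X)) ∧
      0 < (px n J - px n I) * (py n X - py n I) - (py n J - py n I) * (px n X - px n I) := by
  obtain ⟨a, b, K, hab, haK, hbK, rfl, rfl⟩ := hadj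
  have hK : K ⊆ Icc 1 n := (subset_insert a K).trans (hD.subset _ hI)
  have ha : a ∈ Icc 1 n := hD.subset _ hI (mem_insert_self _ _)
  have hb : b ∈ Icc 1 n := hD.subset _ hJ (mem_insert_self _ _)
  have hne : (∃ x ∈ Icc 1 n, Arc b a x ∧ x ∉ K) ∨ ∃ y ∈ K, Arc a b y := by
    by_contra! h
    exact absurd hpos (cross_nonpos_of_cyclic_interval hn ha hb hab hK haK hbK h.1 h.2).not_gt
  have hk := hcard _ hI
  rw [card_insert_of_notMem haK] at hk
  rcases exists_weaklySeparated_exchange hD hb ha hab.symm hbK haK hJ hI hne with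
    ⟨x, hx, harc, hxK, hws⟩ | ⟨y, hy, harc, hws⟩
  · have hax : a ≠ x := by rintro rfl; unfold Arc at harc; omega
    have hbx : b ≠ x := by rintro rfl; unfold Arc at harc; omega
    refine ⟨insert x K, hfull _ (insert_subset hx hK) ?_ hws, ⟨a, x, K, hax, haK, hxK, rfl, rfl⟩,
      ⟨x, b, K, hbx.symm, hxK, hbK, rfl, rfl⟩,
      Or.inl ⟨a, b, x, K, hab, hax, hbx, haK, hbK, hxK, rfl, rfl, rfl⟩, ?_⟩
    · rw [card_insert_of_notMem hxK, hk]
    · rw [px_insert haK, px_insert hbK, px_insert hxK, py_insert haK, py_insert hbK, py_insert hxK]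
      have := det_pos_of_arc ha hb hx harc
      linarith
  · have hay : a ≠ y := by rintro rfl; exact haK hy
    have hby : b ≠ y := by rintro rfl; exact hbK hy
    have hyn := hK hy
    obtain ⟨K, hyK, rfl⟩ : ∃ K', y ∉ K' ∧ K = insert y K' :=
      ⟨K.erase y, notMem_erase y K, (insert_erase hy).symm⟩
    have haK' : a ∉ K := fun h => haK (mem_insert_of_mem h)
    have hbK' : b ∉ K := fun h => hbK (mem_insert_of_mem h)
    have hK' : K ⊆ Icc 1 n := (subset_insert y K).trans hK
    have hX : (insert b (insert a (insert y K))).erase y = insert a (insert b K) := by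
      ext z
      simp only [mem_erase, mem_insert]
      constructor
      · tauto
      · intro h
        refine ⟨?_, by tauto⟩
        rintro rfl
        rcases h with h | h | h
        · exact hay h.symm
        · exact hby h.symm
        · exact hyK h
    rw [hX] at hws
    have habK : a ∉ insert b K := by simp [hab, haK']
    rw [card_insert_of_notMem hyK] at hk
    refine ⟨insert a (insert b K), hfull _ (insert_subset ha (insert_subset hb hK')) ?_ hws,
      ⟨y, b, insert a K, hby.symm, ?_, ?_, ?_, ?_⟩, ⟨a, y, insert b K, hay, habK, ?_, rfl, ?_⟩,
      Or.inr ⟨b, a, y, Icc 1 n \ insert a (insert b (insert y K)), hab.symm, hby, hay,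
        by simp, by simp, by simp, ?_, ?_, ?_⟩, ?_⟩
    · rw [card_insert_of_notMem habK, card_insert_of_notMem hbK', hk]
    · simp [hay.symm, hyK]
    · simp [hab.symm, hbK']
    · rw [insert_comm]
    · rw [insert_comm]
    · simp [hby.symm, hyK]
    · rw [insert_comm]
    · exact (sdiff_insert_sdiff hb hab hbK).symm
    · rw [insert_comm a b]
      exact (sdiff_insert_sdiff ha hab.symm haK).symm
    · ext z
      simp only [mem_insert, mem_sdiff]
      by_cases h : z = y
      · subst h
        simp [hyn, hay.symm, hby.symm, hyK]
      · simp [h]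
    · rw [px_insert haK, px_insert hbK, px_insert habK, py_insert haK, py_insert hbK,
        py_insert habK, px_insert hyK, py_insert hyK, px_insert hbK', py_insert hbK']
      have := det_pos_of_arc hb ha hyn harc
      linarith

theorem exists_ascent {n : ℕ} {H : ℕ → ℝ} (hn : 0 < n) (hper : ∀ j, H (j + n) = H j)
    (hne : ∀ j, H j ≠ 0) (hsum : ∑ j ∈ Icc 1 n, H j = 0) : ∃ j, H j < 0 ∧ 0 < H (j + 1) := by
  by_contra! hcon
  have hlt : ∀ j, H j < 0 → H (j + 1) < 0 := fun j h => lt_of_le_of_ne (hcon j h) (hne _)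
  have hneI : (Icc 1 n).Nonempty := ⟨1, mem_Icc.2 ⟨le_rfl, hn⟩⟩
  obtain ⟨i, hi, hi'⟩ : ∃ i ∈ Icc 1 n, H i < 0 := by
    by_contra! h
    exact (sum_pos (fun j hj => lt_of_le_of_ne (h j hj) (hne j).symm) hneI).ne' hsum
  have hall : ∀ m, H (i + m) < 0 := by
    intro m
    induction m with
    | zero => exact hi'
    | succ m ih => exact hlt _ ih
  refine (sum_neg (fun j hj => ?_) hneI).ne hsum
  rw [← hper, show j + n = i + (j + n - i) by rw [mem_Icc] at hi; omega]
  exact hall _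

theorem vx_add_self {n : ℕ} (hn : 0 < n) (j : ℕ) : vx n (j + n) = vx n j := by
  unfold vx
  have : (n : ℝ) ≠ 0 := by exact_mod_cast hn.ne'
  rw [← Real.cos_add_two_pi (2 * Real.pi * j / n)]
  congr 1
  push_cast
  field_simp

theorem vy_add_self {n : ℕ} (hn : 0 < n) (j : ℕ) : vy n (j + n) = vy n j := by
  unfold vy
  have : (n : ℝ) ≠ 0 := by exact_mod_cast hn.ne'
  rw [← Real.sin_add_two_pi (2 * Real.pi * j / n)]
  congr 1
  push_cast
  field_simp

theorem shiftSet_succ_Icc {n k j : ℕ} (hk : k ≤ n) :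
    shiftSet n (j + 1) (Icc 1 k) = shiftSet n j (Icc 2 (k + 1)) := by
  have : Icc 2 (k + 1) = (Icc 1 k).image (· + 1) := by
    simp
  unfold shiftSet
  rw [this, image_image]
  refine image_congr fun x hx => ?_
  simp only [Function.comp_apply]
  unfold shiftMod
  congr 2
  omega

theorem exists_start {n k : ℕ} {s : ℝ} (hn : 3 ≤ n) (hk : 1 ≤ k) (hkn : k < n)
    (hmem : ∀ j, shiftSet n j (Icc 1 k) ∈ D) (hs : ∀ I ∈ D, py n I - s * px n I ≠ 0) :
    ∃ I ∈ D, ∃ J ∈ D, Adj I J ∧ py n I - s * px n I < 0 ∧ 0 < py n J - s * px n J ∧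
      0 < px n I * py n J - px n J * py n I := by
  have hI : Icc 1 k ⊆ Icc 1 n := Icc_subset_Icc_right hkn.le
  have hsum := px_py_Icc hn
  obtain ⟨j, h1, h2⟩ := exists_ascent (n := n) (H := fun j => py n (shiftSet n j (Icc 1 k)) -
      s * px n (shiftSet n j (Icc 1 k))) (by omega)
    (fun j => by
      simp only [px_shiftSet hI, py_shiftSet hI, vx_add_self (by omega : 0 < n),
        vy_add_self (by omega : 0 < n)])
    (fun j => hs _ (hmem j))
    (by
      have e : ∀ j ∈ Icc 1 n, py n (shiftSet n j (Icc 1 k)) - s * px n (shiftSet n j (Icc 1 k)) =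
          (py n (Icc 1 k) - s * px n (Icc 1 k)) * vx n j +
          (px n (Icc 1 k) + s * py n (Icc 1 k)) * vy n j := by
        intro j _
        rw [px_shiftSet hI, py_shiftSet hI]
        ring
      rw [sum_congr rfl e, sum_add_distrib, ← mul_sum, ← mul_sum]
      change _ * px n (Icc 1 n) + _ * py n (Icc 1 n) = 0
      rw [hsum.1, hsum.2]
      ring)
  have hsub : Icc 2 k ⊆ Icc 1 n := Icc_subset_Icc (by omega) hkn.le
  have m1 : 1 ∈ Icc 1 n := mem_Icc.2 (by omega)
  have m2 : k + 1 ∈ Icc 1 n := mem_Icc.2 (by omega)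
  refine ⟨_, hmem j, _, hmem (j + 1), ⟨shiftMod n j 1, shiftMod n j (k + 1), shiftSet n j (Icc 2 k),
    fun h => ?_, ?_, ?_, ?_, ?_⟩, h1, h2, ?_⟩
  · have := shiftMod_injOn n j m1 m2 h
    omega
  · rw [shiftMod_mem_shiftSet hsub m1]
    simp
  · rw [shiftMod_mem_shiftSet hsub m2]
    simp
  · rw [← shiftSet_insert]
    congr 1
    ext x
    simp only [mem_insert, mem_Icc]
    omega
  · rw [← shiftSet_insert, shiftSet_succ_Icc hkn.le]
    congr 1
    ext x
    simp only [mem_insert, mem_Icc]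
    omega
  · have hne := hs _ (hmem j)
    have hS := shiftSet_subset (t := j) hI
    have e : shiftSet n (j + 1) (Icc 1 k) = shiftSet n 1 (shiftSet n j (Icc 1 k)) := by
      unfold shiftSet
      rw [image_image]
      refine image_congr fun x hx => ?_
      rw [Function.comp_apply, shiftMod_shiftMod _ _ _ (mem_Icc.1 (hI hx)).1, add_comm]
    rw [e, px_shiftSet hS, py_shiftSet hS]
    have hvy := vy_one_pos hn
    generalize px n (shiftSet n j (Icc 1 k)) = x at *
    generalize py n (shiftSet n j (Icc 1 k)) = y at *
    have hpos : 0 < x ^ 2 + y ^ 2 := by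
      by_contra! h
      have hx : x = 0 := by nlinarith [sq_nonneg x, sq_nonneg y]
      have hy : y = 0 := by nlinarith [sq_nonneg x, sq_nonneg y]
      apply hne
      rw [hx, hy]
      ring
    have := mul_pos hvy hpos
    linarith

theorem shiftSet_sdiff {n t : ℕ} {S : Finset ℕ} (hS : S ⊆ Icc 1 n) :
    shiftSet n t (Icc 1 n \ S) = Icc 1 n \ shiftSet n t S := by
  refine eq_of_subset_of_card_le ?_ ?_
  · intro y hy
    obtain ⟨x, hx, rfl⟩ := mem_image.1 hy
    rw [mem_sdiff] at hx ⊢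
    rw [shiftMod_mem_shiftSet hS hx.1]
    exact ⟨shiftMod_mem hx.1, hx.2⟩
  · rw [card_shiftSet sdiff_subset, card_sdiff_of_subset hS,
      card_sdiff_of_subset (shiftSet_subset hS), card_shiftSet hS]

theorem Fan.exists_shiftSet_eq {n t : ℕ} {I J X : Finset ℕ} (hF : Fan I J X) (hD : WSFamily n D)
    (hsym : ∀ I ∈ D, shiftSet n t I ∈ D) (hv : ∀ I ∈ D, ¬ (px n I = 0 ∧ py n I = 0)) (hI : I ∈ D)
    (hJ : J ∈ D) (hX : X ∈ D) {α β γ : ℝ} (hα : 0 ≤ α) (hβ : 0 ≤ β) (hγ : 0 ≤ γ)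
    (hpos : 0 < α + β + γ) (hx0 : α * px n I + β * px n J + γ * px n X = 0)
    (hy0 : α * py n I + β * py n J + γ * py n X = 0) :
    ∃ K ⊆ Icc 1 n, K.card + 1 = I.card ∧ shiftSet n t K = K := by
  obtain ⟨a, b, x, K, hab, hax, hbx, haK, hbK, hxK, rfl, rfl, rfl⟩ := hF
  exact ⟨K, (subset_insert a K).trans (hD.subset _ hI), (card_insert_of_notMem haK).symm,
    shiftSet_eq_of_face hD hsym hv hab hax hbx haK hbK hxK hI hJ hX hα hβ hγ hpos hx0 hy0⟩

/-- A maximal weakly separated family invariant under a rotation contains an invariant vertex or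
the label of an invariant white or black face. -/
theorem exists_shiftSet_eq {n k t : ℕ} (hn : 3 ≤ n) (hk : 1 ≤ k) (hkn : k < n)
    (hD : WSFamily n D) (hcard : ∀ I ∈ D, I.card = k)
    (hfull : ∀ X ⊆ Icc 1 n, X.card = k → (∀ Y ∈ D, WeaklySeparated X Y) → X ∈ D)
    (hsym : ∀ I ∈ D, shiftSet n t I ∈ D) :
    ∃ K ⊆ Icc 1 n, (K.card = k ∨ K.card + 1 = k ∨ K.card + 1 = n - k) ∧ shiftSet n t K = K := by
  by_cases hv : ∃ I ∈ D, px n I = 0 ∧ py n I = 0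
  · obtain ⟨I, hI, hx, hy⟩ := hv
    exact ⟨I, hD.subset I hI, Or.inl (hcard I hI), shiftSet_eq_of_vertex hD hsym hI hx hy⟩
  push Not at hv
  obtain ⟨s, hs⟩ := Infinite.exists_notMem_finset (D.image fun I => py n I / px n I)
  obtain ⟨s, hs⟩ : ∃ s : ℝ, ∀ I ∈ D, py n I - s * px n I ≠ 0 := by
    refine ⟨s, fun I hI h => hs (mem_image.2 ⟨I, hI, ?_⟩)⟩
    by_cases hx : px n I = 0
    · rw [hx, mul_zero, sub_zero] at h
      exact absurd h (hv I hI hx)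
    · rw [div_eq_iff hx]
      linarith
  have hmem : ∀ j, shiftSet n j (Icc 1 k) ∈ D := by
    intro j
    have hI : Icc 1 k ⊆ Icc 1 n := Icc_subset_Icc_right hkn.le
    refine hfull _ (shiftSet_subset hI) (by rw [card_shiftSet hI]; simp) fun Y hY => ?_
    exact weaklySeparated_shiftSet_Icc j hkn.le (hD.subset Y hY)
  obtain ⟨I, J, X, ⟨hI, hJ, hX, hF⟩, c1, c2, c3⟩ := exists_face_around_origin (A := D) (p := px n)
    (q := py n) (s := s) (E := Adj) (F := fun I J X => I ∈ D ∧ J ∈ D ∧ X ∈ D ∧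
      (Fan I J X ∨ Fan (Icc 1 n \ I) (Icc 1 n \ J) (Icc 1 n \ X))) hs
    (by
      intro I hI J hJ hadj hpos
      obtain ⟨X, hX, h1, h2, h3, h4⟩ :=
        exists_next_face (by omega) hD hcard hfull hI hJ hadj hpos
      exact ⟨X, hX, h1, h2, ⟨hI, hJ, hX, h3⟩, h4⟩)
    (exists_start hn hk hkn hmem hs)
  rcases hF with hF | hF
  · obtain ⟨K, hK, h1, h2⟩ := hF.exists_shiftSet_eq hD hsym (fun I hI h => hv I hI h.1 h.2) hI hJ hX
      c2 c3 c1.le (by linarith) (by ring) (by ring)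
    exact ⟨K, hK, Or.inr (Or.inl (h1.trans (hcard I hI))), h2⟩
  · have sI := hD.subset I hI
    have sJ := hD.subset J hJ
    have sX := hD.subset X hX
    obtain ⟨K, hK, h1, h2⟩ := hF.exists_shiftSet_eq (t := t) hD.compl
      (by
        simp only [forall_mem_image]
        intro I hI
        rw [shiftSet_sdiff (hD.subset I hI)]
        exact mem_image_of_mem _ (hsym I hI))
      (by
        simp only [forall_mem_image]
        intro I hI
        rw [px_sdiff hn (hD.subset I hI), py_sdiff hn (hD.subset I hI), neg_eq_zero, neg_eq_zero]
        exact fun h => hv I hI h.1 h.2)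
      (mem_image_of_mem _ hI) (mem_image_of_mem _ hJ) (mem_image_of_mem _ hX) c2 c3 c1.le
      (by linarith) (by rw [px_sdiff hn sI, px_sdiff hn sJ, px_sdiff hn sX]; ring)
      (by rw [py_sdiff hn sI, py_sdiff hn sJ, py_sdiff hn sX]; ring)
    refine ⟨K, hK, Or.inr (Or.inr ?_), h2⟩
    rw [h1, card_sdiff_of_subset sI, hcard I hI, Nat.card_Icc, Nat.add_sub_cancel]

end WeakSeparation

/-- If `D ⊆ C([n], k)` is a `ρ^ℓ`-symmetric weakly separated collection,
maximal with respect to inclusion among weakly separated collections in `C([n], k)`, then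
`k ≡ c (mod d)` for some `c ∈ {−1, 0, 1}`, where `d = n / gcd(n, ℓ)`. -/
theorem stmt2 (n k ℓ : ℕ) (hn : 2 ≤ n) (hk1 : 1 ≤ k) (hk2 : k ≤ n - 1) (hl : 1 ≤ ℓ)
    (d : ℕ) (hd : d = n / Nat.gcd n ℓ)
    (D : Finset (Finset ℕ))
    (hmem : ∀ I ∈ D, I ⊆ Finset.Icc 1 n ∧ I.card = k)
    (hws : ∀ I ∈ D, ∀ J ∈ D, WeaklySeparated I J)
    (hsym : ∀ I ∈ D, shiftSet n ℓ I ∈ D)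
    (hmax : ∀ D' : Finset (Finset ℕ),
      (∀ I ∈ D', I ⊆ Finset.Icc 1 n ∧ I.card = k) →
      (∀ I ∈ D', ∀ J ∈ D', WeaklySeparated I J) → D ⊆ D' → D' = D) :
    ∃ c : ℤ, (c = -1 ∨ c = 0 ∨ c = 1) ∧ (d : ℤ) ∣ ((k : ℤ) - c) := by
  have hdn : d ∣ n := hd ▸ Nat.div_dvd_of_dvd (Nat.gcd_dvd_left n ℓ)
  have hdpos : 0 < d := Nat.pos_of_dvd_of_pos hdn (by omega)
  rcases Nat.lt_or_ge d 4 with h | h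
  · have : (k : ℤ) % d = 0 ∨ (k : ℤ) % d = 1 ∨ ((k : ℤ) + 1) % d = 0 := by
      interval_cases d <;> omega
    rcases this with h | h | h
    · exact ⟨0, by simp, by rw [sub_zero]; exact Int.dvd_of_emod_eq_zero h⟩
    · exact ⟨1, by simp, h ▸ Int.dvd_self_sub_emod⟩
    · exact ⟨-1, by simp, by rw [sub_neg_eq_add]; exact Int.dvd_of_emod_eq_zero h⟩
  have hdle := Nat.le_of_dvd (by omega) hdn
  have hD : WSFamily n D := ⟨fun I hI => (hmem I hI).1,
    fun I hI J hJ => (hmem I hI).2.trans (hmem J hJ).2.symm, hws⟩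
  have hfull : ∀ X ⊆ Finset.Icc 1 n, X.card = k → (∀ Y ∈ D, WeaklySeparated X Y) → X ∈ D := by
    intro X hX hXk hXD
    rw [← hmax (insert X D) ?_ ?_ (Finset.subset_insert X D)]
    · exact Finset.mem_insert_self X D
    · exact Finset.forall_mem_insert _ _ _ |>.2 ⟨⟨hX, hXk⟩, hmem⟩
    · have self : WeaklySeparated X X := by simp [WeaklySeparated]
      have symm : ∀ Y ∈ D, WeaklySeparated Y X := fun Y hY ⟨a, b, c, e, h1, h2, h3, h⟩ =>
        hXD Y hY ⟨a, b, c, e, h1, h2, h3, h.symm⟩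
      intro I hI J hJ
      rcases Finset.mem_insert.1 hI with rfl | hI' <;> rcases Finset.mem_insert.1 hJ with rfl | hJ'
      · exact self
      · exact hXD J hJ'
      · exact symm I hI'
      · exact hws I hI' J hJ'
  obtain ⟨K, hK, hcard, heq⟩ := exists_shiftSet_eq (by omega) hk1 (by omega) hD
    (fun I hI => (hmem I hI).2) hfull hsym
  have hdvd := dvd_card_of_shiftSet_eq (by omega) (by omega) hK heq
  rw [← hd] at hdvd
  have hdvd' : (d : ℤ) ∣ K.card := by exact_mod_cast hdvd
  rcases hcard with hc | hc | hc
  · exact ⟨0, by simp, by rw [sub_zero, ← hc]; exact hdvd'⟩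
  · refine ⟨1, by simp, ?_⟩
    rwa [show (k : ℤ) - 1 = K.card by omega]
  · refine ⟨-1, by simp, ?_⟩
    have hdn' : (d : ℤ) ∣ n := by exact_mod_cast hdn
    rw [show (k : ℤ) - -1 = n - K.card by omega]
    exact dvd_sub hdn' hdvd'
end

section
/- With the algorithm setup (n = dℓ): if k = dr + 1 with r ≥ 1, then |B_{ℓ−r}| = k − r. -/
open Finset

/-- `z` lies strictly between `x` and `y` in the cyclic order, where going from a point to
itself means going all the way around. -/
def CyclicBetween (x z y : ℕ) : Prop :=
  (x < z ∧ z < y) ∨ (z < y ∧ y ≤ x) ∨ (y ≤ x ∧ x < z)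

lemma cyclicSucc_eq {P : Finset ℕ} {x y : ℕ} (hy : y ∈ P)
    (h : ∀ z ∈ P, ¬ CyclicBetween x z y) : cyclicSucc P x = y := by
  unfold CyclicBetween at h
  unfold cyclicSucc
  split_ifs with h1 h2
  · have hm := Finset.min'_mem _ h1
    rw [Finset.mem_filter] at hm
    have h3 := h _ hm.1
    have hxy : x < y := by omega
    have h4 : (P.filter (fun y => x < y)).min' h1 ≤ y :=
      Finset.min'_le _ y (Finset.mem_filter.2 ⟨hy, hxy⟩)
    omega
  · have h3 := h _ (Finset.min'_mem P h2)
    have h4 := Finset.min'_le P y hy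
    have h5 : ¬ x < y := fun hxy => h1 ⟨y, Finset.mem_filter.2 ⟨hy, hxy⟩⟩
    omega
  · exact absurd ⟨y, hy⟩ h2

lemma cyclicSucc_mem {P : Finset ℕ} (hP : P.Nonempty) (x : ℕ) : cyclicSucc P x ∈ P := by
  unfold cyclicSucc
  split_ifs with h1
  · exact (Finset.mem_filter.1 (Finset.min'_mem _ h1)).1
  · exact Finset.min'_mem _ _

lemma not_cyclicBetween_cyclicSucc {P : Finset ℕ} {x z : ℕ} (hx : x ∈ P) (hz : z ∈ P) :
    ¬ CyclicBetween x z (cyclicSucc P x) := by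
  unfold CyclicBetween cyclicSucc
  split_ifs with h1 h2
  · have hm := (Finset.mem_filter.1 (Finset.min'_mem _ h1)).2
    have h3 : x < z → (P.filter (fun y => x < y)).min' h1 ≤ z := fun hxz =>
      Finset.min'_le _ z (Finset.mem_filter.2 ⟨hz, hxz⟩)
    omega
  · have h3 := Finset.min'_le P z hz
    have h4 := Finset.min'_le P x hx
    have h5 : ¬ x < z := fun hxz => h1 ⟨z, Finset.mem_filter.2 ⟨hz, hxz⟩⟩
    omega
  · exact absurd ⟨x, hx⟩ h2

lemma cyclicSucc_of_succ_mem {P : Finset ℕ} {x : ℕ} (hx : x + 1 ∈ P) :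
    cyclicSucc P x = x + 1 :=
  cyclicSucc_eq hx fun z _ => by unfold CyclicBetween; omega

lemma iterate_cyclicSucc_of_Icc_subset {P : Finset ℕ} {x j : ℕ}
    (h : Finset.Icc x (x + j) ⊆ P) : (cyclicSucc P)^[j] x = x + j := by
  induction j with
  | zero => rfl
  | succ j ih =>
    rw [Function.iterate_succ_apply', ih ((Finset.Icc_subset_Icc le_rfl (by omega)).trans h)]
    exact cyclicSucc_of_succ_mem (h (Finset.mem_Icc.2 (by omega)))

lemma iterate_cyclicSucc_mem {P : Finset ℕ} {x : ℕ} (hx : x ∈ P) (j : ℕ) :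
    (cyclicSucc P)^[j] x ∈ P := by
  cases j with
  | zero => exact hx
  | succ j =>
    rw [Function.iterate_succ_apply']
    exact cyclicSucc_mem ⟨x, hx⟩ _

/-- `g` reflects the cyclic order on `{0, …, N - 1}`. -/
def ReflectsCyclic (N : ℕ) (g : ℕ → ℕ) : Prop :=
  ∀ ⦃x z y : ℕ⦄, x < N → z < N → y < N →
    CyclicBetween (g x) (g z) (g y) → CyclicBetween x z y

lemma ReflectsCyclic.of_strictMonoOn {N : ℕ} {e : ℕ → ℕ} (he : StrictMonoOn e (Set.Iio N)) :
    ReflectsCyclic N e := by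
  intro x z y hx hz hy
  unfold CyclicBetween
  rw [he.lt_iff_lt hx hz, he.lt_iff_lt hz hy, he.le_iff_le hy hx]
  exact id

lemma add_mod_eq_ite {N x c : ℕ} (hx : x < N) (hc : c < N) :
    (x + c) % N = if x + c < N then x + c else x + c - N := by
  split_ifs with h
  · exact Nat.mod_eq_of_lt h
  · rw [Nat.mod_eq_sub_mod (by omega)]
    exact Nat.mod_eq_of_lt (by omega)

lemma ReflectsCyclic.rotate {N c : ℕ} {e : ℕ → ℕ} (he : ReflectsCyclic N e) (hc : c < N) :
    ReflectsCyclic N (fun x => e ((x + c) % N)) := by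
  intro x z y hx hz hy h
  have hN : 0 < N := by omega
  have h := he (Nat.mod_lt _ hN) (Nat.mod_lt _ hN) (Nat.mod_lt _ hN) h
  rw [add_mod_eq_ite hx hc, add_mod_eq_ite hz hc, add_mod_eq_ite hy hc] at h
  unfold CyclicBetween at h ⊢
  split_ifs at h <;> omega

lemma cyclicSucc_image {N : ℕ} {g : ℕ → ℕ} (hg : ReflectsCyclic N g) {J : Finset ℕ}
    (hJ : J ⊆ Finset.range N) {x : ℕ} (hx : x ∈ J) :
    cyclicSucc (J.image g) (g x) = g (cyclicSucc J x) := by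
  have hs := cyclicSucc_mem ⟨x, hx⟩ x
  refine cyclicSucc_eq (Finset.mem_image_of_mem g hs) fun w hw hb => ?_
  obtain ⟨z, hz, rfl⟩ := Finset.mem_image.1 hw
  exact not_cyclicBetween_cyclicSucc hx hz
    (hg (Finset.mem_range.1 (hJ hx)) (Finset.mem_range.1 (hJ hz)) (Finset.mem_range.1 (hJ hs)) hb)

lemma iterate_cyclicSucc_image {N : ℕ} {g : ℕ → ℕ} (hg : ReflectsCyclic N g) {J : Finset ℕ}
    (hJ : J ⊆ Finset.range N) {x : ℕ} (hx : x ∈ J) (j : ℕ) :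
    (cyclicSucc (J.image g))^[j] (g x) = g ((cyclicSucc J)^[j] x) := by
  induction j with
  | zero => rfl
  | succ j ih =>
    rw [Function.iterate_succ_apply', Function.iterate_succ_apply', ih,
      cyclicSucc_image hg hJ (iterate_cyclicSucc_mem hx j)]

lemma cyclicSucc_range {M x : ℕ} (hx : x < M) :
    cyclicSucc (Finset.range M) x = (x + 1) % M := by
  rcases Nat.lt_or_ge (x + 1) M with h | h
  · rw [Nat.mod_eq_of_lt h]
    exact cyclicSucc_of_succ_mem (Finset.mem_range.2 h)
  · obtain rfl : M = x + 1 := by omega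
    rw [Nat.mod_self]
    refine cyclicSucc_eq (Finset.mem_range.2 (by omega)) fun z hz => ?_
    rw [Finset.mem_range] at hz
    unfold CyclicBetween
    omega

lemma iterate_cyclicSucc_range {M x : ℕ} (hx : x < M) (j : ℕ) :
    (cyclicSucc (Finset.range M))^[j] x = (x + j) % M := by
  induction j with
  | zero => exact (Nat.mod_eq_of_lt hx).symm
  | succ j ih =>
    rw [Function.iterate_succ_apply', ih, cyclicSucc_range (Nat.mod_lt _ (by omega)),
      Nat.mod_add_mod, Nat.add_assoc]

lemma exists_strictMonoOn_image_range (J : Finset ℕ) :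
    ∃ e : ℕ → ℕ, StrictMonoOn e (Set.Iio J.card) ∧ (Finset.range J.card).image e = J := by
  have hf : {x | x ∈ J}.Finite := J.finite_toSet
  have hc : hf.toFinset = J := by ext; simp
  refine ⟨Nat.nth (· ∈ J), ?_, ?_⟩
  · have := Nat.nth_strictMonoOn hf
    rwa [hc] at this
  · have := Nat.image_nth_Iio_card hf
    rw [hc] at this
    apply Finset.coe_injective
    rw [Finset.coe_image, Finset.coe_range, this]
    rfl

lemma injOn_iterate_cyclicSucc {J : Finset ℕ} {x : ℕ} (hx : x ∈ J) :
    Set.InjOn (fun j => (cyclicSucc J)^[j] x) (Set.Iio J.card) := by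
  obtain ⟨e, he, hJ⟩ := exists_strictMonoOn_image_range J
  obtain ⟨i, hi, rfl⟩ := Finset.mem_image.1 (hJ ▸ hx)
  have hi' := Finset.mem_range.1 hi
  have key : ∀ j, (cyclicSucc J)^[j] (e i) = e ((i + j) % J.card) := fun j => by
    have := iterate_cyclicSucc_image (.of_strictMonoOn he) subset_rfl hi j
    rwa [hJ, iterate_cyclicSucc_range hi'] at this
  intro j hj j' hj' h
  simp only [key] at h
  have h := he.injOn (Nat.mod_lt _ (by omega)) (Nat.mod_lt _ (by omega)) h
  simp only [Set.mem_Iio] at hj hj'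
  rw [Nat.add_comm i, Nat.add_comm i, add_mod_eq_ite hj hi', add_mod_eq_ite hj' hi'] at h
  split_ifs at h <;> omega

/-- The first `k` elements of `J` met when going around cyclically from `x`. -/
def cyclicRun (J : Finset ℕ) (k x : ℕ) : Finset ℕ :=
  (Finset.range k).image (fun j => (cyclicSucc J)^[j] x)

lemma cyclicRun_subset {J : Finset ℕ} {x : ℕ} (hx : x ∈ J) (k : ℕ) : cyclicRun J k x ⊆ J := by
  intro y hy
  obtain ⟨j, -, rfl⟩ := Finset.mem_image.1 hy
  exact iterate_cyclicSucc_mem hx j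

lemma card_cyclicRun {J : Finset ℕ} {k x : ℕ} (hx : x ∈ J) (hk : k ≤ J.card) :
    (cyclicRun J k x).card = k := by
  rw [cyclicRun, Finset.card_image_of_injOn, Finset.card_range]
  refine (injOn_iterate_cyclicSucc hx).mono fun j hj => ?_
  have := Finset.mem_range.1 (Finset.mem_coe.1 hj)
  exact lt_of_lt_of_le this hk

lemma cyclicRun_card {J : Finset ℕ} {x : ℕ} (hx : x ∈ J) : cyclicRun J J.card x = J :=
  Finset.eq_of_subset_of_card_le (cyclicRun_subset hx _) (card_cyclicRun hx le_rfl).ge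

lemma mem_cyclicRun_of_Icc_subset {J : Finset ℕ} {k x y : ℕ} (hxy : x ≤ y) (hk : y < x + k)
    (h : Finset.Icc x y ⊆ J) : y ∈ cyclicRun J k x := by
  refine Finset.mem_image.2 ⟨y - x, Finset.mem_range.2 (by omega), ?_⟩
  have hy : x + (y - x) = y := by omega
  rw [iterate_cyclicSucc_of_Icc_subset (by rwa [hy]), hy]

lemma cyclicRun_eq_of_Ico_subset {J : Finset ℕ} {k x : ℕ} (h : Finset.Ico x (x + k) ⊆ J) :
    cyclicRun J k x = (Finset.range k).image (fun j => x + j) := by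
  refine Finset.image_congr fun j hj => ?_
  have hj := Finset.mem_range.1 (Finset.mem_coe.1 hj)
  refine iterate_cyclicSucc_of_Icc_subset fun y hy => h ?_
  rw [Finset.mem_Icc] at hy
  exact Finset.mem_Ico.2 (by omega)

lemma notMem_cyclicRun_succ {J : Finset ℕ} {k x : ℕ} (hx : x + 1 ∈ J) (hk : k < J.card) :
    x ∉ cyclicRun J k (x + 1) := by
  intro h
  obtain ⟨j, hj, hjx⟩ := Finset.mem_image.1 h
  rw [Finset.mem_range] at hj
  have h1 : (cyclicSucc J)^[j + 1] (x + 1) = (cyclicSucc J)^[0] (x + 1) := by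
    rw [Function.iterate_succ_apply', hjx]
    exact cyclicSucc_of_succ_mem hx
  have := injOn_iterate_cyclicSucc hx (show j + 1 < J.card by omega)
    (show 0 < J.card by omega) h1
  omega

lemma cyclicRun_image {N : ℕ} {g : ℕ → ℕ} (hg : ReflectsCyclic N g) {J : Finset ℕ}
    (hJ : J ⊆ Finset.range N) {x : ℕ} (hx : x ∈ J) (k : ℕ) :
    cyclicRun (J.image g) k (g x) = (cyclicRun J k x).image g := by
  rw [cyclicRun, cyclicRun, Finset.image_image]
  exact Finset.image_congr fun j _ => iterate_cyclicSucc_image hg hJ hx j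

/-- The set `{0, …, d(r+1) - 1}` with the last points of all blocks of length `r + 1` from the
`h`-th one on removed. -/
def gapSet (d r h : ℕ) : Finset ℕ :=
  Finset.range (d * (r + 1)) \ (Finset.Ico h d).image (fun j => r + j * (r + 1))

lemma blockEnd_lt {d r j : ℕ} (hj : j < d) : r + j * (r + 1) < d * (r + 1) := by
  have := Nat.mul_le_mul_right (r + 1) (show j + 1 ≤ d from hj)
  rw [Nat.add_mul] at this
  omega

lemma blockEnd_injective (r : ℕ) : Function.Injective (fun j => r + j * (r + 1)) := by
  intro i j h
  exact Nat.eq_of_mul_eq_mul_right (Nat.succ_pos r) (Nat.add_left_cancel h)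

lemma gapSet_subset (d r h : ℕ) : gapSet d r h ⊆ Finset.range (d * (r + 1)) :=
  Finset.sdiff_subset

lemma card_gapSet {d r h : ℕ} (hh : h ≤ d) : (gapSet d r h).card = d * r + h := by
  rw [gapSet, Finset.card_sdiff_of_subset, Finset.card_image_of_injective _ (blockEnd_injective r),
    Finset.card_range, Nat.card_Ico, Nat.mul_succ]
  · omega
  · intro x hx
    obtain ⟨j, hj, rfl⟩ := Finset.mem_image.1 hx
    exact Finset.mem_range.2 (blockEnd_lt (Finset.mem_Ico.1 hj).2)

lemma mem_gapSet_of_lt {d r h x : ℕ} (hx : x < d * (r + 1)) (hxh : x < r + h * (r + 1)) :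
    x ∈ gapSet d r h := by
  refine Finset.mem_sdiff.2 ⟨Finset.mem_range.2 hx, fun hm => ?_⟩
  obtain ⟨j, hj, rfl⟩ := Finset.mem_image.1 hm
  have := Nat.mul_le_mul_right (r + 1) (Finset.mem_Ico.1 hj).1
  omega

lemma blockEnd_notMem_gapSet {d r h j : ℕ} (hhj : h ≤ j) (hj : j < d) :
    r + j * (r + 1) ∉ gapSet d r h := fun hm =>
  (Finset.mem_sdiff.1 hm).2 (Finset.mem_image.2 ⟨j, Finset.mem_Ico.2 ⟨hhj, hj⟩, rfl⟩)

lemma mem_gapSet_of_le {d r h x : ℕ} (hh : 1 ≤ h) (hhd : h ≤ d) (hx : x ≤ r) :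
    x ∈ gapSet d r h := by
  have h1 := Nat.mul_le_mul_right (r + 1) hh
  have h2 := Nat.mul_le_mul_right (r + 1) hhd
  exact mem_gapSet_of_lt (by omega) (by omega)

/-- The runs of length `dr + 1` in `gapSet d r h`, indexed by a single number `m` that encodes
`h` and the starting point. -/
def gapRun (d r m : ℕ) : Finset ℕ :=
  cyclicRun (gapSet d r (m / (r + 1) + 1)) (d * r + 1) (r - m % (r + 1))

lemma gapRun_eq {d r h t : ℕ} (hh : 1 ≤ h) (ht : t ≤ r) :
    gapRun d r ((h - 1) * (r + 1) + (r - t)) = cyclicRun (gapSet d r h) (d * r + 1) t := by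
  have h1 : ((h - 1) * (r + 1) + (r - t)) / (r + 1) = h - 1 := by
    rw [Nat.add_comm, Nat.add_mul_div_right _ _ (by omega), Nat.div_eq_of_lt (by omega)]
    omega
  have h2 : ((h - 1) * (r + 1) + (r - t)) % (r + 1) = r - t := by
    rw [Nat.add_comm, Nat.add_mul_mod_self_right, Nat.mod_eq_of_lt (by omega)]
  rw [gapRun, h1, h2, Nat.sub_add_cancel hh, Nat.sub_sub_self ht]

lemma gapRun_of_le {d r m : ℕ} (hd : 1 ≤ d) (hm : m ≤ r) : gapRun d r m = gapSet d r 1 := by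
  have h := gapRun_eq (d := d) (h := 1) le_rfl (Nat.sub_le r m)
  rw [Nat.sub_self, Nat.zero_mul, Nat.zero_add, Nat.sub_sub_self hm] at h
  rw [h, ← card_gapSet hd]
  exact cyclicRun_card (mem_gapSet_of_le le_rfl hd (Nat.sub_le r m))

lemma exists_mul_add_sub (r m : ℕ) :
    ∃ h t, 1 ≤ h ∧ t ≤ r ∧ m = (h - 1) * (r + 1) + (r - t) := by
  refine ⟨m / (r + 1) + 1, r - m % (r + 1), Nat.succ_pos _, Nat.sub_le _ _, ?_⟩
  have h1 := Nat.div_add_mod' m (r + 1)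
  have h2 := Nat.mod_lt m (show 0 < r + 1 by omega)
  rw [Nat.add_sub_cancel, Nat.sub_sub_self (by omega)]
  exact h1.symm

lemma gapRun_add {d r m : ℕ} (hm : d * r < m + (r + 1)) (hmN : m + (r + 1) < d * (r + 1)) :
    gapRun d r (m + (r + 1)) = gapRun d r m := by
  obtain ⟨h, t, hh, ht, rfl⟩ := exists_mul_add_sub r m
  obtain ⟨h, rfl⟩ := Nat.exists_eq_add_of_le' hh
  have e : (h + 1 - 1) * (r + 1) + (r - t) + (r + 1) = (h + 1 + 1 - 1) * (r + 1) + (r - t) := by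
    simp only [Nat.add_sub_cancel]
    ring
  have hlt : h + 1 < d := by
    by_contra hc
    have := Nat.mul_le_mul_right (r + 1) (show d ≤ h + 1 by omega)
    simp only [Nat.add_sub_cancel, Nat.add_mul] at *
    omega
  have hb := blockEnd_lt (r := r) hlt
  have hsub : ∀ h', h + 1 ≤ h' → Finset.Ico t (t + (d * r + 1)) ⊆ gapSet d r h' := by
    intro h' hh' x hx
    rw [Finset.mem_Ico] at hx
    have := Nat.mul_le_mul_right (r + 1) hh'
    simp only [Nat.add_sub_cancel, Nat.add_mul] at *
    exact mem_gapSet_of_lt (by simp only [Nat.mul_add] at *; omega) (by omega)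
  rw [e, gapRun_eq (by omega) ht, gapRun_eq (by omega) ht,
    cyclicRun_eq_of_Ico_subset (hsub _ (by omega)), cyclicRun_eq_of_Ico_subset (hsub _ le_rfl)]

lemma exists_gapRun_eq {d r m : ℕ} (hd : 1 ≤ d) (hm : m < d * (r + 1)) :
    ∃ m' ∈ Finset.Icc r (d * r), gapRun d r m' = gapRun d r m := by
  have hrd : r ≤ d * r := Nat.le_mul_of_pos_left r hd
  induction m using Nat.strong_induction_on with
  | _ m ih =>
    rcases Nat.le_total m r with h1 | h1
    · exact ⟨r, Finset.mem_Icc.2 ⟨le_rfl, hrd⟩, by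
        rw [gapRun_of_le hd h1, gapRun_of_le hd le_rfl]⟩
    rcases Nat.lt_or_ge (d * r) m with h2 | h2
    · obtain ⟨m, rfl⟩ := Nat.exists_eq_add_of_le' (show r + 1 ≤ m by omega)
      rw [gapRun_add h2 hm]
      exact ih m (by omega) (by omega)
    · exact ⟨m, Finset.mem_Icc.2 ⟨h1, h2⟩, rfl⟩

lemma injOn_gapRun {d r : ℕ} (hd : 1 ≤ d) (hr : 1 ≤ r) :
    Set.InjOn (gapRun d r) (Finset.Icc r (d * r)) := by
  -- The last block end of the gap set belongs to the run, and determines `h`.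
  have key : ∀ h t, 1 ≤ h → t ≤ r → (h - 1) * (r + 1) + (r - t) ≤ d * r →
      h ≤ d ∧ r + (h - 1) * (r + 1) ∈ cyclicRun (gapSet d r h) (d * r + 1) t := by
    intro h t hh ht hm
    obtain ⟨h, rfl⟩ := Nat.exists_eq_add_of_le' hh
    have hhd : h + 1 ≤ d := by
      by_contra hc
      have := Nat.mul_le_mul_right (r + 1) (show d ≤ h by omega)
      simp only [Nat.add_sub_cancel, Nat.mul_add] at *
      omega
    refine ⟨hhd, mem_cyclicRun_of_Icc_subset (by omega) (by omega) fun x hx => ?_⟩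
    have hb := blockEnd_lt (r := r) (show h < d by omega)
    simp only [Nat.add_sub_cancel, Finset.mem_Icc] at *
    exact mem_gapSet_of_lt (by omega) (by rw [Nat.add_mul]; omega)
  have hle : ∀ h t h' t', 1 ≤ h → t ≤ r → 1 ≤ h' → t' ≤ r →
      (h - 1) * (r + 1) + (r - t) ≤ d * r → (h' - 1) * (r + 1) + (r - t') ≤ d * r →
      cyclicRun (gapSet d r h) (d * r + 1) t = cyclicRun (gapSet d r h') (d * r + 1) t' →
      h' ≤ h := by
    intro h t h' t' hh ht hh' ht' hm hm' heq
    by_contra hc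
    obtain ⟨hd1, -⟩ := key h t hh ht hm
    obtain ⟨hd2, hmem⟩ := key h' t' hh' ht' hm'
    rw [← heq] at hmem
    exact blockEnd_notMem_gapSet (by omega) (by omega)
      (cyclicRun_subset (mem_gapSet_of_le hh hd1 ht) _ hmem)
  have hne : ∀ h t t', 2 ≤ h → h ≤ d → t < t' → t' ≤ r →
      cyclicRun (gapSet d r h) (d * r + 1) t ≠ cyclicRun (gapSet d r h) (d * r + 1) t' := by
    intro h t t' hh hhd htt ht' heq
    obtain ⟨x, rfl⟩ : ∃ x, t' = x + 1 := ⟨t' - 1, by omega⟩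
    have hrd : r ≤ d * r := Nat.le_mul_of_pos_left r hd
    refine notMem_cyclicRun_succ (mem_gapSet_of_le (by omega) hhd ht')
      (show d * r + 1 < _ by rw [card_gapSet hhd]; omega) (heq ▸ ?_)
    refine mem_cyclicRun_of_Icc_subset (by omega) (by omega) fun y hy => ?_
    rw [Finset.mem_Icc] at hy
    exact mem_gapSet_of_le (by omega) hhd (by omega)
  intro m hm m' hm' heq
  rw [Finset.mem_coe, Finset.mem_Icc] at hm hm'
  obtain ⟨h, t, hh, ht, rfl⟩ := exists_mul_add_sub r m
  obtain ⟨h', t', hh', ht', rfl⟩ := exists_mul_add_sub r m'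
  rw [gapRun_eq hh ht, gapRun_eq hh' ht'] at heq
  obtain rfl : h = h' := le_antisymm (hle _ _ _ _ hh' ht' hh ht hm'.2 hm.2 heq.symm)
    (hle _ _ _ _ hh ht hh' ht' hm.2 hm'.2 heq)
  rcases Nat.eq_or_lt_of_le hh with rfl | h2
  · simp only [Nat.sub_self, Nat.zero_mul] at *
    omega
  · obtain ⟨hhd, -⟩ := key h t hh ht hm.2
    rcases Nat.lt_trichotomy t t' with hlt | rfl | hlt
    · exact absurd heq (hne h t t' h2 hhd hlt ht')
    · rfl
    · exact absurd heq.symm (hne h t' t h2 hhd hlt ht)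

lemma image_cyclicRun_gapSet {d r : ℕ} (hd : 1 ≤ d) :
    (Finset.range (r + 1) ×ˢ Finset.Icc 1 d).image
      (fun p => cyclicRun (gapSet d r p.2) (d * r + 1) p.1) =
    (Finset.Icc r (d * r)).image (gapRun d r) := by
  ext I
  simp only [Finset.mem_image, Prod.exists, Finset.mem_product, Finset.mem_range]
  constructor
  · rintro ⟨t, h, ⟨ht, hh⟩, rfl⟩
    rw [Finset.mem_Icc] at hh
    rw [← gapRun_eq hh.1 (by omega)]
    have := blockEnd_lt (r := r) (show h - 1 < d by omega)
    exact exists_gapRun_eq hd (by omega)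
  · rintro ⟨m, hm, rfl⟩
    rw [Finset.mem_Icc] at hm
    obtain ⟨h, t, hh, ht, rfl⟩ := exists_mul_add_sub r m
    refine ⟨t, h, ⟨by omega, Finset.mem_Icc.2 ⟨hh, ?_⟩⟩, (gapRun_eq hh ht).symm⟩
    by_contra hc
    have := Nat.mul_le_mul_right (r + 1) (show d ≤ h - 1 by omega)
    rw [Nat.mul_add] at this
    omega

lemma cyclicIntervalTo_image {N : ℕ} {g : ℕ → ℕ} (hg : ReflectsCyclic N g)
    (hinj : Set.InjOn g (Set.Iio N)) {v : ℕ} (hv : v < N) :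
    cyclicIntervalTo ((Finset.range N).image g) (g 0) (g v) =
      (Finset.range (v + 1)).image g := by
  classical
  have key : ∀ j < N, (cyclicSucc ((Finset.range N).image g))^[j] (g 0) = g j := fun j hj => by
    rw [iterate_cyclicSucc_image hg subset_rfl (Finset.mem_range.2 (by omega)),
      iterate_cyclicSucc_range (by omega), Nat.zero_add, Nat.mod_eq_of_lt hj]
  have hex : ∃ m, (cyclicSucc ((Finset.range N).image g))^[m] (g 0) = g v := ⟨v, key v hv⟩
  have hfind : ∀ inst, @Nat.find _ inst hex = v := fun inst => by
    rw [Nat.find_eq_iff]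
    refine ⟨key v hv, fun m hm h => ?_⟩
    rw [key m (by omega)] at h
    have := hinj (show m < N by omega) hv h
    omega
  rw [cyclicIntervalTo, dif_pos hex, hfind]
  refine Finset.image_congr fun j hj => key j ?_
  have := Finset.mem_range.1 (Finset.mem_coe.1 hj)
  omega

lemma mem_orbit_iff {d ℓ b q c : ℕ} (hb : b ∈ Set.Icc 1 ℓ) (hc : c ∈ Set.Icc 1 ℓ)
    (hq : q < d) : c + ℓ * q ∈ orbit d ℓ b ↔ c = b := by
  simp only [Set.mem_Icc] at hb hc
  unfold orbit
  rw [Finset.mem_image]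
  constructor
  · rintro ⟨i, -, hi⟩
    rcases Nat.lt_trichotomy i q with h | rfl | h
    · have := Nat.mul_le_mul_left ℓ (show i + 1 ≤ q from h)
      rw [Nat.mul_add, Nat.mul_comm ℓ i] at this
      omega
    · rw [Nat.mul_comm] at hi
      omega
    · have := Nat.mul_le_mul_left ℓ (show q + 1 ≤ i from h)
      rw [Nat.mul_add, Nat.mul_comm ℓ i] at this
      omega
  · rintro rfl
    exact ⟨q, Finset.mem_range.2 hq, by rw [Nat.mul_comm]⟩

lemma shiftMod_mul {d ℓ j b : ℕ} (hb : b ∈ Set.Icc 1 ℓ) (hj : j < d) :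
    shiftMod (d * ℓ) (j * ℓ) b = b + j * ℓ := by
  simp only [Set.mem_Icc] at hb
  have := Nat.mul_le_mul_right ℓ (show j + 1 ≤ d from hj)
  rw [Nat.add_mul] at this
  rw [shiftMod, Nat.mod_eq_of_lt (by omega)]
  omega

/-- A cyclic parametrization of `P_s` in which `a_s + jℓ` is the end of the `j`-th block. -/
lemma exists_cyclic_param {d ℓ r : ℕ} (hd : 1 ≤ d) (hrl : r < ℓ) {a : ℕ → ℕ}
    (ha : Set.BijOn a (Set.Icc 1 ℓ) (Set.Icc 1 ℓ)) :
    ∃ g : ℕ → ℕ, ReflectsCyclic (d * (r + 1)) g ∧ Set.InjOn g (Set.Iio (d * (r + 1))) ∧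
      (Finset.range (d * (r + 1))).image g = Pset d ℓ a (ℓ - r) ∧
      ∀ j < d, g (r + j * (r + 1)) = a (ℓ - r) + j * ℓ := by
  have hs : ℓ - r ∈ Set.Icc 1 ℓ := by simp only [Set.mem_Icc]; omega
  set U : Finset ℕ := (Finset.Icc (ℓ - r) ℓ).image a with hU
  have hIcc : ∀ {i}, i ∈ Finset.Icc (ℓ - r) ℓ → i ∈ Set.Icc 1 ℓ := fun {i} hi => by
    rw [Finset.mem_Icc] at hi
    simp only [Set.mem_Icc]
    omega
  have hcard : U.card = r + 1 := by
    rw [hU, Finset.card_image_of_injOn (ha.injOn.mono fun i hi => hIcc (Finset.mem_coe.1 hi)),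
      Nat.card_Icc]
    omega
  have hUl : ∀ c ∈ U, c ∈ Set.Icc 1 ℓ := fun c hc => by
    obtain ⟨i, hi, rfl⟩ := Finset.mem_image.1 hc
    exact ha.mapsTo (hIcc hi)
  obtain ⟨α, hα, hαU⟩ := exists_strictMonoOn_image_range U
  rw [hcard] at hα hαU
  have hαmem : ∀ i < r + 1, α i ∈ U := fun i hi =>
    hαU ▸ Finset.mem_image_of_mem α (Finset.mem_range.2 hi)
  obtain ⟨u, hu, hau⟩ : ∃ u < r + 1, α u = a (ℓ - r) := by
    have : a (ℓ - r) ∈ U := Finset.mem_image_of_mem a (Finset.mem_Icc.2 ⟨le_rfl, by omega⟩)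
    rw [← hαU] at this
    obtain ⟨u, hu, h⟩ := Finset.mem_image.1 this
    exact ⟨u, Finset.mem_range.1 hu, h⟩
  set e : ℕ → ℕ := fun q => α (q % (r + 1)) + ℓ * (q / (r + 1)) with he
  have heval : ∀ i j, i < r + 1 → e (i + j * (r + 1)) = α i + j * ℓ := fun i j hi => by
    simp only [he]
    rw [Nat.add_mul_mod_self_right, Nat.mod_eq_of_lt hi, Nat.add_mul_div_right _ _ (by omega),
      Nat.div_eq_of_lt hi, Nat.zero_add, Nat.mul_comm]
  have hmono : StrictMono e := by
    intro x y hxy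
    have hx := Nat.mod_lt x (show 0 < r + 1 by omega)
    have hy := Nat.mod_lt y (show 0 < r + 1 by omega)
    have h1 := hUl _ (hαmem _ hx)
    have h2 := hUl _ (hαmem _ hy)
    simp only [Set.mem_Icc] at h1 h2
    rcases Nat.eq_or_lt_of_le (Nat.div_le_div_right (c := r + 1) hxy.le) with h | h
    · have h3 : x % (r + 1) < y % (r + 1) := by
        have hx' := Nat.div_add_mod x (r + 1)
        have hy' := Nat.div_add_mod y (r + 1)
        rw [h] at hx'
        omega
      have := hα hx hy h3
      simp only [he, h]
      omega
    · have := Nat.mul_le_mul_left ℓ (show x / (r + 1) + 1 ≤ y / (r + 1) from h)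
      rw [Nat.mul_add] at this
      simp only [he]
      omega
  have himage : (Finset.range (d * (r + 1))).image e = Pset d ℓ a (ℓ - r) := by
    ext x
    simp only [Pset, Finset.mem_sdiff, Finset.mem_biUnion, not_exists, not_and]
    constructor
    · intro hx
      obtain ⟨q, hq, rfl⟩ := Finset.mem_image.1 hx
      have hqd : q / (r + 1) < d := Nat.div_lt_of_lt_mul (by
        rw [Nat.mul_comm]; exact Finset.mem_range.1 hq)
      have hmem := hαmem _ (Nat.mod_lt q (Nat.succ_pos r))
      have hin := hUl _ hmem
      refine ⟨?_, fun i hi ho => ?_⟩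
      · have := Nat.mul_le_mul_left ℓ (show q / (r + 1) + 1 ≤ d from hqd)
        rw [Nat.mul_add, Nat.mul_comm ℓ d] at this
        simp only [Set.mem_Icc] at hin
        simp only [he, Finset.mem_Icc]
        omega
      · rw [Finset.mem_Icc] at hi
        have hi' : i ∈ Set.Icc 1 ℓ := by simp only [Set.mem_Icc]; omega
        have heq := (mem_orbit_iff (ha.mapsTo hi') hin hqd).1 ho
        obtain ⟨i', hi2, hai⟩ := Finset.mem_image.1 hmem
        have := ha.injOn (hIcc hi2) hi' (hai.trans heq)
        rw [Finset.mem_Icc] at hi2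
        omega
    · rintro ⟨hx, hno⟩
      rw [Finset.mem_Icc] at hx
      have hdm := Nat.div_add_mod (x - 1) ℓ
      have hml := Nat.mod_lt (x - 1) (show 0 < ℓ by omega)
      have hqd : (x - 1) / ℓ < d := Nat.div_lt_of_lt_mul (by rw [Nat.mul_comm]; omega)
      have hc : (x - 1) % ℓ + 1 ∈ Set.Icc 1 ℓ := by simp only [Set.mem_Icc]; omega
      obtain ⟨i, hi, hai⟩ := ha.surjOn hc
      have hxo : x = a i + ℓ * ((x - 1) / ℓ) := by omega
      have hiU : a i ∈ U := by
        refine Finset.mem_image_of_mem a (Finset.mem_Icc.2 ?_)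
        simp only [Set.mem_Icc] at hi
        refine ⟨?_, hi.2⟩
        by_contra hlt
        refine hno i (Finset.mem_Icc.2 (by omega)) ?_
        rw [hxo]
        exact (mem_orbit_iff (hai ▸ hc) (hai ▸ hc) hqd).2 rfl
      rw [← hαU] at hiU
      obtain ⟨v, hv, hvi⟩ := Finset.mem_image.1 hiU
      rw [Finset.mem_range] at hv
      refine Finset.mem_image.2 ⟨v + (x - 1) / ℓ * (r + 1), Finset.mem_range.2 ?_, ?_⟩
      · have := blockEnd_lt (r := r) hqd
        omega
      · rw [heval _ _ hv, hvi, Nat.mul_comm, ← hxo]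
  have hN : 0 < d * (r + 1) := Nat.mul_pos hd (Nat.succ_pos r)
  have hNr : r < d * (r + 1) := by
    have := blockEnd_lt (r := r) (show 0 < d from hd)
    omega
  obtain ⟨c, hcN, hc⟩ : ∃ c < d * (r + 1), (r + c) % (d * (r + 1)) = u := by
    rcases Nat.lt_or_ge u r with h | h
    · refine ⟨d * (r + 1) + u - r, by omega, ?_⟩
      rw [show r + (d * (r + 1) + u - r) = u + d * (r + 1) by omega, Nat.add_mod_right,
        Nat.mod_eq_of_lt (by omega)]
    · refine ⟨0, hN, ?_⟩
      rw [Nat.add_zero, Nat.mod_eq_of_lt hNr]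
      omega
  have hrot : Set.InjOn (fun x => (x + c) % (d * (r + 1))) (Set.Iio (d * (r + 1))) := by
    intro x hx y hy hxy
    simp only [Set.mem_Iio] at hx hy
    simp only [add_mod_eq_ite hx hcN, add_mod_eq_ite hy hcN] at hxy
    split_ifs at hxy <;> omega
  refine ⟨fun x => e ((x + c) % (d * (r + 1))),
    (ReflectsCyclic.of_strictMonoOn (hmono.strictMonoOn _)).rotate hcN,
    fun x hx y hy hxy => hrot hx hy (hmono.injective hxy), ?_, fun j hj => ?_⟩
  · rw [← himage, ← Function.comp_def e, ← Finset.image_image]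
    congr 1
    refine Finset.eq_of_subset_of_card_le (fun y hy => ?_) ?_
    · obtain ⟨x, -, rfl⟩ := Finset.mem_image.1 hy
      exact Finset.mem_range.2 (Nat.mod_lt _ hN)
    · rw [Finset.card_image_of_injOn (by rwa [Finset.coe_range])]
  · have hb := blockEnd_lt (r := r) hj
    simp only
    rw [show r + j * (r + 1) + c = (r + c) + j * (r + 1) by omega, ← Nat.mod_add_mod, hc,
      Nat.mod_eq_of_lt (by omega), heval _ _ hu, hau]

/-- With the algorithm setup (`n = dℓ`): if `k = dr + 1` with `r ≥ 1`,
then `|B_{ℓ−r}| = k − r`. -/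
theorem stmt7 (d ℓ k : ℕ) (hd : 1 ≤ d) (hl : 1 ≤ ℓ) (hk1 : 1 ≤ k) (hk2 : 2 * k ≤ d * ℓ)
    (a : ℕ → ℕ) (ha : Set.BijOn a (Set.Icc 1 ℓ) (Set.Icc 1 ℓ))
    (r : ℕ) (hr : 1 ≤ r) (hk : k = d * r + 1) :
    (Bset d ℓ k a (ℓ - r)).card = k - r := by
  have hrl : r < ℓ := by
    by_contra hc
    have := Nat.mul_le_mul_left d (show ℓ ≤ r by omega)
    omega
  obtain ⟨g, hg, hinj, hP, hblock⟩ := exists_cyclic_param hd hrl ha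
  have hs : ℓ - r ∈ Set.Icc 1 ℓ := by simp only [Set.mem_Icc]; omega
  have has := ha.mapsTo hs
  have hN : 0 < d * (r + 1) := Nat.mul_pos hd (Nat.succ_pos r)
  have hNr : r < d * (r + 1) := by
    have := blockEnd_lt (r := r) (show 0 < d from hd)
    omega
  have h0 : g r = a (ℓ - r) := by simpa using hblock 0 hd
  have hlast : g (d * (r + 1) - 1) = shiftMod (d * ℓ) (d * ℓ - ℓ) (a (ℓ - r)) := by
    rw [← Nat.sub_one_mul d ℓ, shiftMod_mul has (by omega), ← hblock _ (by omega)]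
    congr 1
    rw [Nat.sub_mul]
    have := Nat.mul_le_mul_right (r + 1) hd
    omega
  have hstart : cyclicSucc (Pset d ℓ a (ℓ - r))
      (shiftMod (d * ℓ) (d * ℓ - ℓ) (a (ℓ - r))) = g 0 := by
    rw [← hlast, ← hP, cyclicSucc_image hg subset_rfl (Finset.mem_range.2 (by omega)),
      cyclicSucc_range (by omega), Nat.sub_add_cancel hN, Nat.mod_self]
  have hPsh : ∀ h, Psh d ℓ a (ℓ - r) h = (gapSet d r h).image g := fun h => by
    rw [gapSet, Finset.image_sdiff_of_injOn (by rwa [Finset.coe_range]), hP, Psh,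
      Finset.image_image]
    · congr 1
      refine Finset.image_congr fun j hj => ?_
      have hjd := (Finset.mem_Ico.1 (Finset.mem_coe.1 hj)).2
      simp only [Function.comp_apply]
      rw [shiftMod_mul has hjd, hblock j hjd]
    · intro x hx
      obtain ⟨j, hj, rfl⟩ := Finset.mem_image.1 hx
      exact Finset.mem_range.2 (blockEnd_lt (Finset.mem_Ico.1 hj).2)
  have hrun : ∀ t ≤ r, ∀ h, 1 ≤ h → h ≤ d →
      Iih d ℓ k a (ℓ - r) h (g t) = (cyclicRun (gapSet d r h) (d * r + 1) t).image g := by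
    intro t ht h hh hhd
    rw [← cyclicRun_image hg (gapSet_subset d r h) (mem_gapSet_of_le hh hhd ht), ← hPsh, ← hk]
    rfl
  have hsub : ∀ t ≤ r, ∀ h, 1 ≤ h → h ≤ d →
      cyclicRun (gapSet d r h) (d * r + 1) t ⊆ Finset.range (d * (r + 1)) :=
    fun t ht h hh hhd =>
      (cyclicRun_subset (mem_gapSet_of_le hh hhd ht) _).trans (gapSet_subset d r h)
  have hB : Bset d ℓ k a (ℓ - r) =
      ((Finset.Icc r (d * r)).image (gapRun d r)).image (fun I => I.image g) := by
    rw [← image_cyclicRun_gapSet hd, Bset, hstart, ← h0, ← hP,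
      cyclicIntervalTo_image hg hinj hNr, Finset.filter_true_of_mem]
    · ext I
      simp only [Finset.mem_image, Finset.mem_product, Prod.exists, Finset.mem_range,
        Finset.mem_Icc]
      constructor
      · rintro ⟨_, h, ⟨⟨t, ht, rfl⟩, hh⟩, rfl⟩
        exact ⟨_, ⟨t, h, ⟨ht, hh⟩, rfl⟩, (hrun t (by omega) h hh.1 hh.2).symm⟩
      · rintro ⟨_, ⟨t, h, ⟨ht, hh⟩, rfl⟩, rfl⟩
        exact ⟨_, h, ⟨⟨t, ht, rfl⟩, hh⟩, hrun t (by omega) h hh.1 hh.2⟩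
    · intro I hI
      simp only [Finset.mem_image, Finset.mem_product, Prod.exists, Finset.mem_range,
        Finset.mem_Icc] at hI
      obtain ⟨_, h, ⟨⟨t, ht, rfl⟩, hh⟩, rfl⟩ := hI
      rw [hrun t (by omega) h hh.1 hh.2, Finset.card_image_of_injOn, card_cyclicRun, hk]
      · exact mem_gapSet_of_le hh.1 hh.2 (by omega)
      · rw [card_gapSet hh.2]
        omega
      · exact hinj.mono fun x hx => Finset.mem_range.1 (hsub t (by omega) h hh.1 hh.2 hx)
  rw [hB, Finset.card_image_of_injOn, Finset.card_image_of_injOn (injOn_gapRun hd hr),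
    Nat.card_Icc, hk]
  intro I hI J hJ hIJ
  rw [← image_cyclicRun_gapSet hd] at hI hJ
  simp only [Finset.coe_image, Set.mem_image, Finset.mem_coe, Finset.mem_product, Prod.exists,
    Finset.mem_range, Finset.mem_Icc] at hI hJ
  obtain ⟨t, h, ⟨ht, hh⟩, rfl⟩ := hI
  obtain ⟨t', h', ⟨ht', hh'⟩, rfl⟩ := hJ
  have hs1 := hsub t (by omega) h hh.1 hh.2
  have hs2 := hsub t' (by omega) h' hh'.1 hh'.2
  rw [← Finset.coe_subset, Finset.coe_range] at hs1 hs2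
  have hIJ := congrArg (fun S : Finset ℕ => (S : Set ℕ)) hIJ
  simp only [Finset.coe_image] at hIJ
  exact Finset.coe_injective ((hinj.image_eq_image_iff hs1 hs2).1 hIJ)
end
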